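/- There exist absolute constants C ≥ 1, C₀ ≥ 1 and c > 0 such that the following holds. Let p be a prime, α ∈ (0,1), A ⊆ F_p a finite set with |A| ≤ p, and L a set of lines y = mx + b in F_p² with nonzero slopes m such that |L| = |A|, every line of L contains at least α|A| points of the grid A×A, and α|A| ≥ C₀·|A|^(1/2)·max{1, |A|/p^(1/2)}. Then either (a) some slope m₀ is shared by at least c·α^C·|A| lines of L, E⁺(A) ≥ c·α^C·|A|³, and the set B of y-intercepts of the lines in L satisfies E⁺(B) ≥ c·α^C·|A|³; or (b) some point of F_p² lies on at least c·α^C·|A| lines of L, there exists s ∈ F_p with E^×(A−s) ≥ c·α^C·|A|³, and the set D of slopes of the lines in L satisfies E^×(D) ≥ c·α^C·|A|³. -/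

import Mathlib

/-- Additive energy `E⁺(A,B) = #{(a,a',b,b') ∈ A×A×B×B : a − b = a' − b'}`. -/
noncomputable def addE (p : ℕ) (A B : Finset (ZMod p)) : ℕ :=
  Set.ncard {x : ZMod p × ZMod p × ZMod p × ZMod p |
    x.1 ∈ A ∧ x.2.1 ∈ A ∧ x.2.2.1 ∈ B ∧ x.2.2.2 ∈ B ∧ x.1 - x.2.2.1 = x.2.1 - x.2.2.2}

/-- Multiplicative energy `E^×(A,B) = #{(a,a',b,b') ∈ A×A×B×B : a·b' = a'·b}`. -/
noncomputable def mulE (p : ℕ) (A B : Finset (ZMod p)) : ℕ :=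
  Set.ncard {x : ZMod p × ZMod p × ZMod p × ZMod p |
    x.1 ∈ A ∧ x.2.1 ∈ A ∧ x.2.2.1 ∈ B ∧ x.2.2.2 ∈ B ∧ x.1 * x.2.2.2 = x.2.1 * x.2.2.1}


section
open Finset

namespace RL

/-- fibre counting -/
lemma card_mul_le_of_fibers {E Z : Type*} [DecidableEq Z] (C : Finset Z) (D : Finset E)
    (f : E → Z) (k : ℝ) (h : ∀ z ∈ C, k ≤ ((D.filter fun e => f e = z).card : ℝ)) :
    (C.card : ℝ) * k ≤ (D.card : ℝ) := by
  have h1 : (∑ z ∈ C, ((D.filter fun e => f e = z).card : ℝ)) ≤ D.card := by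
    have : ∑ z ∈ C, (D.filter fun e => f e = z).card ≤ D.card := by
      classical
      rw [← Finset.card_biUnion]
      · apply Finset.card_le_card
        intro e he
        simp only [Finset.mem_biUnion, Finset.mem_filter] at he
        obtain ⟨_, _, h, _⟩ := he
        exact h
      · intro x _ y _ hxy
        rw [Function.onFun, Finset.disjoint_left]
        intro e he he2
        simp only [Finset.mem_filter] at he he2
        exact hxy (he.2.symm.trans he2.2)
    exact_mod_cast this
  have h2 := Finset.sum_le_sum h
  simp only [Finset.sum_const, nsmul_eq_mul] at h2
  linarith

/-- averaging: some fibre is large -/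
lemma exists_large_fiber {E Z : Type*} [DecidableEq Z] (C : Finset Z) (D : Finset E)
    (f : E → Z) (hf : ∀ e ∈ D, f e ∈ C) (hD : D.Nonempty) :
    ∃ z ∈ C, (D.card : ℝ) ≤ (C.card : ℝ) * ((D.filter fun e => f e = z).card : ℝ) := by
  by_contra hcon
  push Not at hcon
  have h1 : (D.card : ℝ) = ∑ z ∈ C, ((D.filter fun e => f e = z).card : ℝ) := by
    exact_mod_cast Finset.card_eq_sum_card_fiberwise hf
  obtain ⟨e, he⟩ := hD
  have hC : C.Nonempty := ⟨_, hf e he⟩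
  have hCp : (0:ℝ) < C.card := by exact_mod_cast hC.card_pos
  have h2 : ∑ z ∈ C, ((D.filter fun e => f e = z).card : ℝ) < ∑ z ∈ C, (D.card : ℝ) / C.card := by
    apply Finset.sum_lt_sum_of_nonempty hC
    intro z hz
    rw [lt_div_iff₀ hCp, mul_comm]
    exact hcon z hz
  simp only [Finset.sum_const, nsmul_eq_mul] at h2
  rw [mul_div_cancel₀ _ hCp.ne'] at h2
  linarith

/-- common neighbours -/
noncomputable def cn {X Y : Type*} (t : Finset Y) (r : X → Y → Prop) (x u : X) : ℝ :=
  by classical exact ((t.filter fun y => r x y ∧ r u y).card : ℝ)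

lemma gowers {X Y : Type*} (s : Finset X) (t : Finset Y) (r : X → Y → Prop)
    [∀ x y, Decidable (r x y)] (δ : ℝ) (hδ : 0 < δ) (ht : t.Nonempty)
    (h : δ * s.card * t.card ≤ ∑ x ∈ s, ((t.filter fun y => r x y).card : ℝ)) :
    ∃ s0 ⊆ s, ∃ s' ⊆ s0, δ / 2 * s.card ≤ (s'.card : ℝ) ∧
      ∀ x1 ∈ s', ∀ x2 ∈ s', ∃ w ⊆ s0, (s0.card : ℝ) / 2 ≤ w.card ∧
        ∀ u ∈ w, δ ^ 2 / 64 * t.card ≤ cn t r x1 u ∧ δ ^ 2 / 64 * t.card ≤ cn t r x2 u := by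
  classical
  have htp : (0:ℝ) < t.card := by exact_mod_cast ht.card_pos
  set θ : ℝ := δ ^ 2 / 64 * t.card with hθ
  -- bad pairs
  let bad : X → X → Prop := fun x u => cn t r x u < θ
  let Xy : Y → Finset X := fun y => s.filter fun x => r x y
  let B : Y → ℝ := fun y => ∑ x ∈ Xy y, (((Xy y).filter fun u => bad x u).card : ℝ)
  -- sum of sizes
  have hs1 : ∑ y ∈ t, ((Xy y).card : ℝ) = ∑ x ∈ s, ((t.filter fun y => r x y).card : ℝ) := by
    have : ∑ y ∈ t, (Xy y).card = ∑ x ∈ s, (t.filter fun y => r x y).card := by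
      simp only [Xy, Finset.card_filter]
      rw [Finset.sum_comm]
    exact_mod_cast this
  have hs2 : (δ * s.card) ^ 2 * t.card ≤ ∑ y ∈ t, ((Xy y).card : ℝ) ^ 2 := by
    have hcs := sq_sum_le_card_mul_sum_sq (s := t) (f := fun y => ((Xy y).card : ℝ))
    rw [hs1] at hcs
    have h0 : 0 ≤ δ * s.card * t.card := by positivity
    have h3 : (δ * s.card * t.card) ^ 2 ≤ (∑ x ∈ s, ((t.filter fun y => r x y).card : ℝ)) ^ 2 :=
      pow_le_pow_left₀ h0 h 2
    have h4 : t.card * ((δ * s.card) ^ 2 * t.card) ≤ t.card * ∑ y ∈ t, ((Xy y).card : ℝ) ^ 2 := by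
      nlinarith
    exact le_of_mul_le_mul_left h4 htp
  have hB : ∑ y ∈ t, B y ≤ θ * (s.card : ℝ) ^ 2 := by
    have e1 : ∑ y ∈ t, B y = ∑ x ∈ s, ∑ u ∈ s, if bad x u then cn t r x u else 0 := by
      have : ∀ y ∈ t, B y = ∑ x ∈ s, ∑ u ∈ s,
          if bad x u then (if r x y ∧ r u y then (1:ℝ) else 0) else 0 := by
        intro y _
        simp only [B, Xy]
        rw [Finset.sum_filter]
        apply Finset.sum_congr rfl
        intro x _
        split_ifs with hx
        · rw [Finset.filter_filter, Finset.card_filter]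
          push_cast
          apply Finset.sum_congr rfl
          intro u _
          by_cases h1 : r u y <;> by_cases h2 : bad x u <;> simp [h1, h2, hx]
        · simp [hx]
      rw [Finset.sum_congr rfl this, Finset.sum_comm]
      apply Finset.sum_congr rfl
      intro x _
      rw [Finset.sum_comm]
      apply Finset.sum_congr rfl
      intro u _
      split_ifs with hb
      · simp only [cn, Finset.card_filter]
        push_cast
        apply Finset.sum_congr rfl
        intro y _
        congr
      · simp
    rw [e1]
    have hθ0 : 0 ≤ θ := by positivity
    calc _ ≤ ∑ x ∈ s, ∑ u ∈ s, θ := by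
          apply Finset.sum_le_sum; intro x _
          apply Finset.sum_le_sum; intro u _
          split_ifs with hb
          · exact hb.le
          · exact hθ0
      _ = θ * (s.card : ℝ) ^ 2 := by simp; ring
  obtain ⟨y, hy, hyy⟩ : ∃ y ∈ t, (δ * s.card) ^ 2 / 2 ≤ ((Xy y).card : ℝ) ^ 2 - 32 * B y := by
    apply Finset.exists_le_of_sum_le ht
    rw [Finset.sum_sub_distrib, ← Finset.mul_sum]
    simp only [Finset.sum_const, nsmul_eq_mul]
    have : θ * (s.card : ℝ) ^ 2 = (δ * s.card) ^ 2 * t.card / 64 := by rw [hθ]; ring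
    nlinarith
  have hB0 : 0 ≤ B y := by
    apply Finset.sum_nonneg; intros; positivity
  set n : ℝ := ((Xy y).card : ℝ) with hn
  have hn0 : 0 ≤ n := by positivity
  have hBn : 32 * B y ≤ n ^ 2 := by nlinarith [sq_nonneg (δ * s.card)]
  have hnbig : (δ * s.card) ^ 2 / 2 ≤ n ^ 2 := by linarith
  let S' := (Xy y).filter fun x => (((Xy y).filter fun u => bad x u).card : ℝ) ≤ n / 4
  refine ⟨Xy y, Finset.filter_subset _ _, S', Finset.filter_subset _ _, ?_, ?_⟩
  · -- size
    have hrem : ((((Xy y).filter fun x => ¬ ((((Xy y).filter fun u => bad x u).card : ℝ) ≤ n / 4)).card : ℝ)) * (n / 4) ≤ B y := by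
      have := Finset.sum_le_sum_of_subset_of_nonneg (f := fun x => (((Xy y).filter fun u => bad x u).card : ℝ))
        (Finset.filter_subset (fun x => ¬ ((((Xy y).filter fun u => bad x u).card : ℝ) ≤ n / 4)) (Xy y))
        (by intros; positivity)
      refine le_trans ?_ this
      rw [← nsmul_eq_mul]
      apply Finset.card_nsmul_le_sum
      intro x hx
      rw [Finset.mem_filter] at hx
      linarith [hx.2]
    have hsum : (S'.card : ℝ) + (((Xy y).filter fun x => ¬ ((((Xy y).filter fun u => bad x u).card : ℝ) ≤ n / 4)).card : ℝ) = n := by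
      rw [hn]
      exact_mod_cast Finset.card_filter_add_card_filter_not (s := Xy y) _
    rcases hn0.eq_or_lt with h0 | hpos
    · rw [← h0] at hnbig
      have : δ * s.card = 0 := by
        have : (δ * s.card) ^ 2 ≤ 0 := by nlinarith
        exact pow_eq_zero_iff (two_ne_zero) |>.1 (le_antisymm this (sq_nonneg _))
      have h3 : δ / 2 * s.card = 0 := by linarith
      rw [h3]; positivity
    · set q := (((Xy y).filter fun x => ¬ ((((Xy y).filter fun u => bad x u).card : ℝ) ≤ n / 4)).card : ℝ)
      have hq : q ≤ n / 8 := by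
        by_contra hc
        push Not at hc
        nlinarith
      have h0 : 0 ≤ δ * s.card := by positivity
      have : δ / 2 * s.card ≤ 7 / 8 * n := by
        by_contra hc
        push Not at hc
        have : (7 / 8 * n) ^ 2 < (δ / 2 * s.card) ^ 2 := by
          apply pow_lt_pow_left₀ hc (by positivity) (by norm_num)
        nlinarith
      linarith
  · intro x1 hx1 x2 hx2
    refine ⟨(Xy y).filter fun u => ¬ bad x1 u ∧ ¬ bad x2 u, Finset.filter_subset _ _, ?_, ?_⟩
    · have h1 := (Finset.mem_filter.1 hx1).2
      have h2 := (Finset.mem_filter.1 hx2).2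
      have hcov : Xy y ⊆ ((Xy y).filter fun u => ¬ bad x1 u ∧ ¬ bad x2 u) ∪
          (((Xy y).filter fun u => bad x1 u) ∪ ((Xy y).filter fun u => bad x2 u)) := by
        intro u hu
        simp only [Finset.mem_union, Finset.mem_filter]
        tauto
      have h3 := (Finset.card_le_card hcov).trans ((Finset.card_union_le _ _).trans
        (Nat.add_le_add_left (Finset.card_union_le _ _) _))
      have h4 : n ≤ (((Xy y).filter fun u => ¬ bad x1 u ∧ ¬ bad x2 u).card : ℝ) +
        ((((Xy y).filter fun u => bad x1 u).card : ℝ) + (((Xy y).filter fun u => bad x2 u).card : ℝ)) := by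
        rw [hn]; exact_mod_cast h3
      linarith
    · intro u hu
      have := (Finset.mem_filter.1 hu).2
      simp only [bad, not_lt] at this
      exact this

end RL
end

section
open Finset

namespace RL

/-- invertible affine maps of `F_p` -/
@[ext] structure Aff (p : ℕ) where
  m : (ZMod p)ˣ
  b : ZMod p

namespace Aff
variable {p : ℕ}

instance : Mul (Aff p) := ⟨fun g h => ⟨g.m * h.m, g.m * h.b + g.b⟩⟩
instance : One (Aff p) := ⟨⟨1, 0⟩⟩
instance : Inv (Aff p) := ⟨fun g => ⟨g.m⁻¹, - ((g.m⁻¹ : (ZMod p)ˣ) * g.b)⟩⟩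

@[simp] lemma mul_m (g h : Aff p) : (g * h).m = g.m * h.m := rfl
@[simp] lemma mul_b (g h : Aff p) : (g * h).b = g.m * h.b + g.b := rfl
@[simp] lemma one_m : (1 : Aff p).m = 1 := rfl
@[simp] lemma one_b : (1 : Aff p).b = 0 := rfl
@[simp] lemma inv_m (g : Aff p) : (g⁻¹).m = g.m⁻¹ := rfl
@[simp] lemma inv_b (g : Aff p) : (g⁻¹).b = - ((g.m⁻¹ : (ZMod p)ˣ) * g.b) := rfl

instance : Group (Aff p) where
  mul_assoc a b c := by
    ext
    · simp [mul_assoc]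
    · simp; ring
  one_mul a := by ext <;> simp
  mul_one a := by ext <;> simp
  inv_mul_cancel a := by ext <;> simp

noncomputable instance : DecidableEq (Aff p) := Classical.decEq _

def equivProd (p : ℕ) : Aff p ≃ (ZMod p)ˣ × ZMod p where
  toFun g := (g.m, g.b)
  invFun x := ⟨x.1, x.2⟩
  left_inv _ := rfl
  right_inv _ := rfl

noncomputable instance [NeZero p] : Fintype (Aff p) := Fintype.ofEquiv _ (equivProd p).symm

/-- the action -/
def act (g : Aff p) (x : ZMod p) : ZMod p := g.m * x + g.b

lemma act_mul (g h : Aff p) (x : ZMod p) : (g * h).act x = g.act (h.act x) := by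
  simp [act]; ring
@[simp] lemma act_one (x : ZMod p) : (1 : Aff p).act x = x := by simp [act]
@[simp] lemma act_inv_act (g : Aff p) (x : ZMod p) : g⁻¹.act (g.act x) = x := by
  rw [← act_mul]; simp
@[simp] lemma act_act_inv (g : Aff p) (x : ZMod p) : g.act (g⁻¹.act x) = x := by
  rw [← act_mul]; simp
lemma act_inj (g : Aff p) : Function.Injective g.act := fun x y h => by
  have := congrArg g⁻¹.act h
  simpa using this

lemma eq_of_act [Fact p.Prime] {g h : Aff p} {x y : ZMod p} (hxy : x ≠ y) (h1 : g.act x = h.act x)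
    (h2 : g.act y = h.act y) : g = h := by
  simp only [act] at h1 h2
  have h3 : ((g.m : ZMod p) - h.m) * (x - y) = 0 := by linear_combination h1 - h2
  have h4 : (g.m : ZMod p) = h.m := by
    rcases mul_eq_zero.mp h3 with h | h
    · exact sub_eq_zero.mp h
    · exact absurd (sub_eq_zero.mp h) hxy
  ext
  · exact h4
  · rw [h4] at h1; exact add_left_cancel h1

lemma eq_of_m_act {g h : Aff p} {x : ZMod p} (hm : g.m = h.m) (h1 : g.act x = h.act x) : g = h := by
  simp only [act, hm] at h1
  ext
  · rw [hm]
  · exact add_left_cancel h1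

end Aff

set_option linter.unusedSectionVars false

variable {p : ℕ} [Fact p.Prime]

/-- points of `A` sent into `A` -/
noncomputable def good (A : Finset (ZMod p)) (g : Aff p) : Finset (ZMod p) :=
  A.filter fun a => g.act a ∈ A

lemma mem_good {A : Finset (ZMod p)} {g : Aff p} {a : ZMod p} :
    a ∈ good A g ↔ a ∈ A ∧ g.act a ∈ A := by simp [good]

/-- `β`-rich transformations -/
noncomputable def S (A : Finset (ZMod p)) (β : ℝ) : Finset (Aff p) := by
  classical exact univ.filter fun g => β * (A.card : ℝ) ≤ ((good A g).card : ℝ)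

lemma mem_S {A : Finset (ZMod p)} {β : ℝ} {g : Aff p} :
    g ∈ S A β ↔ β * (A.card : ℝ) ≤ ((good A g).card : ℝ) := by simp [S]

lemma S_mono {A : Finset (ZMod p)} {β β' : ℝ} (h : β' ≤ β) : S A β ⊆ S A β' := by
  intro g hg
  rw [mem_S] at *
  refine le_trans ?_ hg
  gcongr

lemma good_inv_card (A : Finset (ZMod p)) (g : Aff p) : (good A g⁻¹).card = (good A g).card := by
  symm
  apply Finset.card_bij (fun a _ => g.act a)
  · intro a ha
    rw [mem_good] at *
    exact ⟨ha.2, by simpa using ha.1⟩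
  · intro a _ b _ h
    exact g.act_inj h
  · intro b hb
    rw [mem_good] at hb
    exact ⟨g⁻¹.act b, by rw [mem_good]; simpa using hb.symm, by simp⟩

lemma inv_mem_S {A : Finset (ZMod p)} {β : ℝ} {g : Aff p} : g⁻¹ ∈ S A β ↔ g ∈ S A β := by
  rw [mem_S, mem_S, good_inv_card]

lemma mul_inv_mem_S {A : Finset (ZMod p)} {β : ℝ} {g u : Aff p}
    (h : β * (A.card : ℝ) ≤ ((A.filter fun a => g.act a ∈ A ∧ u.act a ∈ A).card : ℝ)) :
    g * u⁻¹ ∈ S A β := by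
  rw [mem_S]
  refine h.trans ?_
  have : (A.filter fun a => g.act a ∈ A ∧ u.act a ∈ A).card ≤ (good A (g * u⁻¹)).card := by
    apply Finset.card_le_card_of_injOn (fun a => u.act a)
    · intro a ha
      simp only [coe_filter, Set.mem_ofPred_eq] at ha
      simp only [SetLike.mem_coe, mem_coe, mem_good, Aff.act_mul, Aff.act_inv_act]
      exact ⟨ha.2.2, ha.2.1⟩
    · intro a _ b _ h
      exact u.act_inj h
  exact_mod_cast this

/-- few parallel rich maps -/
lemma parallel_le (A : Finset (ZMod p)) (β : ℝ) (m : (ZMod p)ˣ) :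
    (((S A β).filter fun g => g.m = m).card : ℝ) * (β * A.card) ≤ (A.card : ℝ) ^ 2 := by
  classical
  have h1 : (((S A β).filter fun g => g.m = m).card : ℝ) * (β * A.card) ≤
      ∑ g ∈ (S A β).filter (fun g => g.m = m), ((good A g).card : ℝ) := by
    rw [← nsmul_eq_mul]
    apply Finset.card_nsmul_le_sum
    intro g hg
    exact mem_S.mp (mem_filter.mp hg).1
  refine h1.trans ?_
  have h2 : ∑ g ∈ (S A β).filter (fun g => g.m = m), (good A g).card ≤ (A ×ˢ A).card := by
    rw [← Finset.card_sigma]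
    apply Finset.card_le_card_of_injOn (fun x => (x.2, x.1.act x.2))
    · rintro ⟨g, a⟩ hx
      simp only [coe_sigma, Set.mem_sigma_iff, mem_coe, mem_good] at hx
      simp [hx.2.1, hx.2.2]
    · rintro ⟨g, a⟩ hx ⟨h, b⟩ hy hxy
      simp only [coe_sigma, Set.mem_sigma_iff, mem_coe, mem_filter] at hx hy
      simp only [Prod.mk.injEq] at hxy
      obtain ⟨rfl, h2⟩ := hxy
      have := Aff.eq_of_m_act (hx.1.2.trans hy.1.2.symm) h2
      subst this; rfl
  rw [card_product] at h2
  rw [sq]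
  exact_mod_cast h2

/-- few concurrent rich maps -/
lemma concurrent_le (A : Finset (ZMod p)) (β : ℝ) (z w : ZMod p) :
    (((S A β).filter fun g => g.act z = w).card : ℝ) * (β * A.card - 1) ≤ (A.card : ℝ) ^ 2 := by
  classical
  have h1 : (((S A β).filter fun g => g.act z = w).card : ℝ) * (β * A.card - 1) ≤
      ∑ g ∈ (S A β).filter (fun g => g.act z = w), (((good A g).erase z).card : ℝ) := by
    rw [← nsmul_eq_mul]
    apply Finset.card_nsmul_le_sum
    intro g hg
    have h3 := mem_S.mp (mem_filter.mp hg).1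
    have h4 : (good A g).card ≤ ((good A g).erase z).card + 1 := by
      have := Finset.pred_card_le_card_erase (s := good A g) (a := z)
      omega
    have h5 : ((good A g).card : ℝ) ≤ ((good A g).erase z).card + 1 := by exact_mod_cast h4
    linarith
  refine h1.trans ?_
  have h2 : ∑ g ∈ (S A β).filter (fun g => g.act z = w), ((good A g).erase z).card
      ≤ (A ×ˢ A).card := by
    rw [← Finset.card_sigma]
    apply Finset.card_le_card_of_injOn (fun x => (x.2, x.1.act x.2))
    · rintro ⟨g, a⟩ hx
      simp only [coe_sigma, Set.mem_sigma_iff, mem_coe, mem_erase, mem_good] at hx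
      simp [hx.2.2.1, hx.2.2.2]
    · rintro ⟨g, a⟩ hx ⟨h, b⟩ hy hxy
      simp only [coe_sigma, Set.mem_sigma_iff, mem_coe, mem_filter, mem_erase] at hx hy
      simp only [Prod.mk.injEq] at hxy
      obtain ⟨rfl, h2⟩ := hxy
      have := Aff.eq_of_act hx.2.1 h2 (hx.1.2.trans hy.1.2.symm)
      subst this; rfl
  rw [card_product] at h2
  rw [sq]
  exact_mod_cast h2

lemma sum_offdiag (A : Finset (ZMod p)) :
    ∑ g : Aff p, ((good A g).card : ℝ) * ((good A g).card - 1) ≤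
      ((A.card : ℝ) * (A.card - 1)) ^ 2 := by
  classical
  have key : ∀ B : Finset (ZMod p), ((B.offDiag.card : ℕ) : ℝ) = (B.card : ℝ) * (B.card - 1) := by
    intro B
    rw [offDiag_card, Nat.cast_sub (Nat.le_mul_self _)]
    push_cast; ring
  have h2 : ∑ g : Aff p, (good A g).offDiag.card ≤ (A.offDiag ×ˢ A.offDiag).card := by
    rw [← Finset.card_sigma]
    apply Finset.card_le_card_of_injOn
      (fun x => (x.2, (x.1.act x.2.1, x.1.act x.2.2)))
    · rintro ⟨g, a, a'⟩ hx
      simp only [coe_sigma, Set.mem_sigma_iff, mem_coe, mem_offDiag, mem_good] at hx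
      simp only [coe_product, Set.mem_prod, mem_coe, mem_offDiag]
      exact ⟨⟨hx.2.1.1, hx.2.2.1.1, hx.2.2.2⟩, hx.2.1.2, hx.2.2.1.2,
        fun h => hx.2.2.2 (g.act_inj h)⟩
    · rintro ⟨g, a, a'⟩ hx ⟨h, b, b'⟩ hy hxy
      simp only [coe_sigma, Set.mem_sigma_iff, mem_coe, mem_offDiag] at hx hy
      simp only [Prod.mk.injEq] at hxy
      obtain ⟨⟨rfl, rfl⟩, h1, h2⟩ := hxy
      have := Aff.eq_of_act hx.2.2.2 h1 h2
      subst this; rfl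
  have h3 : ((∑ g : Aff p, (good A g).offDiag.card : ℕ) : ℝ) ≤
    (((A.offDiag ×ˢ A.offDiag).card : ℕ) : ℝ) := by exact_mod_cast h2
  rw [card_product] at h3
  push_cast at h3
  simp only [key] at h3
  linarith

lemma sum_good (A : Finset (ZMod p)) :
    ∑ g : Aff p, ((good A g).card : ℝ) = ((p : ℝ) - 1) * (A.card : ℝ) ^ 2 := by
  classical
  have h2 : ∑ g : Aff p, (good A g).card = ((univ : Finset (ZMod p)ˣ) ×ˢ (A ×ˢ A)).card := by
    rw [← Finset.card_sigma]
    apply Finset.card_bij (fun x _ => (x.1.m, x.2, x.1.act x.2))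
    · rintro ⟨g, a⟩ hx
      simp only [mem_sigma, mem_good] at hx
      simp [hx.2.1, hx.2.2]
    · rintro ⟨g, a⟩ hx ⟨h, b⟩ hy hxy
      simp only [Prod.mk.injEq] at hxy
      obtain ⟨h1, rfl, h2⟩ := hxy
      have := Aff.eq_of_m_act h1 h2
      subst this; rfl
    · rintro ⟨m, a, c⟩ hx
      simp only [mem_product] at hx
      refine ⟨⟨⟨m, c - m * a⟩, a⟩, ?_, ?_⟩
      · simp [mem_good, Aff.act, hx.2]
      · simp [Aff.act]
  rw [card_product, card_product, card_univ, ZMod.card_units] at h2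
  have h3 : ((∑ g : Aff p, (good A g).card : ℕ) : ℝ) = (((p - 1) * (#A * #A) : ℕ) : ℝ) := by
    rw [h2]
  rw [Nat.cast_mul, Nat.cast_sub (Fact.out : p.Prime).one_le] at h3
  push_cast at h3
  rw [h3]; ring

lemma card_Aff : (Fintype.card (Aff p) : ℝ) = ((p : ℝ) - 1) * p := by
  rw [Fintype.card_congr (Aff.equivProd p), Fintype.card_prod, ZMod.card_units, ZMod.card,
    Nat.cast_mul, Nat.cast_sub (Fact.out : p.Prime).one_le]
  simp

lemma card_le_p (A : Finset (ZMod p)) : (A.card : ℝ) ≤ p := by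
  have := A.card_le_univ
  rw [ZMod.card] at this
  exact_mod_cast this

/-- trivial bound -/
lemma S_trivial (A : Finset (ZMod p)) (β : ℝ) (hβ : 2 ≤ β * A.card) :
    ((S A β).card : ℝ) * β ^ 2 ≤ 2 * (A.card : ℝ) ^ 2 := by
  have h0 := sum_offdiag A
  have h1 : ((S A β).card : ℝ) * ((β * A.card) * (β * A.card - 1)) ≤
      ∑ g ∈ S A β, ((good A g).card : ℝ) * ((good A g).card - 1) := by
    rw [← nsmul_eq_mul]
    apply Finset.card_nsmul_le_sum
    intro g hg
    have h3 := mem_S.mp hg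
    apply mul_le_mul h3 <;> linarith
  have h2 : ∑ g ∈ S A β, ((good A g).card : ℝ) * ((good A g).card - 1) ≤
      ∑ g : Aff p, ((good A g).card : ℝ) * ((good A g).card - 1) := by
    apply Finset.sum_le_sum_of_subset_of_nonneg (subset_univ _)
    intro g _ _
    rcases Nat.eq_zero_or_pos (good A g).card with h | h
    · simp [h]
    · have : (1:ℝ) ≤ (good A g).card := by exact_mod_cast h
      apply mul_nonneg <;> linarith
  have hN : (0:ℝ) < A.card := by
    rcases Nat.eq_zero_or_pos A.card with h | h
    · rw [h] at hβ; norm_num at hβ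
    · exact_mod_cast h
  have hN1 : (1:ℝ) ≤ A.card := by
    have : 0 < A.card := by exact_mod_cast hN
    exact_mod_cast this
  have h4 : ((A.card : ℝ) * (A.card - 1)) ^ 2 ≤ (A.card : ℝ) ^ 4 := by
    have : (A.card : ℝ) * (A.card - 1) ≤ (A.card : ℝ) ^ 2 := by nlinarith
    calc _ ≤ ((A.card : ℝ) ^ 2) ^ 2 := by
          apply pow_le_pow_left₀ _ this
          apply mul_nonneg <;> linarith
      _ = _ := by ring
  have h5 : ((S A β).card : ℝ) * ((β * A.card) ^ 2 / 2) ≤ (A.card : ℝ) ^ 4 := by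
    refine le_trans ?_ (h1.trans (h2.trans (h0.trans h4)))
    gcongr
    nlinarith
  have h6 : (((S A β).card : ℝ) * β ^ 2) * (A.card : ℝ) ^ 2 ≤
    (2 * (A.card : ℝ) ^ 2) * (A.card : ℝ) ^ 2 := by nlinarith
  exact le_of_mul_le_mul_right h6 (by positivity)

/-- Vinh type bound -/
lemma S_vinh (A : Finset (ZMod p)) (β : ℝ) (hA : A.Nonempty) (hβ : 2 * A.card ≤ β * p) :
    ((S A β).card : ℝ) * β ^ 2 ≤ 4 * p := by
  have h0 := sum_offdiag A
  have h1 := sum_good A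
  have h2 := card_Aff (p := p)
  have hNp := card_le_p A
  have hp : (0:ℝ) < p := by exact_mod_cast (Fact.out : p.Prime).pos
  have hN : (0:ℝ) < A.card := by exact_mod_cast hA.card_pos
  set N : ℝ := (A.card : ℝ)
  have h3 : ∑ g : Aff p, (((good A g).card : ℝ) - N ^ 2 / p) ^ 2 ≤ p * N ^ 2 := by
    have : ∑ g : Aff p, (((good A g).card : ℝ) - N ^ 2 / p) ^ 2 =
      ∑ g : Aff p, ((good A g).card : ℝ) * ((good A g).card - 1) +
      (1 - 2 * (N ^ 2 / p)) * ∑ g : Aff p, ((good A g).card : ℝ) +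
      (N ^ 2 / p) ^ 2 * Fintype.card (Aff p) := by
      rw [Finset.mul_sum, ← Finset.sum_add_distrib, ← card_univ (α := Aff p), mul_comm (_ ^ 2), ← nsmul_eq_mul,
        ← Finset.sum_const, ← Finset.sum_add_distrib]
      apply Finset.sum_congr rfl
      intros; ring
    rw [this, h1, h2]
    have h4 : (N * (N - 1)) ^ 2 + (1 - 2 * (N ^ 2 / p)) * ((p - 1) * N ^ 2) +
      (N ^ 2 / p) ^ 2 * ((p - 1) * p) = N ^ 2 * (p - 2 * N + N ^ 2 / p) := by
      field_simp; ring
    have h5 : N ^ 2 / p ≤ N := by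
      rw [div_le_iff₀ hp]; nlinarith
    nlinarith [sq_nonneg N, mul_pos hN hN]
  have h4 : ((S A β).card : ℝ) * ((β * N / 2) ^ 2) ≤
      ∑ g ∈ S A β, (((good A g).card : ℝ) - N ^ 2 / p) ^ 2 := by
    rw [← nsmul_eq_mul]
    apply Finset.card_nsmul_le_sum
    intro g hg
    have h3 := mem_S.mp hg
    have hβ0 : 0 < β := by
      by_contra h
      push Not at h
      nlinarith
    have h5 : N ^ 2 / p ≤ β * N / 2 := by
      rw [div_le_iff₀ hp]; nlinarith
    apply pow_le_pow_left₀ (by positivity)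
    linarith
  have h5 : ∑ g ∈ S A β, (((good A g).card : ℝ) - N ^ 2 / p) ^ 2 ≤
      ∑ g : Aff p, (((good A g).card : ℝ) - N ^ 2 / p) ^ 2 := by
    apply Finset.sum_le_sum_of_subset_of_nonneg (subset_univ _)
    intros; positivity
  have h6 : (((S A β).card : ℝ) * β ^ 2) * N ^ 2 ≤ (4 * p) * N ^ 2 := by nlinarith
  exact le_of_mul_le_mul_right h6 (by positivity)

end RL
end

section
open Finset
open scoped Pointwise

set_option linter.unusedSectionVars false

namespace RL

/-- Cauchy-Schwarz for fibres -/
lemma cs_fiber {E Z : Type*} [DecidableEq Z] (D : Finset E) (T : Finset Z) (f : E → Z)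
    (hf : ∀ e ∈ D, f e ∈ T) :
    (D.card : ℝ) ^ 2 ≤ T.card * (((D ×ˢ D).filter fun q => f q.1 = f q.2).card : ℝ) := by
  classical
  have h1 : (D.card : ℝ) = ∑ z ∈ T, ((D.filter fun e => f e = z).card : ℝ) := by
    exact_mod_cast Finset.card_eq_sum_card_fiberwise hf
  have h2 : (((D ×ˢ D).filter fun q => f q.1 = f q.2).card : ℝ) =
      ∑ z ∈ T, ((D.filter fun e => f e = z).card : ℝ) ^ 2 := by
    have h3 : ((D ×ˢ D).filter fun q => f q.1 = f q.2).card = ∑ z ∈ T,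
        (((D ×ˢ D).filter fun q => f q.1 = f q.2).filter fun q => f q.1 = z).card := by
      apply Finset.card_eq_sum_card_fiberwise
      intro q hq
      simp only [coe_filter, mem_product, Set.mem_ofPred_eq] at hq
      exact hf _ hq.1.1
    rw [h3]
    push_cast
    apply Finset.sum_congr rfl
    intro z _
    rw [sq]
    norm_cast
    rw [← card_product]
    congr 1
    ext q
    simp only [mem_filter, mem_product]
    constructor
    · rintro ⟨⟨⟨h1, h2⟩, h3⟩, h4⟩
      exact ⟨⟨h1, h4⟩, h2, h3 ▸ h4⟩
    · rintro ⟨⟨h1, h2⟩, h3, h4⟩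
      exact ⟨⟨⟨h1, h3⟩, h2.trans h4.symm⟩, h2⟩
  rw [h1, h2]
  exact sq_sum_le_card_mul_sum_sq

variable {p : ℕ} [Fact p.Prime]

lemma rich_gowers (A : Finset (ZMod p)) (hA : A.Nonempty) (β : ℝ) (hβ : 0 < β)
    (S0 : Finset (Aff p)) (hS : S0 ⊆ S A β) :
    ∃ S' ⊆ S0, β / 2 * S0.card ≤ (S'.card : ℝ) ∧
      ((S' * S'⁻¹).card : ℝ) * (β / 4 * S0.card) ≤ ((S A (β ^ 2 / 64)).card : ℝ) ^ 2 := by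
  classical
  obtain ⟨s0, hs0, s', hs', hc, h⟩ := gowers S0 A (fun g a => g.act a ∈ A) β hβ hA (by
    calc β * S0.card * A.card = S0.card * (β * A.card) := by ring
      _ ≤ _ := by
        rw [← nsmul_eq_mul]
        apply Finset.card_nsmul_le_sum
        intro g hg
        exact mem_S.mp (hS hg))
  refine ⟨s', hs'.trans hs0, hc, ?_⟩
  have hs0c : (s'.card : ℝ) ≤ s0.card := by exact_mod_cast card_le_card hs'
  have key := card_mul_le_of_fibers (s' * s'⁻¹) (S A (β ^ 2 / 64) ×ˢ S A (β ^ 2 / 64))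
    (fun q => q.1 * q.2⁻¹) (β / 4 * S0.card) (by
    intro z hz
    obtain ⟨g1, hg1, g2', hg2', rfl⟩ := mem_mul.mp hz
    obtain ⟨g2, hg2, rfl⟩ := mem_inv.mp hg2'
    obtain ⟨w, hw, hwc, hwu⟩ := h g1 hg1 g2 hg2
    have h1 : w.card ≤ ((S A (β ^ 2 / 64) ×ˢ S A (β ^ 2 / 64)).filter
        fun q => q.1 * q.2⁻¹ = g1 * g2⁻¹).card := by
      apply Finset.card_le_card_of_injOn (fun u => (g1 * u⁻¹, g2 * u⁻¹))
      · intro u hu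
        have := hwu u hu
        simp only [cn] at this
        simp only [coe_filter, mem_product, Set.mem_ofPred_eq]
        refine ⟨⟨mul_inv_mem_S ?_, mul_inv_mem_S ?_⟩, by group⟩
        · convert this.1
        · convert this.2
      · intro u _ v _ huv
        simp only [Prod.mk.injEq, mul_right_inj, inv_inj] at huv
        exact huv.1
    have h2 : (w.card : ℝ) ≤ (((S A (β ^ 2 / 64) ×ˢ S A (β ^ 2 / 64)).filter
        fun q => q.1 * q.2⁻¹ = g1 * g2⁻¹).card : ℝ) := by exact_mod_cast h1
    linarith)
  rw [card_product] at key
  push_cast at key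
  rw [sq]
  exact key

lemma pivot_energy (W D : Finset (ZMod p)) :
    ∑ ξ : ZMod p, ((((W ×ˢ D) ×ˢ (W ×ˢ D)).filter fun q =>
      q.1.1 + ξ * q.1.2 = q.2.1 + ξ * q.2.2).card : ℝ) ≤
      p * ((W.card : ℝ) * D.card) + ((W.card : ℝ) * D.card) ^ 2 := by
  classical
  have h : ∑ ξ : ZMod p, (((W ×ˢ D) ×ˢ (W ×ˢ D)).filter fun q =>
      q.1.1 + ξ * q.1.2 = q.2.1 + ξ * q.2.2).card ≤
      (((univ : Finset (ZMod p)) ×ˢ (W ×ˢ D)).disjSum ((W ×ˢ D) ×ˢ (W ×ˢ D))).card := by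
    rw [← Finset.card_sigma]
    apply Finset.card_le_card_of_injOn (fun x => if x.2.1.2 = x.2.2.2 then
      Sum.inl (x.1, x.2.1) else Sum.inr x.2)
    · rintro ⟨ξ, ⟨w, d⟩, w', d'⟩ hx
      simp only [coe_sigma, Set.mem_sigma_iff, mem_coe, mem_filter, mem_product] at hx
      simp only
      split_ifs
      · simp [hx.2.1.1]
      · simp [hx.2.1]
    · rintro ⟨ξ, ⟨w, d⟩, w', d'⟩ hx ⟨η, ⟨y, e⟩, y', e'⟩ hy hxy
      simp only [coe_sigma, Set.mem_sigma_iff, mem_coe, mem_filter, mem_product] at hx hy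
      simp only at hxy
      have hx2 := hx.2.2
      have hy2 := hy.2.2
      split_ifs at hxy with h1 h2 h2
      · simp only [Sum.inl.injEq, Prod.mk.injEq] at hxy
        obtain ⟨rfl, rfl, rfl⟩ := hxy
        subst h1 h2
        have : w' = w := (add_right_cancel hx2).symm
        have h3 : y' = w := (add_right_cancel hy2).symm
        subst this; subst h3; rfl
      · simp only [Sum.inr.injEq, Prod.mk.injEq] at hxy
        obtain ⟨⟨rfl, rfl⟩, rfl, rfl⟩ := hxy
        have : (ξ - η) * (d - d') = 0 := by linear_combination hx2 - hy2
        rcases mul_eq_zero.mp this with h | h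
        · rw [sub_eq_zero.mp h]
        · exact absurd (sub_eq_zero.mp h) h1
  simp only [card_disjSum, card_product, card_univ, ZMod.card] at h
  have h' := (Nat.cast_le (α := ℝ)).mpr h
  push_cast at h'
  rw [sq]
  exact h'

lemma pivot (W D T : Finset (ZMod p)) (v : ZMod p) (hv : v ≠ 0) (hD : 1 < D.card)
    (hW : W.Nonempty)
    (h1 : ∀ d1 ∈ D, ∀ d2 ∈ D, ∀ d ∈ D, ∀ q1 ∈ W, ∀ q2 ∈ W, ∀ w ∈ W,
      (d1 - d2) * w + (q1 - q2) * d ∈ T)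
    (h2 : ∀ d1 ∈ D, ∀ d2 ∈ D, ∀ d ∈ D, ∀ q1 ∈ W, ∀ q2 ∈ W, ∀ w ∈ W,
      (d1 - d2) * w + (q1 - q2) * d + (d1 - d2) * v * d ∈ T) :
    (W.card : ℝ) * D.card ≤ 2 * T.card ∨ (p : ℝ) ≤ 2 * T.card := by
  classical
  set P : ZMod p → Prop := fun ξ => ∃ d1 ∈ D, ∃ d2 ∈ D, d1 ≠ d2 ∧ ∃ q1 ∈ W, ∃ q2 ∈ W,
    ξ * (d1 - d2) = q1 - q2 with hP
  by_cases hc : ∃ ξ, P ξ ∧ ¬ P (ξ + v)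
  · left
    obtain ⟨ξ, ⟨d1, hd1, d2, hd2, hne, q1, hq1, q2, hq2, hξ⟩, hn⟩ := hc
    have : (W ×ˢ D).card ≤ T.card := by
      apply Finset.card_le_card_of_injOn
        (fun x => (d1 - d2) * (x.1 + (ξ + v) * x.2))
      · rintro ⟨w, d⟩ hx
        simp only [coe_product, Set.mem_prod, mem_coe] at hx
        have := h2 d1 hd1 d2 hd2 d hx.2 q1 hq1 q2 hq2 w hx.1
        rw [← hξ] at this
        simp only [mem_coe]
        convert this using 1
        ring
      · rintro ⟨w, d⟩ hx ⟨w', d'⟩ hy hxy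
        simp only [coe_product, Set.mem_prod, mem_coe] at hx hy
        have h3 : w + (ξ + v) * d = w' + (ξ + v) * d' :=
          mul_left_cancel₀ (sub_ne_zero.mpr hne) hxy
        by_cases hdd : d = d'
        · subst hdd
          rw [add_right_cancel h3]
        · exact absurd ⟨d, hx.2, d', hy.2, hdd, w', hy.1, w, hx.1,
            by linear_combination h3⟩ hn
    rw [card_product] at this
    have h3 : (W.card : ℝ) * D.card ≤ T.card := by exact_mod_cast this
    have : (0:ℝ) ≤ T.card := by positivity
    linarith
  · push Not at hc
    have h0 : P 0 := by
      obtain ⟨a, ha, b, hb, hab⟩ := Finset.one_lt_card.mp hD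
      obtain ⟨q, hq⟩ := hW
      exact ⟨a, ha, b, hb, hab, q, hq, q, hq, by simp⟩
    have hn : ∀ n : ℕ, P (n * v) := by
      intro n
      induction n with
      | zero => simpa using h0
      | succ k ih =>
        have := hc _ ih
        convert this using 1
        push_cast; ring
    have hall : ∀ ξ, P ξ := by
      intro ξ
      have := hn (ξ / v).val
      rw [ZMod.natCast_zmod_val, div_mul_cancel₀ _ hv] at this
      exact this
    have hcs : ∀ ξ : ZMod p, ((W.card : ℝ) * D.card) ^ 2 ≤ T.card *
        ((((W ×ˢ D) ×ˢ (W ×ˢ D)).filter fun q =>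
      q.1.1 + ξ * q.1.2 = q.2.1 + ξ * q.2.2).card : ℝ) := by
      intro ξ
      obtain ⟨d1, hd1, d2, hd2, hne, q1, hq1, q2, hq2, hξ⟩ := hall ξ
      have := cs_fiber (W ×ˢ D) T (fun x => (d1 - d2) * (x.1 + ξ * x.2)) (by
        rintro ⟨w, d⟩ hx
        rw [mem_product] at hx
        have := h1 d1 hd1 d2 hd2 d hx.2 q1 hq1 q2 hq2 w hx.1
        rw [← hξ] at this
        convert this using 1
        ring)
      rw [card_product] at this
      push_cast at this
      refine this.trans ?_
      gcongr 2
      refine card_le_card ?_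
      intro q hq
      rw [mem_filter] at *
      exact ⟨hq.1, mul_left_cancel₀ (sub_ne_zero.mpr hne) hq.2⟩
    have hsum := Finset.sum_le_sum (fun ξ (_ : ξ ∈ (univ : Finset (ZMod p))) => hcs ξ)
    rw [← Finset.mul_sum, Finset.sum_const, card_univ, ZMod.card, nsmul_eq_mul] at hsum
    have hE := pivot_energy W D
    set x : ℝ := (W.card : ℝ) * D.card with hx
    have hx0 : 0 < x := by
      have a1 : (0:ℝ) < W.card := by exact_mod_cast hW.card_pos
      have a2 : (0:ℝ) < D.card := by exact_mod_cast (by omega : 0 < D.card)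
      positivity
    have hp0 : (0:ℝ) < p := by exact_mod_cast (Fact.out : p.Prime).pos
    have hT : (0:ℝ) ≤ T.card := by positivity
    have h3 : p * x ^ 2 ≤ T.card * (p * x + x ^ 2) :=
      hsum.trans (mul_le_mul_of_nonneg_left hE hT)
    have h4 : p * x ≤ T.card * (p + x) := by
      have : (p * x) * x ≤ (T.card * (p + x)) * x := by nlinarith
      exact le_of_mul_le_mul_right this hx0
    rcases le_total x p with h | h
    · left
      have : x * p ≤ (2 * T.card) * p := by nlinarith
      exact le_of_mul_le_mul_right this hp0
    · right
      have : p * x ≤ (2 * T.card) * x := by nlinarith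
      exact le_of_mul_le_mul_right this hx0

end RL
end

section
open Finset
open scoped Pointwise

set_option linter.unusedSectionVars false

namespace RL

section grp
variable {G : Type*} [Group G] [DecidableEq G]

/-- representation count -/
noncomputable def rep (S : Finset G) (h : G) : ℝ :=
  (((S ×ˢ S).filter fun q => q.1⁻¹ * q.2 = h).card : ℝ)

/-- popular quotients -/
noncomputable def pop (S : Finset G) (M : ℝ) : Finset G := by
  classical exact (S⁻¹ * S).filter fun h => (S.card : ℝ) ≤ 2 * M * rep S h

lemma rep_le (S : Finset G) (h : G) : rep S h ≤ S.card := by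
  rw [rep]
  norm_cast
  apply Finset.card_le_card_of_injOn (fun q => q.1)
  · rintro ⟨a, b⟩ hq
    simp only [coe_filter, mem_product, Set.mem_ofPred_eq] at hq
    exact hq.1.1
  · rintro ⟨a, b⟩ hq ⟨a', b'⟩ hq' heq
    simp only [coe_filter, mem_product, Set.mem_ofPred_eq] at hq hq' heq
    subst heq
    have := hq.2.trans hq'.2.symm
    rw [mul_right_inj] at this
    rw [this]

lemma rep_one (S : Finset G) : rep S 1 = S.card := by
  rw [rep]
  norm_cast
  have : ((S ×ˢ S).filter fun q => q.1⁻¹ * q.2 = 1) = S.diag := by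
    ext ⟨a, b⟩
    simp only [mem_filter, mem_product, mem_diag, inv_mul_eq_one]
    constructor
    · rintro ⟨⟨h1, _⟩, h⟩; exact ⟨h1, h⟩
    · rintro ⟨h1, h⟩; exact ⟨⟨h1, h ▸ h1⟩, h⟩
  rw [this, diag_card]

lemma rep_inv (S : Finset G) (h : G) : rep S h⁻¹ = rep S h := by
  rw [rep, rep]
  norm_cast
  apply Finset.card_bij (fun q _ => (q.2, q.1))
  · rintro ⟨a, b⟩ hq
    simp only [mem_filter, mem_product] at *
    refine ⟨hq.1.symm, ?_⟩
    rw [← inv_inj, ← hq.2]; group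
  · rintro ⟨a, b⟩ _ ⟨a', b'⟩ _ h
    simp only [Prod.mk.injEq] at h ⊢
    exact h.symm
  · rintro ⟨a, b⟩ hq
    simp only [mem_filter, mem_product] at *
    refine ⟨(b, a), ⟨hq.1.symm, ?_⟩, rfl⟩
    rw [← hq.2]; simp

lemma mem_pop {S : Finset G} {M : ℝ} (hS : S.Nonempty) {h : G} :
    h ∈ pop S M ↔ (S.card : ℝ) ≤ 2 * M * rep S h := by
  classical
  simp only [pop, mem_filter, and_iff_right_iff_imp]
  intro h1
  have hpos : (0:ℝ) < S.card := by exact_mod_cast hS.card_pos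
  have : 0 < rep S h := by
    rcases (by rw [rep]; positivity : 0 ≤ rep S h).eq_or_lt with h2 | h2
    · rw [← h2] at h1; linarith
    · exact h2
  rw [rep] at this
  norm_cast at this
  obtain ⟨⟨a, b⟩, hq⟩ := card_pos.mp this
  simp only [mem_filter, mem_product] at hq
  rw [← hq.2]
  exact mul_mem_mul (inv_mem_inv hq.1.1) hq.1.2

lemma one_mem_pop {S : Finset G} {M : ℝ} (hS : S.Nonempty) (hM : 1 ≤ M) : 1 ∈ pop S M := by
  rw [mem_pop hS, rep_one]
  have hpos : (0:ℝ) < S.card := by exact_mod_cast hS.card_pos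
  nlinarith

lemma inv_mem_pop {S : Finset G} {M : ℝ} (hS : S.Nonempty) {h : G} (hh : h ∈ pop S M) :
    h⁻¹ ∈ pop S M := by
  rw [mem_pop hS] at *
  rwa [rep_inv]

lemma pop_card {S : Finset G} {M : ℝ} (hS : S.Nonempty) (hM : 1 ≤ M)
    (h : ((S * S⁻¹).card : ℝ) ≤ M * S.card) : (S.card : ℝ) ≤ 2 * M * (pop S M).card := by
  classical
  have hpos : (0:ℝ) < S.card := by exact_mod_cast hS.card_pos
  have h1 := cs_fiber (S ×ˢ S) (S * S⁻¹) (fun q => q.1 * q.2⁻¹) (by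
    rintro ⟨a, b⟩ hq
    rw [mem_product] at hq
    exact mul_mem_mul hq.1 (inv_mem_inv hq.2))
  set E : ℝ := ((((S ×ˢ S) ×ˢ (S ×ˢ S)).filter fun q =>
    q.1.1 * q.1.2⁻¹ = q.2.1 * q.2.2⁻¹).card : ℝ) with hE
  have h2 : E = ∑ x ∈ S⁻¹ * S, rep S x ^ 2 := by
    have e1 : E = ((((S ×ˢ S) ×ˢ (S ×ˢ S)).filter fun q =>
        q.1.1⁻¹ * q.1.2 = q.2.1⁻¹ * q.2.2).card : ℝ) := by
      rw [hE]
      norm_cast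
      apply Finset.card_bij (fun q _ => ((q.2.1, q.1.1), (q.2.2, q.1.2)))
      · rintro ⟨⟨a, b⟩, c, d⟩ hq
        simp only [mem_filter, mem_product] at *
        refine ⟨⟨⟨hq.1.2.1, hq.1.1.1⟩, hq.1.2.2, hq.1.1.2⟩, ?_⟩
        have := hq.2
        rw [mul_inv_eq_iff_eq_mul] at this
        rw [this]; group
      · rintro ⟨⟨a, b⟩, c, d⟩ _ ⟨⟨a', b'⟩, c', d'⟩ _ h
        simp only [Prod.mk.injEq] at h ⊢
        tauto
      · rintro ⟨⟨c, a⟩, d, b⟩ hq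
        simp only [mem_filter, mem_product] at *
        refine ⟨((a, b), (c, d)), ⟨⟨⟨hq.1.1.2, hq.1.2.2⟩, hq.1.1.1, hq.1.2.1⟩, ?_⟩, rfl⟩
        have := hq.2
        rw [inv_mul_eq_iff_eq_mul] at this
        simp only
        rw [this]; group
    rw [e1]
    have h3 : (((S ×ˢ S) ×ˢ (S ×ˢ S)).filter fun q =>
        q.1.1⁻¹ * q.1.2 = q.2.1⁻¹ * q.2.2).card = ∑ z ∈ S⁻¹ * S,
        ((((S ×ˢ S) ×ˢ (S ×ˢ S)).filter fun q =>
        q.1.1⁻¹ * q.1.2 = q.2.1⁻¹ * q.2.2).filter fun q => q.1.1⁻¹ * q.1.2 = z).card := by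
      apply Finset.card_eq_sum_card_fiberwise
      intro q hq
      simp only [coe_filter, mem_product, Set.mem_ofPred_eq] at hq
      exact mul_mem_mul (inv_mem_inv hq.1.1.1) hq.1.1.2
    rw [h3]
    push_cast
    apply Finset.sum_congr rfl
    intro z _
    rw [sq, rep]
    norm_cast
    rw [← card_product]
    congr 1
    ext q
    simp only [mem_filter, mem_product]
    constructor
    · rintro ⟨⟨⟨h1, h2⟩, h3⟩, h4⟩
      exact ⟨⟨h1, h4⟩, h2, h3 ▸ h4⟩
    · rintro ⟨⟨h1, h2⟩, h3, h4⟩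
      exact ⟨⟨⟨h1, h3⟩, h2.trans h4.symm⟩, h2⟩
  have hsum : ∑ x ∈ S⁻¹ * S, rep S x = (S.card : ℝ) ^ 2 := by
    have : (S ×ˢ S).card = ∑ z ∈ S⁻¹ * S, ((S ×ˢ S).filter fun q => q.1⁻¹ * q.2 = z).card := by
      apply Finset.card_eq_sum_card_fiberwise
      intro q hq
      simp only [coe_product, Set.mem_prod, mem_coe] at hq
      exact mul_mem_mul (inv_mem_inv hq.1) hq.2
    rw [card_product] at this
    have h4 := congrArg (Nat.cast (R := ℝ)) this
    push_cast at h4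
    rw [sq, h4]; rfl
  have hM0 : 0 < M := by linarith
  have h5 : ∑ x ∈ S⁻¹ * S, rep S x ^ 2 ≤ (pop S M).card * (S.card : ℝ) ^ 2 +
      S.card / (2 * M) * (S.card : ℝ) ^ 2 := by
    have : ∀ x ∈ S⁻¹ * S, rep S x ^ 2 ≤ (if x ∈ pop S M then (S.card : ℝ) ^ 2 else 0) +
        S.card / (2 * M) * rep S x := by
      intro x _
      have r0 : 0 ≤ rep S x := by rw [rep]; positivity
      have r1 := rep_le S x
      split_ifs with hx
      · have : rep S x ^ 2 ≤ (S.card : ℝ) ^ 2 := pow_le_pow_left₀ r0 r1 2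
        have : 0 ≤ S.card / (2 * M) * rep S x := by positivity
        linarith
      · rw [mem_pop hS] at hx
        push Not at hx
        have : rep S x ≤ S.card / (2 * M) := by
          rw [le_div_iff₀ (by positivity)]; linarith
        rw [zero_add, sq]
        exact mul_le_mul_of_nonneg_right this r0
    refine (Finset.sum_le_sum this).trans ?_
    rw [Finset.sum_add_distrib, ← Finset.mul_sum, hsum, Finset.sum_ite_mem, Finset.sum_const,
      nsmul_eq_mul]
    gcongr
    exact inter_subset_right
  rw [← h2] at h5
  rw [card_product] at h1
  push_cast at h1
  have hE0 : 0 ≤ E := by rw [hE]; positivity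
  have h6 : ((S.card : ℝ) * S.card) ^ 2 ≤ M * S.card * E :=
    h1.trans (mul_le_mul_of_nonneg_right h hE0)
  have h7 : (S.card : ℝ) ^ 3 ≤ M * E := by
    have : (S.card : ℝ) ^ 3 * S.card ≤ M * E * S.card := by nlinarith
    exact le_of_mul_le_mul_right this hpos
  have h8 : (S.card : ℝ) ^ 3 ≤ M * (pop S M).card * (S.card : ℝ) ^ 2 + (S.card : ℝ) ^ 3 / 2 := by
    have := mul_le_mul_of_nonneg_left h5 hM0.le
    have e : M * (S.card / (2 * M) * (S.card : ℝ) ^ 2) = (S.card : ℝ) ^ 3 / 2 := by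
      field_simp
    rw [mul_add, e] at this
    linarith
  have h9 : (S.card : ℝ) * (S.card : ℝ) ^ 2 ≤ (2 * M * (pop S M).card) * (S.card : ℝ) ^ 2 := by
    nlinarith
  exact le_of_mul_le_mul_right h9 (by positivity)

lemma pop_step {S : Finset G} {M : ℝ} (hS : S.Nonempty) (hM : 1 ≤ M)
    (h : ((S * S⁻¹).card : ℝ) ≤ M * S.card) (Y : Finset G) :
    ((S * (pop S M * Y)).card : ℝ) ≤ 2 * M ^ 2 * (S * Y).card := by
  classical
  have hpos : (0:ℝ) < S.card := by exact_mod_cast hS.card_pos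
  have hM0 : 0 < M := by linarith
  have key := card_mul_le_of_fibers (S * (pop S M * Y)) ((S * S⁻¹) ×ˢ (S * Y))
    (fun q => q.1 * q.2) (S.card / (2 * M)) (by
    intro z hz
    obtain ⟨s, hs, z', hz', rfl⟩ := mem_mul.mp hz
    obtain ⟨x, hx, y, hy, rfl⟩ := mem_mul.mp hz'
    rw [mem_pop hS] at hx
    have h1 : rep S x ≤ ((((S * S⁻¹) ×ˢ (S * Y)).filter
      fun q => q.1 * q.2 = s * (x * y)).card : ℝ) := by
      rw [rep]
      norm_cast
      apply Finset.card_le_card_of_injOn (fun q => (s * q.1⁻¹, q.2 * y))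
      · rintro ⟨a, b⟩ hq
        simp only [coe_filter, mem_product, Set.mem_ofPred_eq] at hq ⊢
        refine ⟨⟨mul_mem_mul hs (inv_mem_inv hq.1.1), mul_mem_mul hq.1.2 hy⟩, ?_⟩
        rw [← hq.2]; group
      · rintro ⟨a, b⟩ _ ⟨a', b'⟩ _ hab
        simp only [Prod.mk.injEq, mul_right_inj, inv_inj, mul_left_inj] at hab ⊢
        exact hab
    refine le_trans ?_ h1
    rw [div_le_iff₀ (by positivity)]
    linarith)
  rw [card_product] at key
  push_cast at key
  have h2 : ((S * S⁻¹).card : ℝ) * (S * Y).card ≤ M * S.card * (S * Y).card := by gcongr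
  have h3 := key.trans h2
  rw [mul_div_assoc', div_le_iff₀ (by positivity)] at h3
  have h4 : ((S * (pop S M * Y)).card : ℝ) * S.card ≤ (2 * M ^ 2 * (S * Y).card) * S.card := by
    nlinarith
  exact le_of_mul_le_mul_right h4 hpos

lemma pop_pow' {S : Finset G} {M : ℝ} (hS : S.Nonempty) (hM : 1 ≤ M)
    (h : ((S * S⁻¹).card : ℝ) ≤ M * S.card) (n : ℕ) :
    ((S * pop S M ^ n).card : ℝ) ≤ (2 * M ^ 2) ^ n * S.card := by
  induction n with
  | zero => simp
  | succ k ih =>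
    rw [pow_succ' (pop S M)]
    refine (pop_step hS hM h _).trans ?_
    calc _ ≤ 2 * M ^ 2 * ((2 * M ^ 2) ^ k * S.card) := by gcongr
      _ = _ := by ring

lemma pop_pow {S : Finset G} {M : ℝ} (hS : S.Nonempty) (hM : 1 ≤ M)
    (h : ((S * S⁻¹).card : ℝ) ≤ M * S.card) (n : ℕ) :
    ((pop S M ^ n).card : ℝ) ≤ (2 * M ^ 2) ^ n * S.card := by
  refine le_trans ?_ (pop_pow' hS hM h n)
  exact_mod_cast card_le_card_mul_left hS

lemma pop_cover {S : Finset G} {M : ℝ} (hS : S.Nonempty) (hM : 1 ≤ M)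
    (h : ((S * S⁻¹).card : ℝ) ≤ M * S.card) :
    ∃ F : Finset G, (F.card : ℝ) ≤ 4 * M ^ 3 ∧ S ⊆ F * pop S M ^ 2 := by
  have h1 := pop_pow' hS hM h 1
  have h2 := pop_card hS hM h
  obtain ⟨F, _, hF, hS2⟩ := ruzsa_covering_mul (A := S) (B := pop S M) (K := 4 * M ^ 3)
    ⟨1, one_mem_pop hS hM⟩ (by
      simp only [pow_one] at h1
      refine h1.trans ?_
      have : 2 * M ^ 2 * S.card ≤ 2 * M ^ 2 * (2 * M * (pop S M).card) := by gcongr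
      linarith)
  refine ⟨F, hF, hS2.trans ?_⟩
  apply mul_subset_mul_left
  rw [sq]
  intro x hx
  obtain ⟨a, ha, b, hb, rfl⟩ := mem_div.mp hx
  rw [div_eq_mul_inv]
  exact mul_mem_mul ha (inv_mem_pop hS hb)

end grp
end RL
end

section
open Finset
open scoped Pointwise

set_option linter.unusedSectionVars false

namespace RL
variable {p : ℕ} [Fact p.Prime]

/-- translation lengths -/
noncomputable def trans (H : Finset (Aff p)) : Finset (ZMod p) :=
  univ.filter fun t => (⟨1, t⟩ : Aff p) ∈ H

/-- slopes -/
noncomputable def slopes (H : Finset (Aff p)) : Finset (ZMod p)ˣ := H.image Aff.m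

lemma mem_trans {H : Finset (Aff p)} {t : ZMod p} : t ∈ trans H ↔ (⟨1, t⟩ : Aff p) ∈ H := by
  simp [trans]

lemma trans_mono {H K : Finset (Aff p)} (h : H ⊆ K) : trans H ⊆ trans K := by
  intro t ht; rw [mem_trans] at *; exact h ht

lemma slopes_mul_trans (H K : Finset (Aff p)) :
    (slopes H).card * (trans K).card ≤ (H * K).card := by
  classical
  have hch : ∀ m : (ZMod p)ˣ, ∃ h : Aff p, m ∈ slopes H → h ∈ H ∧ h.m = m := by
    intro m
    by_cases hm : m ∈ slopes H
    · obtain ⟨h, hh, rfl⟩ := mem_image.mp hm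
      exact ⟨h, fun _ => ⟨hh, rfl⟩⟩
    · exact ⟨1, fun h => absurd h hm⟩
  choose f hf using hch
  rw [← card_product]
  apply Finset.card_le_card_of_injOn (fun x => f x.1 * (⟨1, x.2⟩ : Aff p))
  · rintro ⟨m, t⟩ hx
    simp only [coe_product, Set.mem_prod, mem_coe] at hx
    exact mul_mem_mul (hf m hx.1).1 (mem_trans.mp hx.2)
  · rintro ⟨m, t⟩ hx ⟨m', t'⟩ hy hxy
    simp only [coe_product, Set.mem_prod, mem_coe] at hx hy
    have h1 := congrArg Aff.m hxy
    simp only [Aff.mul_m, mul_one, (hf m hx.1).2, (hf m' hy.1).2] at h1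
    subst h1
    have h2 := congrArg Aff.b (mul_left_cancel hxy)
    simp only at h2
    rw [h2]

lemma card_le_slopes_trans (H : Finset (Aff p)) (hH : H.Nonempty)
    (hinv : ∀ h ∈ H, h⁻¹ ∈ H) :
    (H.card : ℝ) ≤ (slopes H).card * (trans (H ^ 2)).card := by
  classical
  obtain ⟨m, hm, h⟩ := exists_large_fiber (slopes H) H Aff.m
    (fun e he => mem_image_of_mem _ he) hH
  refine h.trans ?_
  gcongr
  obtain ⟨h0, hh0, rfl⟩ := mem_image.mp hm
  apply Finset.card_le_card_of_injOn (fun h => (h0⁻¹ * h).b)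
  · intro x hx
    simp only [coe_filter, Set.mem_ofPred_eq] at hx
    simp only [mem_coe, mem_trans]
    have : (⟨1, (h0⁻¹ * x).b⟩ : Aff p) = h0⁻¹ * x := by
      ext
      · simp [hx.2]
      · rfl
    rw [this, sq]
    exact mul_mem_mul (hinv _ hh0) hx.1
  · intro x hx y hy hxy
    simp only [coe_filter, Set.mem_ofPred_eq] at hx hy
    have : h0⁻¹ * x = h0⁻¹ * y := by
      ext
      · simp [hx.2, hy.2]
      · exact hxy
    exact mul_left_cancel this

section tr
variable {H : Finset (Aff p)}

lemma trans_add {k l : ℕ} {s t : ZMod p} (hs : s ∈ trans (H ^ k)) (ht : t ∈ trans (H ^ l)) :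
    s + t ∈ trans (H ^ (k + l)) := by
  rw [mem_trans] at *
  rw [pow_add]
  have : (⟨1, s + t⟩ : Aff p) = ⟨1, s⟩ * ⟨1, t⟩ := by
    ext
    · simp
    · simp [add_comm]
  rw [this]
  exact mul_mem_mul hs ht

lemma inv_mem_pow (hinv : ∀ h ∈ H, h⁻¹ ∈ H) {k : ℕ} : ∀ {x : Aff p}, x ∈ H ^ k → x⁻¹ ∈ H ^ k := by
  induction k with
  | zero => intro x hx; simpa using hx
  | succ n ih =>
    intro x hx
    rw [pow_succ] at hx
    obtain ⟨a, ha, b, hb, rfl⟩ := mem_mul.mp hx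
    rw [pow_succ', mul_inv_rev]
    exact mul_mem_mul (hinv b hb) (ih ha)

lemma trans_neg (hinv : ∀ h ∈ H, h⁻¹ ∈ H) {k : ℕ} {s : ZMod p} (hs : s ∈ trans (H ^ k)) :
    -s ∈ trans (H ^ k) := by
  rw [mem_trans] at *
  convert inv_mem_pow hinv hs using 1
  ext <;> simp

lemma trans_smul (hinv : ∀ h ∈ H, h⁻¹ ∈ H) {k : ℕ} {s : ZMod p} {m : (ZMod p)ˣ}
    (hs : s ∈ trans (H ^ k)) (hm : m ∈ slopes H) : (m : ZMod p) * s ∈ trans (H ^ (k + 2)) := by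
  obtain ⟨h, hh, rfl⟩ := mem_image.mp hm
  rw [mem_trans] at *
  have e : (⟨1, (h.m : ZMod p) * s⟩ : Aff p) = h * ⟨1, s⟩ * h⁻¹ := by
    ext
    · simp
    · simp only [Aff.mul_b, Aff.mul_m, Aff.inv_b, Units.val_mul, Units.val_one, mul_one]
      have : (h.m : ZMod p) * ((h.m⁻¹ : (ZMod p)ˣ) : ZMod p) = 1 := Units.mul_inv _
      linear_combination (h.b) * this
  rw [e, pow_succ, pow_succ']
  exact mul_mem_mul (mul_mem_mul hh hs) (hinv h hh)

end tr

/-- dichotomy when there is a nonzero translation -/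
lemma structure_trans {H : Finset (Aff p)} (h1 : 1 ∈ H) (hinv : ∀ h ∈ H, h⁻¹ ∈ H)
    {v : ZMod p} (hv : v ≠ 0) (hv4 : v ∈ trans (H ^ 4)) :
    (slopes H).card ≤ 1 ∨ ((H.card : ℝ) ≤ 2 * (trans (H ^ 40)).card ∨
      (p : ℝ) ≤ 2 * (trans (H ^ 40)).card) := by
  classical
  rcases Nat.lt_or_ge 1 (slopes H).card with hc | hc
  swap
  · left; exact hc
  right
  set D : Finset (ZMod p) := (slopes H).image (fun m : (ZMod p)ˣ => (m : ZMod p)) with hD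
  have hDc : D.card = (slopes H).card := by
    rw [hD, card_image_of_injective]
    exact Units.val_injective
  have hmono : ∀ {k l : ℕ}, k ≤ l → ∀ {x : ZMod p}, x ∈ trans (H ^ k) → x ∈ trans (H ^ l) := by
    intro k l hkl x hx
    exact trans_mono (pow_subset_pow_right h1 hkl) hx
  have hmul : ∀ {k : ℕ} {d s : ZMod p}, d ∈ D → s ∈ trans (H ^ k) → d * s ∈ trans (H ^ (k + 2)) := by
    intro k d s hd hs
    obtain ⟨m, hm, rfl⟩ := mem_image.mp hd
    exact trans_smul hinv hs hm
  have hsub : ∀ {k l : ℕ} {s t : ZMod p}, s ∈ trans (H ^ k) → t ∈ trans (H ^ l) →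
      s - t ∈ trans (H ^ (k + l)) := by
    intro k l s t hs ht
    rw [sub_eq_add_neg]
    exact trans_add hs (trans_neg hinv ht)
  have key1 : ∀ d1 ∈ D, ∀ d2 ∈ D, ∀ d ∈ D, ∀ q1 ∈ trans (H ^ 4), ∀ q2 ∈ trans (H ^ 4),
      ∀ w ∈ trans (H ^ 4), (d1 - d2) * w + (q1 - q2) * d ∈ trans (H ^ 24) := by
    intro d1 hd1 d2 hd2 d hd q1 hq1 q2 hq2 w hw
    have := trans_add (hsub (hmul hd1 hw) (hmul hd2 hw)) (hsub (hmul hd hq1) (hmul hd hq2))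
    convert this using 1
    ring
  have := pivot (trans (H ^ 4)) D (trans (H ^ 40)) v hv (by rw [hDc]; exact hc) ⟨v, hv4⟩
    (fun d1 hd1 d2 hd2 d hd q1 hq1 q2 hq2 w hw =>
      hmono (by norm_num) (key1 d1 hd1 d2 hd2 d hd q1 hq1 q2 hq2 w hw))
    (by
      intro d1 hd1 d2 hd2 d hd q1 hq1 q2 hq2 w hw
      have := trans_add (key1 d1 hd1 d2 hd2 d hd q1 hq1 q2 hq2 w hw)
        (hsub (hmul hd1 (hmul hd hv4)) (hmul hd2 (hmul hd hv4)))
      convert this using 1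
      ring)
  refine this.imp (fun h => ?_) id
  refine le_trans ?_ h
  refine (card_le_slopes_trans H ⟨1, h1⟩ hinv).trans ?_
  rw [hDc, mul_comm]
  gcongr
  exact trans_mono (pow_subset_pow_right h1 (by norm_num))

/-- dichotomy when there is no nonzero translation -/
lemma structure_notrans {H : Finset (Aff p)} (hinv : ∀ h ∈ H, h⁻¹ ∈ H)
    (hv4 : ∀ v ∈ trans (H ^ 4), v = 0) :
    (∀ h ∈ H, h.m = 1) ∨ ∃ z, ∀ h ∈ H, h.act z = z := by
  by_cases hc : ∀ h ∈ H, h.m = 1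
  · left; exact hc
  right
  push Not at hc
  obtain ⟨h0, hh0, hm0⟩ := hc
  have hm0' : (h0.m : ZMod p) - 1 ≠ 0 := by
    intro h
    apply hm0
    ext
    rw [sub_eq_zero.mp h]; simp
  have hcomm : ∀ h ∈ H, h * h0 = h0 * h := by
    intro h hh
    have e : (⟨1, (h * h0 * (h⁻¹ * h0⁻¹)).b⟩ : Aff p) = h * h0 * (h⁻¹ * h0⁻¹) := by
      ext
      · simp only [Aff.mul_m, Aff.inv_m]
        rw [mul_comm h.m h0.m, ← mul_inv_rev, mul_inv_cancel]
      · rfl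
    have h1 : (h * h0 * (h⁻¹ * h0⁻¹)).b ∈ trans (H ^ 4) := by
      rw [mem_trans, e, show (4:ℕ) = 2 + 2 from rfl, pow_add, sq]
      exact mul_mem_mul (mul_mem_mul hh hh0) (mul_mem_mul (hinv _ hh) (hinv _ hh0))
    have h2 := hv4 _ h1
    rw [h2] at e
    have h3 : h * h0 * (h⁻¹ * h0⁻¹) = 1 := e.symm
    rw [← mul_inv_rev, mul_inv_eq_one] at h3
    exact h3
  refine ⟨- h0.b / ((h0.m : ZMod p) - 1), ?_⟩
  set z : ZMod p := - h0.b / ((h0.m : ZMod p) - 1) with hz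
  have huniq : ∀ y, h0.act y = y → y = z := by
    intro y hy
    simp only [Aff.act] at hy
    rw [hz, eq_div_iff hm0']
    linear_combination hy
  have hz0 : h0.act z = z := by
    simp only [Aff.act]
    have : z * ((h0.m : ZMod p) - 1) = - h0.b := by rw [hz, div_mul_cancel₀ _ hm0']
    linear_combination this
  intro h hh
  apply huniq
  rw [← Aff.act_mul, ← hcomm h hh, Aff.act_mul, hz0]

lemma slopes_mul_card (F H : Finset (Aff p)) :
    (slopes (F * H)).card ≤ F.card * (slopes H).card := by
  classical
  have : slopes (F * H) ⊆ slopes F * slopes H := by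
    intro m hm
    obtain ⟨g, hg, rfl⟩ := mem_image.mp hm
    obtain ⟨a, ha, b, hb, rfl⟩ := mem_mul.mp hg
    exact mul_mem_mul (mem_image_of_mem _ ha) (mem_image_of_mem _ hb)
  refine (card_le_card this).trans (card_mul_le.trans ?_)
  gcongr
  exact card_image_le

/-- structure of small tripling-like sets -/
theorem aff_structure (S0 : Finset (Aff p)) (hS : S0.Nonempty) (M : ℝ) (hM : 1 ≤ M)
    (h : ((S0 * S0⁻¹).card : ℝ) ≤ M * S0.card) :
    (∃ z : ZMod p, ∃ W : Finset (ZMod p), (W.card : ℝ) ≤ (2 * M) ^ 95 ∧ ∀ s ∈ S0, s.act z ∈ W) ∨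
    ((slopes S0).card : ℝ) ≤ (2 * M) ^ 95 ∨
    (p : ℝ) * (slopes S0).card ≤ (2 * M) ^ 95 * S0.card := by
  classical
  obtain ⟨F, hF, hcov⟩ := pop_cover hS hM h
  have hH := pop_card hS hM h
  have hpow := pop_pow hS hM h
  have h1 := one_mem_pop hS hM
  have hinv : ∀ x ∈ pop S0 M, x⁻¹ ∈ pop S0 M := fun x hx => inv_mem_pop hS hx
  set H := pop S0 M with hHdef
  have hM0 : 0 < M := by linarith
  have hn : (0:ℝ) < S0.card := by exact_mod_cast hS.card_pos
  have hslope : ((slopes S0).card : ℝ) ≤ 4 * M ^ 3 * (slopes (H ^ 2)).card := by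
    have e1 : (slopes S0).card ≤ F.card * (slopes (H ^ 2)).card :=
      (card_le_card (image_subset_image hcov)).trans (slopes_mul_card F (H ^ 2))
    have e2 : ((slopes S0).card : ℝ) ≤ F.card * (slopes (H ^ 2)).card := by exact_mod_cast e1
    refine e2.trans ?_
    gcongr
  have hb1 : 4 * M ^ 3 ≤ (2 * M) ^ 95 := by
    calc 4 * M ^ 3 ≤ (2 * M) ^ 3 := by nlinarith [pow_pos hM0 3]
      _ ≤ (2 * M) ^ 95 := pow_le_pow_right₀ (by linarith) (by norm_num)
  by_cases hv : ∀ v ∈ trans (H ^ 4), v = 0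
  · rcases structure_notrans hinv hv with hc | ⟨z, hz⟩
    · right; left
      have : (slopes (H ^ 2)).card ≤ 1 := by
        rw [card_le_one]
        have : ∀ a ∈ slopes (H ^ 2), a = 1 := by
          intro m hm
          obtain ⟨g, hg, rfl⟩ := mem_image.mp hm
          rw [sq] at hg
          obtain ⟨a, ha, b, hb, rfl⟩ := mem_mul.mp hg
          simp [hc a ha, hc b hb]
        intro a ha b hb
        rw [this a ha, this b hb]
      have h2 : ((slopes (H ^ 2)).card : ℝ) ≤ 1 := by exact_mod_cast this
      calc _ ≤ _ := hslope
        _ ≤ 4 * M ^ 3 * 1 := by gcongr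
        _ ≤ _ := by linarith
    · left
      refine ⟨z, F.image (fun f => f.act z), ?_, ?_⟩
      · refine le_trans ?_ (hF.trans hb1)
        exact_mod_cast card_image_le
      · intro s hs
        obtain ⟨f, hf, g, hg, rfl⟩ := mem_mul.mp (hcov hs)
        rw [sq] at hg
        obtain ⟨a, ha, b, hb, rfl⟩ := mem_mul.mp hg
        rw [mem_image]
        refine ⟨f, hf, ?_⟩
        rw [Aff.act_mul, Aff.act_mul, hz b hb, hz a ha]
  · right
    push Not at hv
    obtain ⟨v, hv4, hv0⟩ := hv
    have hx := structure_trans h1 hinv hv0 hv4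
    have hX1 : 0 < (slopes H).card := card_pos.mpr ⟨_, mem_image_of_mem _ h1⟩
    have hX1' : (1:ℝ) ≤ (slopes H).card := by exact_mod_cast hX1
    -- slopes of `H^2`
    have hT2 : 0 < (trans (H ^ 2)).card := card_pos.mpr ⟨0, mem_trans.mpr (by
      have : (1 : Aff p) ∈ H ^ 2 := by rw [sq]; simpa using mul_mem_mul h1 h1
      exact this)⟩
    have hT2' : (0:ℝ) < (trans (H ^ 2)).card := by exact_mod_cast hT2
    have e1 : ((slopes (H ^ 2)).card : ℝ) * (trans (H ^ 2)).card ≤ (2 * M ^ 2) ^ 4 * S0.card := by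
      refine le_trans ?_ (hpow 4)
      have := slopes_mul_trans (H ^ 2) (H ^ 2)
      rw [← pow_add] at this
      exact_mod_cast this
    have e2 := card_le_slopes_trans H ⟨1, h1⟩ hinv
    have e3 : ((slopes (H ^ 2)).card : ℝ) ≤ 2 * M * (2 * M ^ 2) ^ 4 * (slopes H).card := by
      have : ((slopes (H ^ 2)).card : ℝ) * (trans (H ^ 2)).card ≤
          (2 * M * (2 * M ^ 2) ^ 4 * (slopes H).card) * (trans (H ^ 2)).card := by
        calc _ ≤ _ := e1
          _ ≤ (2 * M ^ 2) ^ 4 * (2 * M * H.card) := by gcongr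
          _ ≤ (2 * M ^ 2) ^ 4 * (2 * M * ((slopes H).card * (trans (H ^ 2)).card)) := by gcongr
          _ = _ := by ring
      exact le_of_mul_le_mul_right this hT2'
    have e4 : ((slopes S0).card : ℝ) ≤ 8 * M ^ 4 * (2 * M ^ 2) ^ 4 * (slopes H).card := by
      calc _ ≤ _ := hslope
        _ ≤ 4 * M ^ 3 * (2 * M * (2 * M ^ 2) ^ 4 * (slopes H).card) := by gcongr
        _ = _ := by ring
    have e5 : ((slopes H).card : ℝ) * (trans (H ^ 40)).card ≤ (2 * M ^ 2) ^ 41 * S0.card := by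
      refine le_trans ?_ (hpow 41)
      have := slopes_mul_trans H (H ^ 40)
      rw [← pow_succ'] at this
      exact_mod_cast this
    have hbig : 8 * M ^ 4 * (2 * M ^ 2) ^ 4 * (4 * M * (2 * M ^ 2) ^ 41) ≤ (2 * M) ^ 95 := by
      calc 8 * M ^ 4 * (2 * M ^ 2) ^ 4 * (4 * M * (2 * M ^ 2) ^ 41)
          = (2 * M) ^ 5 * (2 * M ^ 2) ^ 45 := by ring
        _ ≤ (2 * M) ^ 5 * ((2 * M) ^ 2) ^ 45 := by gcongr; nlinarith
        _ = _ := by ring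
    have hbig1 : 1 ≤ 4 * M * (2 * M ^ 2) ^ 41 := by
      have : 1 ≤ (2 * M ^ 2) ^ 41 := one_le_pow₀ (by nlinarith)
      nlinarith
    rcases hx with hx | hx | hx
    · left
      have h2 : ((slopes H).card : ℝ) ≤ 4 * M * (2 * M ^ 2) ^ 41 := by
        refine le_trans ?_ hbig1
        exact_mod_cast hx
      calc _ ≤ _ := e4
        _ ≤ 8 * M ^ 4 * (2 * M ^ 2) ^ 4 * (4 * M * (2 * M ^ 2) ^ 41) := by gcongr
        _ ≤ _ := hbig
    · left
      have h2 : ((slopes H).card : ℝ) ≤ 4 * M * (2 * M ^ 2) ^ 41 := by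
        have : ((slopes H).card : ℝ) * S0.card ≤ (4 * M * (2 * M ^ 2) ^ 41) * S0.card := by
          calc ((slopes H).card : ℝ) * S0.card
              ≤ (slopes H).card * (2 * M * (2 * (trans (H ^ 40)).card)) := by
                gcongr
                refine hH.trans ?_
                gcongr
            _ = 4 * M * ((slopes H).card * (trans (H ^ 40)).card) := by ring
            _ ≤ 4 * M * ((2 * M ^ 2) ^ 41 * S0.card) := by gcongr
            _ = _ := by ring
        exact le_of_mul_le_mul_right this hn
      calc _ ≤ _ := e4
        _ ≤ 8 * M ^ 4 * (2 * M ^ 2) ^ 4 * (4 * M * (2 * M ^ 2) ^ 41) := by gcongr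
        _ ≤ _ := hbig
    · right
      calc (p : ℝ) * (slopes S0).card
          ≤ (2 * (trans (H ^ 40)).card) * (8 * M ^ 4 * (2 * M ^ 2) ^ 4 * (slopes H).card) :=
            mul_le_mul hx e4 (Nat.cast_nonneg _) (le_trans (Nat.cast_nonneg p) hx)
        _ = 16 * M ^ 4 * (2 * M ^ 2) ^ 4 * ((slopes H).card * (trans (H ^ 40)).card) := by ring
        _ ≤ 16 * M ^ 4 * (2 * M ^ 2) ^ 4 * ((2 * M ^ 2) ^ 41 * S0.card) := by gcongr
        _ = (16 * M ^ 4 * (2 * M ^ 2) ^ 4 * (2 * M ^ 2) ^ 41) * S0.card := by ring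
        _ ≤ (8 * M ^ 4 * (2 * M ^ 2) ^ 4 * (4 * M * (2 * M ^ 2) ^ 41)) * S0.card := by
            have aux : ∀ u w : ℝ, 0 < u → 0 < w →
                16 * M ^ 4 * w * u ≤ 8 * M ^ 4 * w * (4 * M * u) := by
              intro u w hu hw
              have h4 : 0 < M ^ 4 * w * u := by positivity
              nlinarith
            exact mul_le_mul_of_nonneg_right (aux _ _ (by positivity) (by positivity)) hn.le
        _ ≤ _ := mul_le_mul_of_nonneg_right hbig hn.le

end RL
end

section
open Finset
open scoped Pointwise

set_option linter.unusedSectionVars false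

namespace RL

section ag
variable {G : Type*} [AddCommGroup G] [DecidableEq G]

/-- iterated sumset -/
def ks : ℕ → Finset G → Finset G
  | 0, _ => {0}
  | n + 1, V => ks n V + V

lemma ks_eq (n : ℕ) (V : Finset G) : ks n V = n • V := by
  induction n with
  | zero => simp [ks]; rfl
  | succ k ih => rw [ks, ih, succ_nsmul]

lemma pr_bound {Z : Finset G} (hZ : Z.Nonempty) {K : ℝ}
    (h : ((Z - Z).card : ℝ) ≤ K * Z.card) (m n : ℕ) :
    ((ks m Z - ks n Z).card : ℝ) ≤ K ^ (m + n) * Z.card := by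
  rw [ks_eq, ks_eq]
  have h1 := pluennecke_ruzsa_inequality_nsmul_sub_nsmul_sub hZ Z m n
  have h2 : ((m • Z - n • Z).card : ℝ) ≤ ((Z - Z).card / Z.card : ℝ) ^ (m + n) * Z.card := by
    have h3 := (NNRat.cast_le (K := ℝ)).mpr h1
    push_cast at h3
    exact h3
  refine h2.trans ?_
  have hpos : (0:ℝ) < Z.card := by exact_mod_cast hZ.card_pos
  gcongr
  rw [div_le_iff₀ hpos]
  exact h

lemma ks_add {V : Finset G} {m n : ℕ} {a b : G} (ha : a ∈ ks m V) (hb : b ∈ ks n V) :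
    a + b ∈ ks (m + n) V := by
  rw [ks_eq] at *
  rw [add_nsmul]
  exact add_mem_add ha hb

lemma ks_neg {V : Finset G} (hV : ∀ v ∈ V, -v ∈ V) {n : ℕ} :
    ∀ {a : G}, a ∈ ks n V → -a ∈ ks n V := by
  induction n with
  | zero => intro a ha; simpa [ks] using ha
  | succ k ih =>
    intro a ha
    rw [ks] at *
    obtain ⟨x, hx, y, hy, rfl⟩ := mem_add.mp ha
    rw [neg_add]
    exact add_mem_add (ih hx) (hV y hy)

lemma ks_sub {V : Finset G} (hV : ∀ v ∈ V, -v ∈ V) {m n : ℕ} {a b : G} (ha : a ∈ ks m V)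
    (hb : b ∈ ks n V) : a - b ∈ ks (m + n) V := by
  rw [sub_eq_add_neg]
  exact ks_add ha (ks_neg hV hb)

lemma ks_one {V : Finset G} {a : G} : a ∈ ks 1 V ↔ a ∈ V := by
  rw [ks_eq, one_nsmul]

lemma ks_mono {V : Finset G} (h0 : 0 ∈ V) {m n : ℕ} (hmn : m ≤ n) : ks m V ⊆ ks n V := by
  rw [ks_eq, ks_eq]
  exact nsmul_subset_nsmul_right h0 hmn

lemma ks_diff {Z : Finset G} {n : ℕ} : ks n (Z - Z) ⊆ ks n Z - ks n Z := by
  induction n with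
  | zero => simp [ks]
  | succ k ih =>
    intro a ha
    rw [ks] at ha
    obtain ⟨x, hx, y, hy, rfl⟩ := mem_add.mp ha
    obtain ⟨b, hb, c, hc, rfl⟩ := mem_sub.mp (ih hx)
    obtain ⟨d, hd, e, he, rfl⟩ := mem_sub.mp hy
    rw [ks]
    refine mem_sub.mpr ⟨b + d, add_mem_add hb hd, c + e, add_mem_add hc he, ?_⟩
    abel

lemma sub_symm {Z : Finset G} : ∀ v ∈ Z - Z, -v ∈ Z - Z := by
  intro v hv
  obtain ⟨a, ha, b, hb, rfl⟩ := mem_sub.mp hv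
  rw [neg_sub]
  exact sub_mem_sub hb ha

lemma zero_mem_sub' {Z : Finset G} (hZ : Z.Nonempty) : (0 : G) ∈ Z - Z := by
  obtain ⟨z, hz⟩ := hZ
  exact mem_sub.mpr ⟨z, hz, z, hz, sub_self z⟩

lemma ks_cover {Z : Finset G} (hZ : Z.Nonempty) {K : ℝ}
    (h : ((Z - Z).card : ℝ) ≤ K * Z.card) (n : ℕ) :
    ∃ F : Finset G, (F.card : ℝ) ≤ K ^ (2 * n + 1) ∧ ks n (Z - Z) ⊆ F + (Z - Z) := by
  obtain ⟨F, _, hF, hc⟩ := ruzsa_covering_add (A := ks n (Z - Z)) (B := Z) (K := K ^ (2 * n + 1))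
    hZ (by
      have h1 := pr_bound hZ h (n + 1) n
      rw [show n + 1 + n = 2 * n + 1 by ring] at h1
      refine le_trans ?_ h1
      norm_cast
      apply card_le_card
      intro a ha
      obtain ⟨x, hx, y, hy, rfl⟩ := mem_add.mp ha
      obtain ⟨b, hb, c, hc, rfl⟩ := mem_sub.mp (ks_diff hx)
      rw [ks]
      exact mem_sub.mpr ⟨b + y, add_mem_add hb hy, c, hc, by abel⟩)
  exact ⟨F, hF, hc⟩

end ag

variable {p : ℕ} [Fact p.Prime]

/-- `y·V` is covered by few translates of `nV` -/
def Cov (V : Finset (ZMod p)) (y : ZMod p) (k : ℝ) (n : ℕ) : Prop :=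
  ∃ F : Finset (ZMod p), (F.card : ℝ) ≤ k ∧ ∀ v ∈ V, ∃ f ∈ F, y * v - f ∈ ks n V

lemma cov_base {Z Fx : Finset (ZMod p)} {x : ZMod p} {M : ℝ}
    (hF : (Fx.card : ℝ) ≤ M) (h : ∀ z ∈ Z, ∃ f ∈ Fx, x * z - f ∈ Z - Z) :
    Cov (Z - Z) x (M ^ 2) 2 := by
  refine ⟨Fx - Fx, ?_, ?_⟩
  · have : ((Fx - Fx).card : ℝ) ≤ Fx.card * Fx.card := by exact_mod_cast card_sub_le
    refine this.trans ?_
    rw [sq]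
    gcongr
    exact le_trans (Nat.cast_nonneg _) hF
  · intro v hv
    obtain ⟨a, ha, b, hb, rfl⟩ := mem_sub.mp hv
    obtain ⟨f, hf, hf2⟩ := h a ha
    obtain ⟨g, hg, hg2⟩ := h b hb
    refine ⟨f - g, sub_mem_sub hf hg, ?_⟩
    have := ks_sub (m := 1) (n := 1) (V := Z - Z) sub_symm (ks_one.mpr hf2) (ks_one.mpr hg2)
    convert this using 1
    ring

lemma cov_mul {Z : Finset (ZMod p)} {x y : ZMod p} {M : ℝ}
    (hx : Cov (Z - Z) x (M ^ 2) 2) (hy : Cov (Z - Z) y (M ^ 2) 2) :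
    Cov (Z - Z) (x * y) (M ^ 6) 4 := by
  obtain ⟨F, hF, hF2⟩ := hx
  obtain ⟨H, hH, hH2⟩ := hy
  refine ⟨H.image (fun f => x * f) + (F + F), ?_, ?_⟩
  · have h1 : ((H.image (fun f => x * f) + (F + F)).card : ℝ) ≤ H.card * (F.card * F.card) := by
      have : (H.image (fun f => x * f) + (F + F)).card ≤ H.card * (F.card * F.card) :=
        card_add_le.trans (Nat.mul_le_mul card_image_le card_add_le)
      exact_mod_cast this
    refine h1.trans ?_
    calc _ ≤ M ^ 2 * (M ^ 2 * M ^ 2) := by gcongr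
      _ = _ := by ring
  · intro v hv
    obtain ⟨f, hf, hf2⟩ := hH2 v hv
    obtain ⟨a, ha, b, hb, hab⟩ := mem_add.mp
      (show y * v - f ∈ (Z - Z) + (Z - Z) by
        rw [ks_eq, two_nsmul] at hf2; exact hf2)
    obtain ⟨g, hg, hg2⟩ := hF2 a ha
    obtain ⟨g', hg', hg2'⟩ := hF2 b hb
    refine ⟨x * f + (g + g'), add_mem_add (mem_image_of_mem _ hf) (add_mem_add hg hg'), ?_⟩
    have := ks_add hg2 hg2'
    convert this using 1
    linear_combination (-x) * hab

lemma cov_mono {Z : Finset (ZMod p)} (hZ : Z.Nonempty) {x : ZMod p} {M : ℝ} (hM : 1 ≤ M)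
    (hx : Cov (Z - Z) x (M ^ 2) 2) : Cov (Z - Z) x (M ^ 6) 4 := by
  obtain ⟨F, hF, hF2⟩ := hx
  refine ⟨F, hF.trans (pow_le_pow_right₀ hM (by norm_num)), fun v hv => ?_⟩
  obtain ⟨f, hf, hf2⟩ := hF2 v hv
  exact ⟨f, hf, ks_mono (zero_mem_sub' hZ) (by norm_num) hf2⟩

/-- covering `y(V-V)-(V-V)` -/
lemma cov_final {Z : Finset (ZMod p)} (hZ : Z.Nonempty) {y : ZMod p} {M : ℝ}
    (hM : 1 ≤ M) (h : ((Z - Z).card : ℝ) ≤ M * Z.card) (hy : Cov (Z - Z) y (M ^ 6) 4) :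
    ∃ F : Finset (ZMod p), (F.card : ℝ) ≤ M ^ 33 ∧
      ∀ a ∈ ks 2 (Z - Z), ∀ b ∈ ks 2 (Z - Z), ∃ f ∈ F, y * a - b - f ∈ Z - Z := by
  obtain ⟨F, hF, hF2⟩ := hy
  obtain ⟨H, hH, hH2⟩ := ks_cover hZ h 10
  refine ⟨(F + F) + H, ?_, ?_⟩
  · have h1 : (((F + F) + H).card : ℝ) ≤ (F.card * F.card) * H.card := by
      have : ((F + F) + H).card ≤ (F.card * F.card) * H.card :=
        card_add_le.trans (Nat.mul_le_mul card_add_le le_rfl)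
      exact_mod_cast this
    refine h1.trans ?_
    calc _ ≤ (M ^ 6 * M ^ 6) * M ^ (2 * 10 + 1) := by gcongr
      _ = _ := by ring
  · intro a ha b hb
    rw [ks_eq, two_nsmul] at ha
    obtain ⟨c, hc, d, hd, rfl⟩ := mem_add.mp ha
    obtain ⟨f, hf, hf2⟩ := hF2 c hc
    obtain ⟨g, hg, hg2⟩ := hF2 d hd
    have h1 := ks_sub sub_symm (ks_add hf2 hg2) hb
    obtain ⟨k, hk, e, he, hke⟩ := mem_add.mp (hH2 h1)
    refine ⟨(f + g) + k, add_mem_add (add_mem_add hf hg) hk, ?_⟩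
    convert he using 1
    linear_combination (-1 : ZMod p) * hke

/-- the set of multiplicatively popular elements -/
noncomputable def Qset (X U : Finset (ZMod p)) (τ : ℝ) : Finset (ZMod p) := by
  classical exact univ.filter fun y =>
    (X.card : ℝ) ^ 2 ≤ τ * (((X ×ˢ X).filter fun q => y * (q.1 - q.2) ∈ U).card : ℝ)

lemma mem_Qset {X U : Finset (ZMod p)} {τ : ℝ} {y : ZMod p} : y ∈ Qset X U τ ↔
    (X.card : ℝ) ^ 2 ≤ τ * (((X ×ˢ X).filter fun q => y * (q.1 - q.2) ∈ U).card : ℝ) := by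
  simp [Qset]

lemma Qset_card (X U : Finset (ZMod p)) (τ : ℝ) (hτ : 0 < τ) (hX : 2 * τ ≤ X.card) :
    ((Qset X U τ).card : ℝ) ≤ 2 * τ * U.card := by
  classical
  have hXp : (0:ℝ) < X.card := by linarith
  have key := card_mul_le_of_fibers (Qset X U τ) (((X ×ˢ X) ×ˢ U))
    (fun q => q.2 / (q.1.1 - q.1.2)) ((X.card : ℝ) ^ 2 / (2 * τ)) (by
    intro y hy
    rw [mem_Qset] at hy
    set P := (X ×ˢ X).filter fun q => y * (q.1 - q.2) ∈ U with hP
    have h1 : P.card ≤ (P.filter fun q => q.1 ≠ q.2).card + X.card := by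
      have := Finset.card_filter_add_card_filter_not (s := P) (fun q => q.1 = q.2)
      have h2 : (P.filter fun q => q.1 = q.2).card ≤ X.card := by
        apply Finset.card_le_card_of_injOn (fun q => q.1)
        · rintro ⟨a, b⟩ hq
          simp only [coe_filter, Set.mem_ofPred_eq, hP, mem_filter, mem_product] at hq
          exact hq.1.1.1
        · rintro ⟨a, b⟩ hq ⟨a', b'⟩ hq' hab
          simp only [coe_filter, Set.mem_ofPred_eq] at hq hq' hab
          rw [Prod.mk.injEq]
          exact ⟨hab, by rw [← hq.2, ← hq'.2, hab]⟩
      have h3 : (P.filter fun q => ¬ q.1 = q.2).card = (P.filter fun q => q.1 ≠ q.2).card := rfl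
      omega
    have h2 : (P.filter fun q => q.1 ≠ q.2).card ≤ (((X ×ˢ X) ×ˢ U).filter
        fun q => q.2 / (q.1.1 - q.1.2) = y).card := by
      apply Finset.card_le_card_of_injOn (fun q => (q, y * (q.1 - q.2)))
      · rintro ⟨a, b⟩ hq
        simp only [coe_filter, Set.mem_ofPred_eq, hP, mem_filter, mem_product] at hq ⊢
        refine ⟨⟨hq.1.1, hq.1.2⟩, ?_⟩
        rw [mul_div_assoc, div_self (sub_ne_zero.mpr hq.2), mul_one]
      · intro a _ b _ hab
        exact (Prod.mk.inj hab).1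
    have h3 : (P.card : ℝ) ≤ (((X ×ˢ X) ×ˢ U).filter
        fun q => q.2 / (q.1.1 - q.1.2) = y).card + X.card := by
      exact_mod_cast h1.trans (Nat.add_le_add_right h2 _)
    rw [div_le_iff₀ (by positivity)]
    have h4 : (X.card : ℝ) * (2 * τ) ≤ (X.card : ℝ) ^ 2 := by rw [sq]; gcongr
    have h5 := mul_le_mul_of_nonneg_left h3 hτ.le
    linarith)
  rw [card_product, card_product] at key
  push_cast at key
  rw [mul_div_assoc', div_le_iff₀ (by positivity)] at key
  have h6 : ((Qset X U τ).card : ℝ) * (X.card : ℝ) ^ 2 ≤ (2 * τ * U.card) * (X.card : ℝ) ^ 2 := by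
    nlinarith
  exact le_of_mul_le_mul_right h6 (by positivity)

/-- membership in `Qset` -/
lemma mem_Qset_of {X Xc V F : Finset (ZMod p)} (hV : ∀ v ∈ V, -v ∈ V) {y : ZMod p} {k θ : ℝ}
    (hk : 0 < k) (hθ : 0 < θ)
    (hXc : Xc ⊆ X) (hXcc : (X.card : ℝ) ≤ θ * Xc.card) (hF : (F.card : ℝ) ≤ k)
    (h : ∀ x ∈ Xc, ∃ f ∈ F, x * y - f ∈ V) : y ∈ Qset X (ks 2 V) (θ ^ 2 * k) := by
  classical
  rw [mem_Qset]
  have hch : ∀ x : ZMod p, ∃ f, x ∈ Xc → f ∈ F ∧ x * y - f ∈ V := by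
    intro x
    by_cases hx : x ∈ Xc
    · obtain ⟨f, h1, h2⟩ := h x hx
      exact ⟨f, fun _ => ⟨h1, h2⟩⟩
    · exact ⟨0, fun h => absurd h hx⟩
  choose φ hφ using hch
  have h1 := cs_fiber Xc F φ (fun x hx => (hφ x hx).1)
  have h2 : ((Xc ×ˢ Xc).filter fun q => φ q.1 = φ q.2) ⊆
      ((X ×ˢ X).filter fun q => y * (q.1 - q.2) ∈ ks 2 V) := by
    rintro ⟨a, b⟩ hq
    simp only [mem_filter, mem_product] at hq ⊢
    refine ⟨⟨hXc hq.1.1, hXc hq.1.2⟩, ?_⟩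
    have := ks_sub hV (ks_one.mpr (hφ a hq.1.1).2) (ks_one.mpr (hφ b hq.1.2).2)
    convert this using 1
    rw [hq.2]; ring
  have h3 : (((Xc ×ˢ Xc).filter fun q => φ q.1 = φ q.2).card : ℝ) ≤
    (((X ×ˢ X).filter fun q => y * (q.1 - q.2) ∈ ks 2 V).card : ℝ) := by
    exact_mod_cast card_le_card h2
  calc (X.card : ℝ) ^ 2 ≤ (θ * Xc.card) ^ 2 := by gcongr
    _ = θ ^ 2 * (Xc.card : ℝ) ^ 2 := by ring
    _ ≤ θ ^ 2 * (F.card * (((Xc ×ˢ Xc).filter fun q => φ q.1 = φ q.2).card : ℝ)) := by gcongr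
    _ ≤ θ ^ 2 * (k * (((X ×ˢ X).filter fun q => y * (q.1 - q.2) ∈ ks 2 V).card : ℝ)) := by gcongr
    _ = _ := by ring

end RL
end

section
open Finset
open scoped Pointwise

set_option linter.unusedSectionVars false

namespace RL
variable {p : ℕ} [Fact p.Prime]

lemma choose_z0 (Z X : Finset (ZMod p)) (hZ : Z.Nonempty) (M : ℝ) (hM : 1 ≤ M)
    (hcov : ∀ x ∈ X, ∃ F : Finset (ZMod p), (F.card : ℝ) ≤ M ∧
      ∀ z ∈ Z, ∃ f ∈ F, x * z - f ∈ Z - Z) :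
    ∃ z0 ∈ Z, 1 / M * Z.card * X.card ≤
      ∑ z ∈ Z, ((X.filter fun x => x * (z - z0) ∈ ks 2 (Z - Z)).card : ℝ) := by
  classical
  have hZp : (0:ℝ) < Z.card := by exact_mod_cast hZ.card_pos
  have hx : ∀ x ∈ X, (Z.card : ℝ) ^ 2 ≤
      M * (((Z ×ˢ Z).filter fun q => x * (q.2 - q.1) ∈ ks 2 (Z - Z)).card : ℝ) := by
    intro x hx
    obtain ⟨F, hF, h⟩ := hcov x hx
    have hch : ∀ z : ZMod p, ∃ f, z ∈ Z → f ∈ F ∧ x * z - f ∈ Z - Z := by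
      intro z
      by_cases hz : z ∈ Z
      · obtain ⟨f, h1, h2⟩ := h z hz
        exact ⟨f, fun _ => ⟨h1, h2⟩⟩
      · exact ⟨0, fun h => absurd h hz⟩
    choose φ hφ using hch
    have h1 := cs_fiber Z F φ (fun z hz => (hφ z hz).1)
    refine h1.trans ?_
    have h2 : ((Z ×ˢ Z).filter fun q => φ q.1 = φ q.2) ⊆
      ((Z ×ˢ Z).filter fun q => x * (q.2 - q.1) ∈ ks 2 (Z - Z)) := by
      rintro ⟨a, b⟩ hq
      simp only [mem_filter, mem_product] at hq ⊢
      refine ⟨hq.1, ?_⟩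
      have := ks_sub sub_symm (ks_one.mpr (hφ b hq.1.2).2) (ks_one.mpr (hφ a hq.1.1).2)
      convert this using 1
      rw [hq.2]; ring
    have h3 : (((Z ×ˢ Z).filter fun q => φ q.1 = φ q.2).card : ℝ) ≤
      (((Z ×ˢ Z).filter fun q => x * (q.2 - q.1) ∈ ks 2 (Z - Z)).card : ℝ) := by
      exact_mod_cast card_le_card h2
    gcongr
  have hs := Finset.sum_le_sum hx
  rw [← Finset.mul_sum, Finset.sum_const, nsmul_eq_mul] at hs
  have hsw : ∑ x ∈ X, (((Z ×ˢ Z).filter fun q => x * (q.2 - q.1) ∈ ks 2 (Z - Z)).card : ℝ) =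
      ∑ z0 ∈ Z, ∑ z ∈ Z, ((X.filter fun x => x * (z - z0) ∈ ks 2 (Z - Z)).card : ℝ) := by
    simp only [card_filter]
    push_cast
    simp only [Finset.sum_product]
    rw [Finset.sum_comm]
    apply Finset.sum_congr rfl
    intro z0 _
    rw [Finset.sum_comm]
  rw [hsw] at hs
  apply Finset.exists_le_of_sum_le hZ
  rw [Finset.sum_const, nsmul_eq_mul]
  have hM0 : 0 < M := by linarith
  calc _ = (X.card * (Z.card : ℝ) ^ 2) / M := by field_simp
    _ ≤ _ := by rw [div_le_iff₀ hM0]; linarith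

theorem lemZ (Z X : Finset (ZMod p)) (hZ : Z.Nonempty) (hX0 : ∀ x ∈ X, x ≠ 0) (M : ℝ)
    (hM : 1 ≤ M) (hZZ : ((Z - Z).card : ℝ) ≤ M * Z.card)
    (hcov : ∀ x ∈ X, ∃ F : Finset (ZMod p), (F.card : ℝ) ≤ M ∧
      ∀ z ∈ Z, ∃ f ∈ F, x * z - f ∈ Z - Z) :
    (X.card : ℝ) ≤ (2 * M) ^ 667 ∨ (p : ℝ) ≤ (2 * M) ^ 667 * Z.card ∨
      (Z.card : ℝ) ≤ (2 * M) ^ 667 := by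
  classical
  have hM0 : 0 < M := by linarith
  have hR1 : 1 ≤ 2 * M := by linarith
  have hZp : (0:ℝ) < Z.card := by exact_mod_cast hZ.card_pos
  by_cases hXbig : (X.card : ℝ) ≤ (2 * M) ^ 42
  · left; exact hXbig.trans (pow_le_pow_right₀ hR1 (by norm_num))
  by_cases hZbig : (Z.card : ℝ) ≤ (2 * M) ^ 2
  · right; right; exact hZbig.trans (pow_le_pow_right₀ hR1 (by norm_num))
  push Not at hXbig hZbig
  have hXp : (0:ℝ) < X.card := lt_trans (by positivity) hXbig
  have hXne : X.Nonempty := by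
    rw [← card_pos]; exact_mod_cast hXp
  obtain ⟨z0, hz0, hsum⟩ := choose_z0 Z X hZ M hM hcov
  set V := Z - Z with hV
  obtain ⟨Z0, hZ0, Z', hZ', hZc, hg⟩ := gowers Z X (fun z x => x * (z - z0) ∈ ks 2 V) (1 / M)
    (by positivity) hXne hsum
  -- words
  set Y := X ∪ X * X with hY
  have hYcov : ∀ y ∈ Y, Cov V y (M ^ 6) 4 := by
    have hb : ∀ x ∈ X, Cov V x (M ^ 2) 2 := by
      intro x hx
      obtain ⟨F, hF, h⟩ := hcov x hx
      exact cov_base hF h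
    intro y hy
    rcases mem_union.mp hy with h | h
    · exact cov_mono hZ hM (hb y h)
    · obtain ⟨a, ha, b, hb', rfl⟩ := mem_mul.mp h
      exact cov_mul (hb a ha) (hb b hb')
  set τ : ℝ := (64 * M ^ 2) ^ 2 * M ^ 33 with hτ
  have hτ0 : 0 < τ := by positivity
  have hτR : 2 * τ ≤ (2 * M) ^ 42 := by
    have h1 : 1 ≤ M ^ 5 := one_le_pow₀ hM
    have e : (2 * M) ^ 42 = (2 : ℝ) ^ 42 * M ^ 37 * M ^ 5 := by ring
    have e2 : 2 * τ = 8192 * M ^ 37 := by rw [hτ]; ring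
    rw [e, e2]
    have h3 : 0 < M ^ 37 := by positivity
    calc 8192 * M ^ 37 ≤ (2 : ℝ) ^ 42 * M ^ 37 := by gcongr; norm_num
      _ ≤ (2 : ℝ) ^ 42 * M ^ 37 * M ^ 5 := le_mul_of_one_le_right (by positivity) h1
  set Q := Qset X (ks 2 V) τ with hQ
  have hmemQ : ∀ y ∈ Y, ∀ z1 u : ZMod p,
      (1 / M) ^ 2 / 64 * X.card ≤ cn X (fun z x => x * (z - z0) ∈ ks 2 V) z1 u →
      y * (z1 - z0) - (u - z0) ∈ Q := by
    intro y hy z1 u hcn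
    obtain ⟨F, hF, hF2⟩ := cov_final hZ hM hZZ (hYcov y hy)
    simp only [cn] at hcn
    refine mem_Qset_of (Xc := X.filter fun x => x * (z1 - z0) ∈ ks 2 V ∧ x * (u - z0) ∈ ks 2 V)
      sub_symm (by positivity) (by positivity) (filter_subset _ _) ?_ hF ?_
    · have h1 : (1 / M) ^ 2 / 64 * (X.card : ℝ) ≤ ((X.filter fun x => x * (z1 - z0) ∈ ks 2 V ∧
          x * (u - z0) ∈ ks 2 V).card : ℝ) := by convert hcn
      have h2 := mul_le_mul_of_nonneg_left h1 (show (0:ℝ) ≤ 64 * M ^ 2 by positivity)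
      refine le_trans (le_of_eq ?_) h2
      field_simp
    · intro x hx
      rw [mem_filter] at hx
      obtain ⟨f, hf, hf2⟩ := hF2 _ hx.2.1 _ hx.2.2
      refine ⟨f, hf, ?_⟩
      convert hf2 using 1
      ring
  have hQc : (Q.card : ℝ) ≤ (2 * M) ^ 46 * Z.card := by
    have h1 := Qset_card X (ks 2 V) τ hτ0 (by linarith)
    have h2 : ((ks 2 V).card : ℝ) ≤ M ^ 4 * Z.card := by
      refine le_trans ?_ (pr_bound hZ hZZ 2 2)
      exact_mod_cast card_le_card ks_diff
    calc (Q.card : ℝ) ≤ _ := h1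
      _ ≤ (2 * M) ^ 42 * ((2 * M) ^ 4 * Z.card) := by
        gcongr
        refine h2.trans ?_
        gcongr
        linarith
      _ = _ := by ring
  set W := Z'.image (fun z => z - z0) with hW
  have hWc : W.card = Z'.card := card_image_of_injective _ (sub_left_injective)
  set T1 := Y * W with hT1
  have hZ'c : (Z.card : ℝ) ≤ 2 * M * Z'.card := by
    have := mul_le_mul_of_nonneg_left hZc (show (0:ℝ) ≤ 2 * M by positivity)
    refine le_trans (le_of_eq ?_) this
    field_simp
  have hZ'Z0 : (Z'.card : ℝ) ≤ Z0.card := by exact_mod_cast card_le_card hZ'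
  have hdiff : ((T1 - T1).card : ℝ) * ((Z0.card : ℝ) / 2) ≤ (Q.card : ℝ) ^ 2 := by
    have key := card_mul_le_of_fibers (T1 - T1) (Q ×ˢ Q) (fun q => q.1 - q.2) ((Z0.card : ℝ) / 2)
      (by
      intro t ht
      obtain ⟨a, ha, b, hb, rfl⟩ := mem_sub.mp ht
      obtain ⟨y1, hy1, w1, hw1, rfl⟩ := mem_mul.mp ha
      obtain ⟨y2, hy2, w2, hw2, rfl⟩ := mem_mul.mp hb
      obtain ⟨z1, hz1, rfl⟩ := mem_image.mp hw1
      obtain ⟨z2, hz2, rfl⟩ := mem_image.mp hw2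
      obtain ⟨w, hw, hwc, hwu⟩ := hg z1 hz1 z2 hz2
      refine hwc.trans ?_
      norm_cast
      apply Finset.card_le_card_of_injOn
        (fun u => (y1 * (z1 - z0) - (u - z0), y2 * (z2 - z0) - (u - z0)))
      · intro u hu
        simp only [coe_filter, mem_product, Set.mem_ofPred_eq]
        exact ⟨⟨hmemQ y1 hy1 z1 u (hwu u hu).1, hmemQ y2 hy2 z2 u (hwu u hu).2⟩, by ring⟩
      · intro u _ v _ huv
        have := (Prod.mk.inj huv).1
        linear_combination -this)
    rw [card_product] at key
    push_cast at key
    rw [sq]; exact key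
  have hdiff2 : ((T1 - T1).card : ℝ) ≤ (2 * M) ^ 94 * Z.card := by
    have h1 : ((T1 - T1).card : ℝ) * Z.card ≤ ((2 * M) ^ 94 * Z.card) * Z.card := by
      calc ((T1 - T1).card : ℝ) * Z.card ≤ (T1 - T1).card * (2 * M * Z0.card) := by
            gcongr; exact hZ'c.trans (by gcongr)
        _ = (4 * M) * ((T1 - T1).card * ((Z0.card : ℝ) / 2)) := by ring
        _ ≤ (4 * M) * (Q.card : ℝ) ^ 2 := by gcongr
        _ ≤ (2 * M) ^ 2 * ((2 * M) ^ 46 * Z.card) ^ 2 := by gcongr; nlinarith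
        _ = _ := by ring
    exact le_of_mul_le_mul_right h1 hZp
  have hT1c : (Z'.card : ℝ) ≤ T1.card := by
    obtain ⟨x, hx⟩ := hXne
    rw [← hWc]
    norm_cast
    apply Finset.card_le_card_of_injOn (fun w => x * w)
    · intro w hw
      exact mul_mem_mul (mem_union_left _ hx) hw
    · intro w _ w' _ h
      exact mul_left_cancel₀ (hX0 x hx) h
  have hZp0 : (1:ℝ) < Z'.card := by
    have : (2 * M) * 1 < 2 * M * Z'.card := by nlinarith
    exact lt_of_mul_lt_mul_left this (by positivity)
  have hZpp : 1 < Z'.card := by exact_mod_cast hZp0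
  have hT1ne : T1.Nonempty := by
    rw [← card_pos]
    have : (0:ℝ) < T1.card := by linarith
    exact_mod_cast this
  have hK : ((T1 - T1).card : ℝ) ≤ (2 * M) ^ 95 * T1.card := by
    refine hdiff2.trans ?_
    calc (2 * M) ^ 94 * (Z.card : ℝ) ≤ (2 * M) ^ 94 * (2 * M * T1.card) := by
          gcongr; exact hZ'c.trans (by gcongr)
      _ = _ := by ring
  have hTc : ((ks 3 T1 - ks 3 T1).card : ℝ) ≤ (2 * M) ^ 664 * Z.card := by
    have h1 := pr_bound hT1ne hK 3 3
    have h2 : (T1.card : ℝ) ≤ (T1 - T1).card := by exact_mod_cast card_le_card_sub_right hT1ne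
    calc _ ≤ _ := h1
      _ ≤ ((2 * M) ^ 95) ^ (3 + 3) * ((2 * M) ^ 94 * Z.card) := by
        gcongr; exact h2.trans hdiff2
      _ = _ := by rw [← mul_assoc, ← pow_mul, ← pow_add]
  -- nonzero element
  obtain ⟨v, hvW, hv0⟩ : ∃ v ∈ W, v ≠ 0 := by
    rw [← hWc] at hZpp
    obtain ⟨a, ha, b, hb, hab⟩ := one_lt_card.mp hZpp
    by_cases h : a = 0
    · exact ⟨b, hb, fun h' => hab (h.trans h'.symm)⟩
    · exact ⟨a, ha, h⟩
  have hXW : ∀ x ∈ X, ∀ w ∈ W, x * w ∈ T1 := fun x hx w hw =>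
    mul_mem_mul (mem_union_left _ hx) hw
  have hXXW : ∀ x ∈ X, ∀ x' ∈ X, ∀ w ∈ W, x * x' * w ∈ T1 := fun x hx x' hx' w hw =>
    mul_mem_mul (mem_union_right _ (mul_mem_mul hx hx')) hw
  have hks3 : ∀ a ∈ T1, ∀ b ∈ T1, ∀ c ∈ T1, a + b + c ∈ ks 3 T1 := fun a ha b hb c hc =>
    ks_add (m := 2) (n := 1) (ks_add (m := 1) (n := 1) (ks_one.mpr ha) (ks_one.mpr hb))
      (ks_one.mpr hc)
  have hXc1 : 1 < X.card := by
    have : (1:ℝ) < X.card := lt_of_le_of_lt (one_le_pow₀ hR1) hXbig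
    exact_mod_cast this
  rcases pivot W X (ks 3 T1 - ks 3 T1) v hv0 hXc1 ⟨v, hvW⟩ (by
    intro d1 hd1 d2 hd2 d hd q1 hq1 q2 hq2 w hw
    have := sub_mem_sub (hks3 _ (hXW d1 hd1 w hw) _ (hXW d hd q1 hq1) _ (hXW d hd q1 hq1))
      (hks3 _ (hXW d2 hd2 w hw) _ (hXW d hd q2 hq2) _ (hXW d hd q1 hq1))
    convert this using 1
    ring) (by
    intro d1 hd1 d2 hd2 d hd q1 hq1 q2 hq2 w hw
    have := sub_mem_sub (hks3 _ (hXW d1 hd1 w hw) _ (hXW d hd q1 hq1) _ (hXXW d1 hd1 d hd v hvW))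
      (hks3 _ (hXW d2 hd2 w hw) _ (hXW d hd q2 hq2) _ (hXXW d2 hd2 d hd v hvW))
    convert this using 1
    ring) with h | h
  · left
    rw [hWc] at h
    have h1 : (X.card : ℝ) * Z.card ≤ (2 * M) ^ 667 * Z.card := by
      calc (X.card : ℝ) * Z.card ≤ X.card * (2 * M * Z'.card) := by gcongr
        _ = (2 * M) * (Z'.card * X.card) := by ring
        _ ≤ (2 * M) * (2 * (ks 3 T1 - ks 3 T1).card) := by gcongr
        _ ≤ (2 * M) * ((2 * M) ^ 2 * ((2 * M) ^ 664 * Z.card)) := by gcongr; nlinarith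
        _ = (2 * M) ^ (1 + 2 + 664) * Z.card := by rw [pow_add, pow_add]; ring
        _ = _ := by norm_num
    exact le_of_mul_le_mul_right h1 hZp
  · right; left
    calc (p : ℝ) ≤ _ := h
      _ ≤ (2 * M) ^ 3 * ((2 * M) ^ 664 * Z.card) := by
        gcongr
        calc (2:ℝ) ≤ 2 * M := by linarith
          _ ≤ (2 * M) ^ 3 := le_self_pow₀ hR1 (by norm_num)
      _ = (2 * M) ^ (3 + 664) * Z.card := by rw [pow_add]; ring
      _ = _ := by norm_num

end RL
end

section
open Finset
open scoped Pointwise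

set_option linter.unusedSectionVars false

namespace RL
variable {p : ℕ} [Fact p.Prime]

lemma card_filter_and_sum {α : Type*} (s : Finset α) (P : α → Prop) [DecidablePred P] :
    ((s.filter P).card : ℝ) = ∑ a ∈ s, if P a then (1:ℝ) else 0 := by
  rw [card_filter]; push_cast; rfl

/-- overlap lemma -/
lemma overlap (A : Finset (ZMod p)) (hA : A.Nonempty) (G1 G0 : Finset (Aff p))
    (h1 : G1.Nonempty) (h0 : G0.Nonempty) (δ : ℝ) (hδ : 0 < δ)
    (h : δ * A.card * (G1.card * G0.card) ≤ ∑ g ∈ G1, ∑ u ∈ G0,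
      ((A.filter fun a => g.act a ∈ A ∧ u.act a ∈ A).card : ℝ)) :
    ∃ u' ∈ G0, δ ^ 2 / 2 * (G1.card * G0.card) ≤
      (((G1 ×ˢ G0).filter fun q => q.1 * q.2⁻¹ * u' ∈ S A (δ ^ 2 / 2)).card : ℝ) := by
  classical
  have hN : (0:ℝ) < A.card := by exact_mod_cast hA.card_pos
  have hG1 : (0:ℝ) < G1.card := by exact_mod_cast h1.card_pos
  have hG0 : (0:ℝ) < G0.card := by exact_mod_cast h0.card_pos
  set Fm : ZMod p → ℝ := fun b => ∑ u ∈ G0, if u⁻¹.act b ∈ A then (1:ℝ) else 0 with hFm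
  set H : ZMod p → ℝ := fun b => ∑ g ∈ G1, ∑ u ∈ G0,
    if u⁻¹.act b ∈ A ∧ g.act (u⁻¹.act b) ∈ A then (1:ℝ) else 0 with hH
  have hsumH : ∑ b ∈ A, H b = ∑ g ∈ G1, ∑ u ∈ G0,
      ((A.filter fun a => g.act a ∈ A ∧ u.act a ∈ A).card : ℝ) := by
    simp only [hH]
    rw [Finset.sum_comm]
    apply Finset.sum_congr rfl
    intro g _
    rw [Finset.sum_comm]
    apply Finset.sum_congr rfl
    intro u _
    rw [← card_filter_and_sum]
    norm_cast
    apply Finset.card_bij (fun b _ => u⁻¹.act b)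
    · intro b hb
      simp only [mem_filter] at hb ⊢
      refine ⟨hb.2.1, hb.2.2, ?_⟩
      rw [Aff.act_act_inv]; exact hb.1
    · intro a _ b _ hab
      exact u⁻¹.act_inj hab
    · intro a ha
      simp only [mem_filter] at ha
      refine ⟨u.act a, ?_, by simp⟩
      simp only [mem_filter, Aff.act_inv_act]
      exact ⟨ha.2.2, ha.1, ha.2.1⟩
  have hHF : ∀ b, H b ≤ G1.card * Fm b := by
    intro b
    simp only [hH, hFm]
    rw [← nsmul_eq_mul, ← Finset.sum_const]
    apply Finset.sum_le_sum
    intro g _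
    apply Finset.sum_le_sum
    intro u _
    split_ifs with h1 h2 h2
    · exact le_rfl
    · exact absurd h1.1 h2
    · norm_num
    · exact le_rfl
  have hH0 : ∀ b, 0 ≤ H b := by
    intro b
    apply Finset.sum_nonneg; intro g _
    apply Finset.sum_nonneg; intro u _
    split_ifs <;> norm_num
  rw [← hsumH] at h
  have hcs : (∑ b ∈ A, H b) ^ 2 ≤ A.card * ∑ b ∈ A, H b ^ 2 := sq_sum_le_card_mul_sum_sq
  have h3 : ∑ b ∈ A, H b ^ 2 ≤ G1.card * ∑ b ∈ A, H b * Fm b := by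
    rw [Finset.mul_sum]
    apply Finset.sum_le_sum
    intro b _
    have := mul_le_mul_of_nonneg_left (hHF b) (hH0 b)
    nlinarith
  have h4 : δ ^ 2 * A.card * (G1.card * (G0.card : ℝ) ^ 2) ≤ ∑ b ∈ A, H b * Fm b := by
    have e1 : (δ * A.card * (G1.card * G0.card)) ^ 2 ≤ (∑ b ∈ A, H b) ^ 2 :=
      pow_le_pow_left₀ (by positivity) h 2
    have e2 : (A.card : ℝ) * ∑ b ∈ A, H b ^ 2 ≤ A.card * (G1.card * ∑ b ∈ A, H b * Fm b) := by
      gcongr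
    have e3 : (δ ^ 2 * A.card * (G1.card * (G0.card : ℝ) ^ 2)) * (A.card * G1.card) ≤
        (∑ b ∈ A, H b * Fm b) * (A.card * G1.card) := by
      calc _ = (δ * A.card * (G1.card * G0.card)) ^ 2 := by ring
        _ ≤ _ := e1.trans (hcs.trans e2)
        _ = _ := by ring
    exact le_of_mul_le_mul_right e3 (by positivity)
  set R : Aff p → Aff p × Aff p → ℝ := fun u' q => ((A.filter fun b => u'⁻¹.act b ∈ A ∧
    (q.2⁻¹.act b ∈ A ∧ q.1.act (q.2⁻¹.act b) ∈ A)).card : ℝ) with hR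
  have h5 : ∑ b ∈ A, H b * Fm b = ∑ u' ∈ G0, ∑ q ∈ G1 ×ˢ G0, R u' q := by
    simp only [hR, hH, hFm, card_filter_and_sum, Finset.sum_product]
    simp_rw [Finset.mul_sum, Finset.sum_mul]
    rw [Finset.sum_comm]
    apply Finset.sum_congr rfl
    intro u' _
    rw [Finset.sum_comm]
    apply Finset.sum_congr rfl
    intro g _
    rw [Finset.sum_comm]
    apply Finset.sum_congr rfl
    intro u _
    apply Finset.sum_congr rfl
    intro b _
    by_cases c1 : u'⁻¹.act b ∈ A <;>
      by_cases c2 : (u⁻¹.act b ∈ A ∧ g.act (u⁻¹.act b) ∈ A) <;> simp [c1, c2]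
  obtain ⟨u', hu', hle⟩ : ∃ u' ∈ G0, δ ^ 2 * A.card * (G1.card * G0.card) ≤
      ∑ q ∈ G1 ×ˢ G0, R u' q := by
    apply Finset.exists_le_of_sum_le h0
    rw [← h5, Finset.sum_const, nsmul_eq_mul]
    refine le_trans (le_of_eq ?_) h4
    ring
  refine ⟨u', hu', ?_⟩
  have hRN : ∀ q, R u' q ≤ A.card := by
    intro q
    simp only [hR]
    exact_mod_cast card_filter_le _ _
  have hRS : ∀ q, δ ^ 2 / 2 * A.card ≤ R u' q → q.1 * q.2⁻¹ * u' ∈ S A (δ ^ 2 / 2) := by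
    intro q hq
    rw [mem_S]
    refine hq.trans ?_
    simp only [hR]
    norm_cast
    apply Finset.card_le_card_of_injOn (fun b => u'⁻¹.act b)
    · intro b hb
      simp only [coe_filter, Set.mem_ofPred_eq] at hb
      simp only [mem_coe, mem_good, Aff.act_mul, Aff.act_act_inv]
      exact ⟨hb.2.1, hb.2.2.2⟩
    · intro a _ b _ hab
      exact u'⁻¹.act_inj hab
  have h6 : ∑ q ∈ G1 ×ˢ G0, R u' q ≤
      A.card * (((G1 ×ˢ G0).filter fun q => q.1 * q.2⁻¹ * u' ∈ S A (δ ^ 2 / 2)).card : ℝ) +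
      δ ^ 2 / 2 * A.card * (G1.card * G0.card) := by
    have : ∀ q ∈ G1 ×ˢ G0, R u' q ≤
        A.card * (if q.1 * q.2⁻¹ * u' ∈ S A (δ ^ 2 / 2) then (1:ℝ) else 0) +
          δ ^ 2 / 2 * A.card := by
      intro q _
      split_ifs with hq
      · have := hRN q
        have : 0 ≤ δ ^ 2 / 2 * (A.card : ℝ) := by positivity
        linarith
      · have : ¬ (δ ^ 2 / 2 * A.card ≤ R u' q) := fun hc => hq (hRS q hc)
        push Not at this
        linarith
    refine (Finset.sum_le_sum this).trans (le_of_eq ?_)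
    rw [Finset.sum_add_distrib, ← Finset.mul_sum, ← card_filter_and_sum, Finset.sum_const,
      card_product, nsmul_eq_mul]
    push_cast; ring
  have h7 : (δ ^ 2 / 2 * (G1.card * G0.card)) * A.card ≤
      (((G1 ×ˢ G0).filter fun q => q.1 * q.2⁻¹ * u' ∈ S A (δ ^ 2 / 2)).card : ℝ) * A.card := by
    linarith
  exact le_of_mul_le_mul_right h7 hN

/-- a popular partner -/
lemma partner {ι α : Type*} (A : Finset α) (D : Finset ι) (hA : A.Nonempty)
    (hD : D.Nonempty) (f : ι → α → ℝ) (r : ι → ℝ) (β : ℝ) (hβ : 0 < β)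
    (hf0 : ∀ m ∈ D, ∀ a ∈ A, 0 ≤ f m a) (hf1 : ∀ m ∈ D, ∀ a ∈ A, f m a ≤ 1)
    (hsum : ∀ m ∈ D, β * A.card ≤ ∑ a ∈ A, f m a) :
    ∃ m0 ∈ D, ∃ D2 ⊆ D, β ^ 2 / 4 * D.card ≤ (D2.card : ℝ) ∧
      ∀ m ∈ D2, r m ≤ r m0 ∧ β ^ 2 / 4 * A.card ≤ ∑ a ∈ A, f m a * f m0 a := by
  classical
  have hN : (0:ℝ) < A.card := by exact_mod_cast hA.card_pos
  have hDp : (0:ℝ) < D.card := by exact_mod_cast hD.card_pos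
  set o : ι → ι → ℝ := fun m m' => ∑ a ∈ A, f m a * f m' a with ho
  have hosymm : ∀ m m', o m m' = o m' m := fun m m' => by
    simp only [ho]; exact Finset.sum_congr rfl (fun a _ => mul_comm _ _)
  have ho0 : ∀ m ∈ D, ∀ m' ∈ D, 0 ≤ o m m' := fun m hm m' hm' =>
    Finset.sum_nonneg fun a ha => mul_nonneg (hf0 m hm a ha) (hf0 m' hm' a ha)
  have hoN : ∀ m ∈ D, ∀ m' ∈ D, o m m' ≤ A.card := by
    intro m hm m' hm'
    calc o m m' ≤ ∑ a ∈ A, (1:ℝ) := by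
          apply Finset.sum_le_sum
          intro a ha
          have := mul_le_mul (hf1 m hm a ha) (hf1 m' hm' a ha) (hf0 m' hm' a ha) zero_le_one
          linarith
      _ = _ := by simp
  have htot : β ^ 2 * A.card * (D.card : ℝ) ^ 2 ≤ ∑ m' ∈ D, ∑ m ∈ D, o m m' := by
    have e1 : ∑ m' ∈ D, ∑ m ∈ D, o m m' = ∑ a ∈ A, (∑ m ∈ D, f m a) ^ 2 := by
      simp only [ho, sq, Finset.sum_mul_sum]
      rw [Finset.sum_congr rfl (fun m' _ => Finset.sum_comm), Finset.sum_comm]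
      apply Finset.sum_congr rfl
      intro a _
      apply Finset.sum_congr rfl
      intro m _
      apply Finset.sum_congr rfl
      intro m' _
      ring
    have e2 : (∑ a ∈ A, ∑ m ∈ D, f m a) ^ 2 ≤ A.card * ∑ a ∈ A, (∑ m ∈ D, f m a) ^ 2 :=
      sq_sum_le_card_mul_sum_sq
    have e3 : β * A.card * D.card ≤ ∑ a ∈ A, ∑ m ∈ D, f m a := by
      rw [Finset.sum_comm]
      have := Finset.sum_le_sum hsum
      rw [Finset.sum_const, nsmul_eq_mul] at this
      linarith
    have e4 : (β * A.card * D.card) ^ 2 ≤ (∑ a ∈ A, ∑ m ∈ D, f m a) ^ 2 :=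
      pow_le_pow_left₀ (by positivity) e3 2
    rw [e1]
    have e5 : (β ^ 2 * A.card * (D.card : ℝ) ^ 2) * A.card ≤
      (∑ a ∈ A, (∑ m ∈ D, f m a) ^ 2) * A.card := by
      calc _ = (β * A.card * D.card) ^ 2 := by ring
        _ ≤ _ := e4.trans e2
        _ = _ := by ring
    exact le_of_mul_le_mul_right e5 hN
  set o' : ι → ι → ℝ := fun m m' => if r m ≤ r m' then o m m' else 0 with ho'
  have hhalf : ∑ m' ∈ D, ∑ m ∈ D, o m m' ≤ 2 * ∑ m' ∈ D, ∑ m ∈ D, o' m m' := by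
    have e1 : ∑ m' ∈ D, ∑ m ∈ D, o m m' ≤ ∑ m' ∈ D, ∑ m ∈ D, (o' m m' + o' m' m) := by
      apply Finset.sum_le_sum; intro m' hm'
      apply Finset.sum_le_sum; intro m hm
      simp only [ho']
      have h1 := ho0 m hm m' hm'
      have h2 := hosymm m m'
      rcases le_total (r m) (r m') with h | h
      · rw [if_pos h]
        split_ifs
        · linarith
        · linarith
      · rw [if_pos h]
        split_ifs
        · linarith
        · linarith
    have e2 : ∑ m' ∈ D, ∑ m ∈ D, (o' m m' + o' m' m) = 2 * ∑ m' ∈ D, ∑ m ∈ D, o' m m' := by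
      simp only [Finset.sum_add_distrib]
      rw [Finset.sum_comm (f := fun m' m => o' m' m)]
      ring
    linarith
  obtain ⟨m0, hm0, hle⟩ : ∃ m0 ∈ D, β ^ 2 / 2 * A.card * D.card ≤ ∑ m ∈ D, o' m m0 := by
    apply Finset.exists_le_of_sum_le hD
    rw [Finset.sum_const, nsmul_eq_mul]
    nlinarith
  refine ⟨m0, hm0, D.filter fun m => r m ≤ r m0 ∧ β ^ 2 / 4 * A.card ≤ o m m0,
    filter_subset _ _, ?_, fun m hm => (mem_filter.mp hm).2⟩
  have h6 : ∑ m ∈ D, o' m m0 ≤ A.card *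
      ((D.filter fun m => r m ≤ r m0 ∧ β ^ 2 / 4 * A.card ≤ o m m0).card : ℝ) +
      β ^ 2 / 4 * A.card * D.card := by
    have : ∀ m ∈ D, o' m m0 ≤
        A.card * (if r m ≤ r m0 ∧ β ^ 2 / 4 * A.card ≤ o m m0 then (1:ℝ) else 0) +
          β ^ 2 / 4 * A.card := by
      intro m hm
      have hpos : 0 ≤ β ^ 2 / 4 * (A.card : ℝ) := by positivity
      simp only [ho']
      by_cases c1 : r m ≤ r m0
      · by_cases c2 : β ^ 2 / 4 * A.card ≤ o m m0
        · rw [if_pos c1, if_pos ⟨c1, c2⟩]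
          have := hoN m hm m0 hm0
          linarith
        · rw [if_pos c1, if_neg (fun h => c2 h.2)]
          push Not at c2
          linarith
      · rw [if_neg c1, if_neg (fun h => c1 h.1)]
        linarith
    refine (Finset.sum_le_sum this).trans (le_of_eq ?_)
    rw [Finset.sum_add_distrib, ← Finset.mul_sum, ← card_filter_and_sum, Finset.sum_const,
      nsmul_eq_mul]
    ring
  have h7 : (β ^ 2 / 4 * D.card) * A.card ≤
      ((D.filter fun m => r m ≤ r m0 ∧ β ^ 2 / 4 * A.card ≤ o m m0).card : ℝ) * A.card := by
    linarith
  exact le_of_mul_le_mul_right h7 hN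

end RL
end

section
open Finset
open scoped Pointwise

set_option linter.unusedSectionVars false

namespace RL
variable {p : ℕ} [Fact p.Prime]

/-- intercepts of the rich lines of slope `m` -/
noncomputable def Bs (A : Finset (ZMod p)) (β : ℝ) (m : (ZMod p)ˣ) : Finset (ZMod p) := by
  classical exact univ.filter fun b => (⟨m, b⟩ : Aff p) ∈ S A β

lemma mem_Bs {A : Finset (ZMod p)} {β : ℝ} {m : (ZMod p)ˣ} {b : ZMod p} :
    b ∈ Bs A β m ↔ (⟨m, b⟩ : Aff p) ∈ S A β := by simp [Bs]

lemma Bs_mono {A : Finset (ZMod p)} {β β' : ℝ} {m : (ZMod p)ˣ} (h : β' ≤ β) :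
    Bs A β m ⊆ Bs A β' m := fun _ hb => mem_Bs.mpr (S_mono h (mem_Bs.mp hb))

lemma Bs_card (A : Finset (ZMod p)) (β : ℝ) (m : (ZMod p)ˣ) :
    (Bs A β m).card = ((S A β).filter fun g => g.m = m).card := by
  apply Finset.card_bij (fun b _ => (⟨m, b⟩ : Aff p))
  · intro b hb
    simp only [mem_filter, and_true]
    exact mem_Bs.mp hb
  · intro a _ b _ h
    simpa using h
  · rintro ⟨m', b⟩ hg
    simp only [mem_filter] at hg
    obtain ⟨h1, rfl⟩ := hg
    exact ⟨b, mem_Bs.mpr h1, rfl⟩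

lemma Bs_card_le (A : Finset (ZMod p)) (hA : A.Nonempty) (β : ℝ) (m : (ZMod p)ˣ) :
    ((Bs A β m).card : ℝ) * β ≤ A.card := by
  have h := parallel_le A β m
  rw [← Bs_card] at h
  have hN : (0:ℝ) < A.card := by exact_mod_cast hA.card_pos
  by_contra hc
  push Not at hc
  nlinarith

lemma ov_sum {α β γ : Type*} (A : Finset α) (B1 : Finset β) (B0 : Finset γ)
    (P : β → α → Prop) (Q : γ → α → Prop) [∀ b a, Decidable (P b a)] [∀ b a, Decidable (Q b a)] :
    ∑ b ∈ B1, ∑ z ∈ B0, ((A.filter fun a => P b a ∧ Q z a).card : ℝ) =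
      ∑ a ∈ A, ((B1.filter fun b => P b a).card : ℝ) * ((B0.filter fun z => Q z a).card : ℝ) := by
  simp only [card_filter_and_sum]
  simp only [Finset.sum_mul_sum]
  rw [Finset.sum_comm (s := A)]
  refine sum_congr rfl fun b _ => ?_
  rw [Finset.sum_comm (s := A)]
  refine sum_congr rfl fun z _ => sum_congr rfl fun a _ => ?_
  by_cases h1 : P b a <;> by_cases h2 : Q z a <;> simp [h1, h2]

lemma mk_inj (m : (ZMod p)ˣ) : Function.Injective (fun b : ZMod p => (⟨m, b⟩ : Aff p)) := by
  intro a b h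
  simpa using h

lemma transferL (A : Finset (ZMod p)) (hA : A.Nonempty) (m m0 : (ZMod p)ˣ)
    (B1 B0 : Finset (ZMod p)) (h1 : B1.Nonempty) (h0 : B0.Nonempty) (δ : ℝ) (hδ : 0 < δ)
    (h : δ * A.card * (B1.card * B0.card) ≤ ∑ b ∈ B1, ∑ z ∈ B0,
      ((A.filter fun a => (⟨m, b⟩ : Aff p).act a ∈ A ∧ (⟨m0, z⟩ : Aff p).act a ∈ A).card : ℝ)) :
    ∃ b' : ZMod p, δ ^ 2 / 2 * (B1.card * B0.card) ≤ (((B1 ×ˢ B0).filter fun q =>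
        q.1 - ((m * m0⁻¹ : (ZMod p)ˣ) : ZMod p) * q.2 + b' ∈ Bs A (δ ^ 2 / 2) m).card : ℝ) := by
  classical
  obtain ⟨u', hu', h2⟩ := overlap A hA (B1.image fun b => (⟨m, b⟩ : Aff p))
    (B0.image fun b => (⟨m0, b⟩ : Aff p)) (h1.image _) (h0.image _) δ hδ (by
      rw [card_image_of_injective _ (mk_inj m), card_image_of_injective _ (mk_inj m0),
        sum_image (fun a _ b _ h => mk_inj m h)]
      simp_rw [sum_image (fun a _ b _ h => mk_inj m0 h)]
      exact h)
  rw [card_image_of_injective _ (mk_inj m), card_image_of_injective _ (mk_inj m0)] at h2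
  obtain ⟨b', -, rfl⟩ := mem_image.mp hu'
  refine ⟨((m * m0⁻¹ : (ZMod p)ˣ) : ZMod p) * b', h2.trans ?_⟩
  norm_cast
  apply Finset.card_le_card_of_injOn (fun q => (q.1.b, q.2.b))
  · rintro ⟨g, u⟩ hq
    simp only [coe_filter, mem_product, mem_image, Set.mem_ofPred_eq] at hq ⊢
    obtain ⟨⟨⟨b, hb, rfl⟩, ⟨z, hz, rfl⟩⟩, h3⟩ := hq
    refine ⟨⟨hb, hz⟩, ?_⟩
    rw [mem_Bs]
    convert h3 using 1
    refine Aff.ext ?_ ?_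
    · simp
    · simp only [Aff.mul_b, Aff.inv_b, Aff.mul_m, Aff.inv_m, Units.val_mul]
      ring_nf
  · rintro ⟨g, u⟩ hq ⟨g', u'⟩ hq' heq
    simp only [coe_filter, mem_product, mem_image, Set.mem_ofPred_eq] at hq hq'
    obtain ⟨⟨⟨b, hb, rfl⟩, ⟨z, hz, rfl⟩⟩, h3⟩ := hq
    obtain ⟨⟨⟨b, hb, rfl⟩, ⟨z, hz, rfl⟩⟩, h3⟩ := hq'
    simp only [Prod.mk.injEq] at heq
    rw [heq.1, heq.2]

lemma transferR (A : Finset (ZMod p)) (hA : A.Nonempty) (m m0 : (ZMod p)ˣ)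
    (B1 B0 : Finset (ZMod p)) (h1 : B1.Nonempty) (h0 : B0.Nonempty) (δ : ℝ) (hδ : 0 < δ)
    (h : δ * A.card * (B1.card * B0.card) ≤ ∑ b ∈ B1, ∑ z ∈ B0,
      ((A.filter fun a => (⟨m, b⟩⁻¹ : Aff p).act a ∈ A ∧ (⟨m0, z⟩⁻¹ : Aff p).act a ∈ A).card : ℝ)) :
    ∃ b' : ZMod p, δ ^ 2 / 2 * (B1.card * B0.card) ≤ (((B1 ×ˢ B0).filter fun q =>
        q.1 - 1 * q.2 + b' ∈ Bs A (δ ^ 2 / 2) m).card : ℝ) := by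
  classical
  have hi : ∀ m : (ZMod p)ˣ, Function.Injective (fun b : ZMod p => (⟨m, b⟩⁻¹ : Aff p)) :=
    fun m a b h => mk_inj m (inv_injective h)
  obtain ⟨u', hu', h2⟩ := overlap A hA (B1.image fun b => (⟨m, b⟩⁻¹ : Aff p))
    (B0.image fun b => (⟨m0, b⟩⁻¹ : Aff p)) (h1.image _) (h0.image _) δ hδ (by
      rw [card_image_of_injective _ (hi m), card_image_of_injective _ (hi m0),
        sum_image (fun a _ b _ h => hi m h)]
      simp_rw [sum_image (fun a _ b _ h => hi m0 h)]
      exact h)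
  rw [card_image_of_injective _ (hi m), card_image_of_injective _ (hi m0)] at h2
  obtain ⟨b', -, rfl⟩ := mem_image.mp hu'
  refine ⟨b', h2.trans ?_⟩
  norm_cast
  apply Finset.card_le_card_of_injOn (fun q => (q.1⁻¹.b, q.2⁻¹.b))
  · rintro ⟨g, u⟩ hq
    simp only [coe_filter, mem_product, mem_image, Set.mem_ofPred_eq] at hq ⊢
    obtain ⟨⟨⟨b, hb, rfl⟩, ⟨z, hz, rfl⟩⟩, h3⟩ := hq
    simp only [inv_inv]
    refine ⟨⟨hb, hz⟩, ?_⟩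
    rw [mem_Bs]
    rw [← inv_mem_S] at h3
    convert h3 using 1
    rw [mul_inv_rev, mul_inv_rev, inv_inv, inv_inv, inv_inv]
    refine Aff.ext ?_ ?_
    · simp
    · simp only [Aff.mul_b, Aff.inv_b, Aff.mul_m, Aff.inv_m, Units.val_mul]
      ring_nf
      simp only [mul_assoc, Units.mul_inv, Units.mul_inv_cancel_left, mul_one]
      try ring
  · rintro ⟨g, u⟩ hq ⟨g', u'⟩ hq' heq
    simp only [coe_filter, mem_product, mem_image, Set.mem_ofPred_eq] at hq hq'
    obtain ⟨⟨⟨b, hb, rfl⟩, ⟨z, hz, rfl⟩⟩, h3⟩ := hq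
    obtain ⟨⟨⟨b, hb, rfl⟩, ⟨z, hz, rfl⟩⟩, h3⟩ := hq'
    simp only [Prod.mk.injEq, inv_inv] at heq
    rw [heq.1, heq.2]

/-- pigeonhole on the translates -/
lemma translate_pigeon (B1 B0 P : Finset (ZMod p)) (l b' : ZMod p) (ε : ℝ) (hε : 0 < ε)
    (h1 : B1.Nonempty) (h0 : B0.Nonempty)
    (h : ε * (B1.card * B0.card) ≤ (((B1 ×ˢ B0).filter fun q =>
        q.1 - l * q.2 + b' ∈ P).card : ℝ)) :
    ∃ q : ZMod p, ε * (B1.card * B0.card) ≤ P.card *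
      ((B0.filter fun z => q + l * z ∈ B1).card : ℝ) := by
  classical
  have hG1 : (0:ℝ) < B1.card := by exact_mod_cast h1.card_pos
  have hG0 : (0:ℝ) < B0.card := by exact_mod_cast h0.card_pos
  obtain ⟨z, hz, h2⟩ := exists_large_fiber P ((B1 ×ˢ B0).filter fun q => q.1 - l * q.2 + b' ∈ P)
    (fun q => q.1 - l * q.2 + b') (fun e he => (mem_filter.mp he).2) (by
      rw [← card_pos]
      have : (0:ℝ) < ε * (B1.card * B0.card) := by positivity
      exact_mod_cast this.trans_le h)
  refine ⟨z - b', h.trans (h2.trans ?_)⟩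
  gcongr
  apply Finset.card_le_card_of_injOn (fun q => q.2)
  · rintro ⟨g, u⟩ hq
    simp only [coe_filter, mem_product, mem_filter, Set.mem_ofPred_eq] at hq ⊢
    refine ⟨hq.1.1.2, ?_⟩
    convert hq.1.1.1 using 1
    linear_combination -hq.2
  · rintro ⟨g, u⟩ hq ⟨g', u'⟩ hq' heq
    simp only [coe_filter, mem_product, mem_filter, Set.mem_ofPred_eq] at hq hq' heq
    subst heq
    have : g = g' := by linear_combination hq.2 - hq'.2
    rw [this]

lemma bsg_diff (B P : Finset (ZMod p)) (c : ZMod p) (δ : ℝ) (hδ : 0 < δ) (hB : B.Nonempty)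
    (h : δ * (B.card * B.card) ≤ (((B ×ˢ B).filter fun q => q.1 - 1 * q.2 + c ∈ P).card : ℝ)) :
    ∃ B' ⊆ B, δ / 2 * B.card ≤ (B'.card : ℝ) ∧
      ((B' - B').card : ℝ) * (δ / 4 * B.card * (δ ^ 2 / 64 * B.card) ^ 2) ≤ (P.card : ℝ) ^ 4 := by
  classical
  obtain ⟨s0, hs0, s', hs', hc, h⟩ := gowers B B (fun x y => x - y + c ∈ P) δ hδ hB (by
    rw [mul_assoc]
    refine h.trans (le_of_eq ?_)
    rw [card_filter_and_sum, sum_product]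
    simp only [one_mul, card_filter_and_sum])
  refine ⟨s', hs'.trans hs0, hc, ?_⟩
  have hs0c : (s'.card : ℝ) ≤ s0.card := by exact_mod_cast card_le_card hs'
  have key := card_mul_le_of_fibers (s' - s') ((P ×ˢ P) ×ˢ (P ×ˢ P))
    (fun q => q.1.1 - q.1.2 + (q.2.1 - q.2.2)) (δ / 4 * B.card * (δ ^ 2 / 64 * B.card) ^ 2) (by
    intro z hz
    obtain ⟨x1, hx1, x2, hx2, rfl⟩ := mem_sub.mp hz
    obtain ⟨w, hw, hwc, hwu⟩ := h x1 hx1 x2 hx2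
    simp only [cn] at hwu
    have h1 : (w.sigma fun u => (B.filter fun y => x1 - y + c ∈ P ∧ u - y + c ∈ P) ×ˢ
        (B.filter fun y => x2 - y + c ∈ P ∧ u - y + c ∈ P)).card ≤
        (((P ×ˢ P) ×ˢ (P ×ˢ P)).filter
        fun q => q.1.1 - q.1.2 + (q.2.1 - q.2.2) = x1 - x2).card := by
      apply Finset.card_le_card_of_injOn
        (fun t => ((x1 - t.2.1 + c, t.1 - t.2.1 + c), (t.1 - t.2.2 + c, x2 - t.2.2 + c)))
      · rintro ⟨u, y1, y2⟩ hu
        simp only [mem_coe, mem_sigma, mem_product, mem_filter] at hu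
        simp only [coe_filter, mem_product, Set.mem_ofPred_eq]
        refine ⟨⟨⟨hu.2.1.2.1, hu.2.1.2.2⟩, hu.2.2.2.2, hu.2.2.2.1⟩, by ring⟩
      · rintro ⟨u, y1, y2⟩ _ ⟨v, z1, z2⟩ _ huv
        simp only [Prod.mk.injEq] at huv
        obtain ⟨⟨e1, e2⟩, e3, e4⟩ := huv
        have f1 : y1 = z1 := by linear_combination -e1
        have f2 : y2 = z2 := by linear_combination -e4
        subst f1 f2
        have f3 : u = v := by linear_combination e2
        rw [f3]
    have h2 : (δ / 4 * B.card * (δ ^ 2 / 64 * B.card) ^ 2) ≤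
      ((w.sigma fun u => (B.filter fun y => x1 - y + c ∈ P ∧ u - y + c ∈ P) ×ˢ
        (B.filter fun y => x2 - y + c ∈ P ∧ u - y + c ∈ P)).card : ℝ) := by
      rw [card_sigma]
      push_cast
      calc δ / 4 * B.card * (δ ^ 2 / 64 * B.card) ^ 2 ≤ w.card * (δ ^ 2 / 64 * B.card) ^ 2 := by
            gcongr; linarith
        _ ≤ _ := by
          rw [← nsmul_eq_mul]
          apply Finset.card_nsmul_le_sum
          intro u hu
          rw [card_product, sq]
          push_cast
          have := hwu u hu
          gcongr
          · convert this.1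
          · convert this.2
    exact h2.trans (by exact_mod_cast h1))
  rw [card_product, card_product] at key
  push_cast at key
  calc _ ≤ _ := key
    _ = _ := by ring

end RL
end

section
open Finset
open scoped Pointwise

set_option linter.unusedSectionVars false

namespace RL
variable {p : ℕ} [Fact p.Prime]

lemma le_of_beta {L β x y : ℝ} (k : ℕ) (hL : 0 < L) (hβ : 0 < β) (hLβ : 1 ≤ L * β) (hx : 0 ≤ x)
    (h : x * β ^ k ≤ y) : x ≤ y * L ^ k := by
  have h1 : 1 ≤ (L * β) ^ k := one_le_pow₀ hLβ
  calc x = x * 1 := by ring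
    _ ≤ x * (L * β) ^ k := by gcongr
    _ = (x * β ^ k) * L ^ k := by rw [mul_pow]; ring
    _ ≤ y * L ^ k := by gcongr

lemma pow_ten_le {β : ℝ} (hβ : 0 < β) (hβ2 : β ≤ 1 / 2) : β ^ 10 ≤ β ^ 4 / 64 := by
  have : β ^ 6 ≤ (1/2) ^ 6 := by gcongr
  have h4 : 0 < β ^ 4 := by positivity
  calc β ^ 10 = β ^ 4 * β ^ 6 := by ring
    _ ≤ β ^ 4 * (1/2)^6 := by gcongr
    _ = _ := by ring

lemma sum_good_slice (A B : Finset (ZMod p)) (β : ℝ) (m : (ZMod p)ˣ) (hB : B ⊆ Bs A β m) :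
    β * A.card * B.card ≤ ∑ a ∈ A, ((B.filter fun b => (⟨m, b⟩ : Aff p).act a ∈ A).card : ℝ) := by
  have : ∑ a ∈ A, ((B.filter fun b => (⟨m, b⟩ : Aff p).act a ∈ A).card : ℝ) =
      ∑ b ∈ B, ((good A ⟨m, b⟩).card : ℝ) := by
    simp only [good, card_filter_and_sum]
    rw [sum_comm]
  rw [this, mul_comm, ← nsmul_eq_mul]
  apply Finset.card_nsmul_le_sum
  intro b hb
  exact mem_S.mp (mem_Bs.mp (hB hb))

lemma sum_good_slice_inv (A B : Finset (ZMod p)) (β : ℝ) (m : (ZMod p)ˣ) (hB : B ⊆ Bs A β m) :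
    β * A.card * B.card ≤ ∑ a ∈ A, ((B.filter fun b => (⟨m, b⟩⁻¹ : Aff p).act a ∈ A).card : ℝ) := by
  have : ∑ a ∈ A, ((B.filter fun b => (⟨m, b⟩⁻¹ : Aff p).act a ∈ A).card : ℝ) =
      ∑ b ∈ B, ((good A ⟨m, b⟩⁻¹).card : ℝ) := by
    simp only [good, card_filter_and_sum]
    rw [sum_comm]
  rw [this, mul_comm, ← nsmul_eq_mul]
  apply Finset.card_nsmul_le_sum
  intro b hb
  exact mem_S.mp (inv_mem_S.mpr (mem_Bs.mp (hB hb)))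

lemma pass0 (A : Finset (ZMod p)) (hA : A.Nonempty) (L β : ℝ) (hL : 64 ≤ L) (hβ : 0 < β)
    (hβ2 : β ≤ 1 / 2) (hLβ : 1 ≤ L * β) (m : (ZMod p)ˣ) (hr : (Bs A β m).Nonempty)
    (h : ((Bs A (β ^ 10) m).card : ℝ) ≤ L * (Bs A β m).card) :
    ∃ B' ⊆ Bs A β m, B'.Nonempty ∧ ((Bs A β m).card : ℝ) ≤ L ^ 6 * B'.card ∧
      ((B' - B').card : ℝ) ≤ L ^ 39 * B'.card := by
  classical
  have hL0 : (0:ℝ) < L := by linarith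
  have hL1 : (1:ℝ) ≤ L := by linarith
  have hN : (0:ℝ) < A.card := by exact_mod_cast hA.card_pos
  set B := Bs A β m with hB
  have hrp : (0:ℝ) < B.card := by exact_mod_cast hr.card_pos
  obtain ⟨b', hb'⟩ := transferL A hA m m B B hr hr (β ^ 2) (by positivity) (by
    rw [ov_sum]
    have h1 := sum_good_slice A B β m (subset_of_eq hB)
    have h2 := sq_sum_le_card_mul_sum_sq (s := A)
      (f := fun a => ((B.filter fun b => (⟨m, b⟩ : Aff p).act a ∈ A).card : ℝ))
    have h3 : (β * A.card * B.card) ^ 2 ≤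
      (∑ a ∈ A, ((B.filter fun b => (⟨m, b⟩ : Aff p).act a ∈ A).card : ℝ)) ^ 2 := by gcongr
    have h4 := h3.trans h2
    simp only [sq (Nat.cast _ : ℝ)] at h4
    have h5 : (A.card : ℝ) * (β ^ 2 * A.card * (B.card * B.card)) ≤ A.card * _ :=
      le_trans (le_of_eq (by ring)) h4
    exact le_of_mul_le_mul_left h5 hN)
  have hβ4 : (0:ℝ) < β ^ 4 := by positivity
  have e1 : (β ^ 2) ^ 2 / 2 = β ^ 4 / 2 := by ring
  rw [e1, mul_inv_cancel, Units.val_one] at hb'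
  obtain ⟨B', hB', hc, hd⟩ := bsg_diff B (Bs A (β ^ 4 / 2) m) b' (β ^ 4 / 2) (by positivity) hr hb'
  have hP : ((Bs A (β ^ 4 / 2) m).card : ℝ) ≤ L * B.card := by
    refine le_trans ?_ h
    norm_cast
    apply card_le_card
    apply Bs_mono
    have := pow_ten_le hβ hβ2
    linarith
  have hne : (0:ℝ) < B'.card := lt_of_lt_of_le (by positivity) hc
  have h6 : (B.card : ℝ) ≤ L ^ 5 * B'.card := by
    have := le_of_beta (x := B.card) (y := 4 * B'.card) 4 hL0 hβ hLβ (by positivity) (by linarith)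
    refine this.trans ?_
    calc 4 * B'.card * L ^ 4 ≤ L * B'.card * L ^ 4 := by gcongr; linarith
      _ = _ := by ring
  refine ⟨B', hB', ?_, ?_, ?_⟩
  · rw [← card_pos]; exact_mod_cast hne
  · refine h6.trans ?_
    gcongr
    · norm_num
  · set x : ℝ := ((B' - B').card : ℝ) with hx
    have hx0 : 0 ≤ x := by positivity
    set r : ℝ := (B.card : ℝ) with hrr
    have h7 : x * β ^ 20 ≤ 2 ^ 19 * L ^ 4 * r := by
      have : r ^ 3 * (x * β ^ 20) ≤ r ^ 3 * (2 ^ 19 * L ^ 4 * r) := by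
        have h8 : ((Bs A (β ^ 4 / 2) m).card : ℝ) ^ 4 ≤ (L * r) ^ 4 := by gcongr
        have h9 := hd.trans h8
        calc r ^ 3 * (x * β ^ 20) = 2 ^ 19 *
              (x * (β ^ 4 / 2 / 4 * r * ((β ^ 4 / 2) ^ 2 / 64 * r) ^ 2)) := by ring
          _ ≤ 2 ^ 19 * (L * r) ^ 4 := by gcongr
          _ = _ := by ring
      exact le_of_mul_le_mul_left this (by positivity)
    have h8 := le_of_beta 20 hL0 hβ hLβ hx0 h7
    calc x ≤ _ := h8
      _ = 2 ^ 19 * L ^ 24 * r := by ring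
      _ ≤ L ^ 4 * L ^ 24 * (L ^ 5 * B'.card) := by
        have : (64:ℝ) ^ 4 ≤ L ^ 4 := by gcongr
        gcongr
        refine le_trans ?_ this
        norm_num
      _ = L ^ 33 * B'.card := by ring
      _ ≤ _ := by
        gcongr
        · norm_num

lemma pass1 (A : Finset (ZMod p)) (hA : A.Nonempty) (L β : ℝ) (hL : 64 ≤ L) (hβ : 0 < β)
    (hβ2 : β ≤ 1 / 2) (hLβ : 1 ≤ L * β) (m : (ZMod p)ˣ) (B1 B0 : Finset (ZMod p)) (l b' : ZMod p)
    (h1 : B1.Nonempty) (h0 : B0.Nonempty) (k : ℕ)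
    (h : ((Bs A (β ^ 10) m).card : ℝ) ≤ L ^ k * B1.card)
    (hq : (β ^ 2 / 4) ^ 2 / 2 * (B1.card * B0.card) ≤ (((B1 ×ˢ B0).filter fun q =>
        q.1 - l * q.2 + b' ∈ Bs A ((β ^ 2 / 4) ^ 2 / 2) m).card : ℝ)) :
    ∃ q : ZMod p, (B0.card : ℝ) ≤ L ^ (k + 5) * ((B0.filter fun z => q + l * z ∈ B1).card : ℝ) := by
  have hL0 : (0:ℝ) < L := by linarith
  have hr1 : (0:ℝ) < B1.card := by exact_mod_cast h1.card_pos
  obtain ⟨q, hq⟩ := translate_pigeon _ _ _ _ _ _ (by positivity) h1 h0 hq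
  refine ⟨q, ?_⟩
  have hP : ((Bs A ((β ^ 2 / 4) ^ 2 / 2) m).card : ℝ) ≤ L ^ k * B1.card := by
    refine le_trans ?_ h
    norm_cast
    apply card_le_card
    apply Bs_mono
    have := pow_ten_le hβ hβ2
    have : (0:ℝ) < β ^ 4 := by positivity
    rw [show (β ^ 2 / 4) ^ 2 / 2 = β ^ 4 / 32 by ring]
    linarith
  set y : ℝ := ((B0.filter fun z => q + l * z ∈ B1).card : ℝ) with hy
  have h2 : B1.card * (B0.card * β ^ 4) ≤ B1.card * (32 * L ^ k * y) := by
    calc B1.card * (B0.card * β ^ 4) = 32 * ((β ^ 2 / 4) ^ 2 / 2 * (B1.card * B0.card)) := by ring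
      _ ≤ 32 * (L ^ k * B1.card * y) := by
        refine mul_le_mul_of_nonneg_left (hq.trans ?_) (by norm_num)
        gcongr
      _ = _ := by ring
  have h3 := le_of_mul_le_mul_left h2 hr1
  have h4 := le_of_beta 4 hL0 hβ hLβ (by positivity) h3
  calc (B0.card : ℝ) ≤ _ := h4
    _ = 32 * (L ^ k * L ^ 4 * y) := by ring
    _ ≤ L * (L ^ k * L ^ 4 * y) := by gcongr; linarith
    _ = _ := by ring

lemma pass3 (Z Z1 : Finset (ZMod p)) (hZ1 : Z1 ⊆ Z) (hZ1n : Z1.Nonempty) (L : ℝ) (hL : 64 ≤ L)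
    (hZZ : ((Z - Z).card : ℝ) ≤ L ^ 39 * Z.card) (hc : (Z.card : ℝ) ≤ L ^ 36 * Z1.card)
    (x q : ZMod p) (h : ∀ z ∈ Z1, x * z + q ∈ Z) :
    ∃ F : Finset (ZMod p), (F.card : ℝ) ≤ L ^ 114 ∧ ∀ z ∈ Z, ∃ f ∈ F, x * z - f ∈ Z - Z := by
  classical
  have hL0 : (0:ℝ) < L := by linarith
  have hZ : Z.Nonempty := hZ1n.mono hZ1
  have h2 := pr_bound hZ hZZ 2 0
  obtain ⟨F, _, hF, hcov⟩ := ruzsa_covering_add (A := Z) (B := Z1) (K := L ^ 114) hZ1n (by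
    calc ((Z + Z1).card : ℝ) ≤ ((ks 2 Z - ks 0 Z).card : ℝ) := by
          norm_cast
          apply card_le_card
          simp only [ks]
          rw [show ({0} : Finset (ZMod p)) = 0 from rfl, zero_add, sub_zero]
          exact add_subset_add_left hZ1
      _ ≤ _ := h2
      _ ≤ (L ^ 39) ^ 2 * (L ^ 36 * Z1.card) := by gcongr
      _ = _ := by ring)
  refine ⟨F.image fun f => x * f, ?_, ?_⟩
  · refine le_trans ?_ hF
    exact_mod_cast card_image_le
  · intro z hz
    obtain ⟨f, hf, d, hd, rfl⟩ := mem_add.mp (hcov hz)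
    obtain ⟨z1, hz1, z2, hz2, rfl⟩ := mem_sub.mp hd
    refine ⟨x * f, mem_image_of_mem _ hf, ?_⟩
    refine mem_sub.mpr ⟨_, h z1 hz1, _, h z2 hz2, by ring⟩

end RL
end

section
open Finset
open scoped Pointwise

set_option linter.unusedSectionVars false

namespace RL

lemma lemZ_ex : ∃ E : ℕ, ∀ (p : ℕ) [Fact p.Prime] (Z X : Finset (ZMod p)), Z.Nonempty →
    (∀ x ∈ X, x ≠ 0) → ∀ M : ℝ, 1 ≤ M → ((Z - Z).card : ℝ) ≤ M * Z.card →
    (∀ x ∈ X, ∃ F : Finset (ZMod p), (F.card : ℝ) ≤ M ∧ ∀ z ∈ Z, ∃ f ∈ F, x * z - f ∈ Z - Z) →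
    (X.card : ℝ) ≤ (2 * M) ^ E ∨ (p : ℝ) ≤ (2 * M) ^ E * Z.card ∨ (Z.card : ℝ) ≤ (2 * M) ^ E :=
  ⟨667, fun _ _ Z X hZ hX0 M hM hZZ hcov => lemZ Z X hZ hX0 M hM hZZ hcov⟩

variable {p : ℕ} [Fact p.Prime]

lemma filter_div_le {α : Type*} (B : Finset α) (P : α → Prop) [DecidablePred P] :
    ((B.filter P).card : ℝ) / B.card ≤ 1 := by
  apply div_le_one_of_le₀
  · exact_mod_cast card_filter_le _ _
  · positivity

set_option maxHeartbeats 2000000 in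
lemma descent : ∃ c : ℕ, ∀ (p : ℕ) [Fact p.Prime] (A : Finset (ZMod p)), A.Nonempty →
    ∀ (L β : ℝ), 64 ≤ L → 0 < β → β ≤ 1 / 2 → 1 ≤ L * β →
    ∀ D1 : Finset (ZMod p)ˣ, D1.Nonempty → (∀ m ∈ D1, (Bs A β m).Nonempty) →
    (∀ m ∈ D1, ((Bs A (β ^ 10) m).card : ℝ) ≤ L * (Bs A β m).card) →
    (D1.card : ℝ) ≤ L ^ c ∨ (∃ m ∈ D1, ((Bs A β m).card : ℝ) ≤ L ^ c) ∨ (p : ℝ) ≤ L ^ c * A.card := by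
  obtain ⟨E, hE⟩ := lemZ_ex
  refine ⟨115 * E + 6, ?_⟩
  intro p _ A hA L β hL hβ hβ2 hLβ D1 hD1 hne hreg
  classical
  have hL0 : (0:ℝ) < L := by linarith
  have hL1 : (1:ℝ) ≤ L := by linarith
  have hN : (0:ℝ) < A.card := by exact_mod_cast hA.card_pos
  -- pass 0
  have h0 : ∀ m : (ZMod p)ˣ, ∃ B' : Finset (ZMod p), m ∈ D1 → B' ⊆ Bs A β m ∧ B'.Nonempty ∧
      ((Bs A β m).card : ℝ) ≤ L ^ 6 * B'.card ∧ ((B' - B').card : ℝ) ≤ L ^ 39 * B'.card := by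
    intro m
    by_cases hm : m ∈ D1
    · obtain ⟨B', h⟩ := pass0 A hA L β hL hβ hβ2 hLβ m (hne m hm) (hreg m hm)
      exact ⟨B', fun _ => h⟩
    · exact ⟨∅, fun h => absurd h hm⟩
  choose B' hB' using h0
  -- pass 1
  obtain ⟨m0, hm0, D2, hD2, hD2c, hp⟩ := partner A D1 hA hD1
    (fun m a => (((B' m).filter fun b => (⟨m, b⟩ : Aff p).act a ∈ A).card : ℝ) / (B' m).card)
    (fun m => ((Bs A β m).card : ℝ)) β hβ (fun m _ a _ => div_nonneg (Nat.cast_nonneg _) (Nat.cast_nonneg _))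
    (fun m _ a _ => filter_div_le _ _) (by
      intro m hm
      have hpos : (0:ℝ) < (B' m).card := by exact_mod_cast (hB' m hm).2.1.card_pos
      rw [← sum_div, le_div_iff₀ hpos]
      exact sum_good_slice A (B' m) β m (hB' m hm).1)
  set Z := B' m0 with hZdef
  obtain ⟨hZs, hZn, hZr, hZZ⟩ := hB' m0 hm0
  have hZpos : (0:ℝ) < Z.card := by exact_mod_cast hZn.card_pos
  have h1 : ∀ m : (ZMod p)ˣ, ∃ q : ZMod p, m ∈ D2 → (Z.card : ℝ) ≤ L ^ 12 *
      ((Z.filter fun z => q + ((m * m0⁻¹ : (ZMod p)ˣ) : ZMod p) * z ∈ B' m).card : ℝ) := by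
    intro m
    by_cases hm : m ∈ D2
    · obtain ⟨h2, h3, h4, h5⟩ := hB' m (hD2 hm)
      have hpos : (0:ℝ) < (B' m).card := by exact_mod_cast h3.card_pos
      obtain ⟨b', hb'⟩ := transferL A hA m m0 (B' m) Z h3 hZn (β ^ 2 / 4) (by positivity) (by
        rw [ov_sum]
        have h6 := (hp m hm).2
        simp only [div_mul_div_comm] at h6
        rw [← sum_div, le_div_iff₀ (by positivity)] at h6
        exact h6)
      obtain ⟨q, hq⟩ := pass1 A hA L β hL hβ hβ2 hLβ m (B' m) Z _ b' h3 hZn 7 (by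
        calc _ ≤ _ := hreg m (hD2 hm)
          _ ≤ L * (L ^ 6 * (B' m).card) := by gcongr
          _ = _ := by ring) hb'
      exact ⟨q, fun _ => hq⟩
    · exact ⟨0, fun h => absurd h hm⟩
  choose q hq using h1
  set Zm : (ZMod p)ˣ → Finset (ZMod p) := fun m =>
    Z.filter fun z => q m + ((m * m0⁻¹ : (ZMod p)ˣ) : ZMod p) * z ∈ B' m with hZm
  set B2 : (ZMod p)ˣ → Finset (ZMod p) := fun m =>
    (Zm m).image fun z => q m + ((m * m0⁻¹ : (ZMod p)ˣ) : ZMod p) * z with hB2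
  have hinj : ∀ m : (ZMod p)ˣ, Function.Injective
      fun z : ZMod p => q m + ((m * m0⁻¹ : (ZMod p)ˣ) : ZMod p) * z := by
    intro m a b hab
    exact (Units.mul_right_inj _).mp (add_left_cancel hab)
  have hB2c : ∀ m, (B2 m).card = (Zm m).card := fun m => card_image_of_injective _ (hinj m)
  have hZmpos : ∀ m ∈ D2, (0:ℝ) < (Zm m).card := by
    intro m hm
    have := hq m hm
    by_contra hc
    have h0 : ((Zm m).card : ℝ) = 0 := le_antisymm (not_lt.mp hc) (by positivity)
    rw [h0] at this
    simp at this
    exact hZn.ne_empty this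
  have hB2n : ∀ m ∈ D2, (B2 m).Nonempty := by
    intro m hm
    rw [← card_pos, hB2c]
    exact_mod_cast hZmpos m hm
  have hB2s : ∀ m ∈ D2, B2 m ⊆ Bs A β m := by
    intro m hm b hb
    obtain ⟨z, hz, rfl⟩ := mem_image.mp hb
    exact (hB' m (hD2 hm)).1 (mem_filter.mp hz).2
  have hD2n : D2.Nonempty := by
    rw [← card_pos]
    have : (0:ℝ) < D1.card := by exact_mod_cast hD1.card_pos
    have : (0:ℝ) < β ^ 2 / 4 * D1.card := by positivity
    exact_mod_cast this.trans_le hD2c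
  -- pass 2
  obtain ⟨m1, hm1, D3, hD3, hD3c, hp2⟩ := partner A D2 hA hD2n
    (fun m a => (((B2 m).filter fun b => (⟨m, b⟩⁻¹ : Aff p).act a ∈ A).card : ℝ) / (B2 m).card)
    (fun m => 0) β hβ (fun m _ a _ => div_nonneg (Nat.cast_nonneg _) (Nat.cast_nonneg _))
    (fun m _ a _ => filter_div_le _ _) (by
      intro m hm
      have hpos : (0:ℝ) < (B2 m).card := by exact_mod_cast (hB2n m hm).card_pos
      rw [← sum_div, le_div_iff₀ hpos]
      exact sum_good_slice_inv A (B2 m) β m (hB2s m hm))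
  have hpos1 : (0:ℝ) < (B2 m1).card := by exact_mod_cast (hB2n m1 hm1).card_pos
  have h2 : ∀ m ∈ D3, ∃ q : ZMod p, ((B2 m1).card : ℝ) ≤ L ^ 24 *
      (((B2 m1).filter fun z => q + 1 * z ∈ B2 m).card : ℝ) := by
    intro m hm
    have hm2 := hD3 hm
    have hpos : (0:ℝ) < (B2 m).card := by exact_mod_cast (hB2n m hm2).card_pos
    obtain ⟨b', hb'⟩ := transferR A hA m m1 (B2 m) (B2 m1) (hB2n m hm2) (hB2n m1 hm1)
      (β ^ 2 / 4) (by positivity) (by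
        rw [ov_sum]
        have h6 := (hp2 m hm).2
        simp only [div_mul_div_comm] at h6
        rw [← sum_div, le_div_iff₀ (by positivity)] at h6
        exact h6)
    obtain ⟨q', hq'⟩ := pass1 A hA L β hL hβ hβ2 hLβ m (B2 m) (B2 m1) _ b' (hB2n m hm2)
      (hB2n m1 hm1) 19 (by
        calc _ ≤ _ := hreg m (hD2 hm2)
          _ ≤ L * (Bs A β m0).card := mul_le_mul_of_nonneg_left (hp m hm2).1 hL0.le
          _ ≤ L * (L ^ 6 * Z.card) := by gcongr
          _ ≤ L * (L ^ 6 * (L ^ 12 * (Zm m).card)) := by gcongr; exact hq m hm2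
          _ = L ^ 19 * (B2 m).card := by rw [hB2c]; ring) hb'
    exact ⟨q', hq'⟩
  -- covering
  have h3 : ∀ m ∈ D3, ∃ F : Finset (ZMod p), (F.card : ℝ) ≤ L ^ 114 ∧
      ∀ z ∈ Z, ∃ f ∈ F, ((m1 * m⁻¹ : (ZMod p)ˣ) : ZMod p) * z - f ∈ Z - Z := by
    intro m hm
    obtain ⟨q', hq'⟩ := h2 m hm
    set Z1 := (Zm m1).filter fun z =>
      q' + 1 * (q m1 + ((m1 * m0⁻¹ : (ZMod p)ˣ) : ZMod p) * z) ∈ B2 m with hZ1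
    have hZ1c : ((B2 m1).filter fun z => q' + 1 * z ∈ B2 m).card ≤ Z1.card := by
      rw [hB2, filter_image]
      exact card_image_le
    have hc : (Z.card : ℝ) ≤ L ^ 36 * Z1.card := by
      calc (Z.card : ℝ) ≤ L ^ 12 * (Zm m1).card := hq m1 hm1
        _ = L ^ 12 * (B2 m1).card := by rw [hB2c]
        _ ≤ L ^ 12 * (L ^ 24 * Z1.card) := by
          gcongr
          refine hq'.trans ?_
          gcongr
        _ = _ := by ring
    refine pass3 Z Z1 ((filter_subset _ _).trans (filter_subset _ _)) ?_ L hL hZZ hc _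
      ((m0 * m⁻¹ : (ZMod p)ˣ) * (q' + q m1 - q m)) ?_
    · rw [nonempty_iff_ne_empty]
      rintro hemp
      rw [hemp] at hc
      simp at hc
      exact hZn.ne_empty hc
    · intro z hz
      obtain ⟨hz1, hz2⟩ := mem_filter.mp hz
      obtain ⟨z', hz', heq⟩ := mem_image.mp hz2
      have hz'Z : z' ∈ Z := (mem_filter.mp hz').1
      convert hz'Z using 1
      apply (Units.mul_right_inj (m * m0⁻¹)).mp
      have e1 : ((m * m0⁻¹ : (ZMod p)ˣ) : ZMod p) * ((m0 * m⁻¹ : (ZMod p)ˣ) : ZMod p) = 1 := by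
        rw [← Units.val_mul]; simp
      have e2 : ((m * m0⁻¹ : (ZMod p)ˣ) : ZMod p) * ((m1 * m⁻¹ : (ZMod p)ˣ) : ZMod p) =
          ((m1 * m0⁻¹ : (ZMod p)ˣ) : ZMod p) := by
        rw [← Units.val_mul]
        congr 1
        rw [mul_comm m1 m⁻¹, mul_assoc, mul_comm m0⁻¹, mul_assoc, mul_inv_cancel_left]
      linear_combination z * e2 + (q' + q m1 - q m) * e1 - heq
  have hM1 : (1:ℝ) ≤ L ^ 114 := one_le_pow₀ hL1
  have hEL : (2 * L ^ 114) ^ E ≤ L ^ (115 * E) := by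
    rw [pow_mul]
    gcongr
    calc 2 * L ^ 114 ≤ L * L ^ 114 := by gcongr; linarith
      _ = _ := by ring
  set X : Finset (ZMod p) := D3.image fun m => ((m1 * m⁻¹ : (ZMod p)ˣ) : ZMod p) with hX
  have hXc : X.card = D3.card := by
    apply card_image_of_injective
    intro a b hab
    have := Units.ext hab
    simpa using this
  rcases hE p Z X hZn (by
      intro x hx
      obtain ⟨m, _, rfl⟩ := mem_image.mp hx
      exact Units.ne_zero _) (L ^ 114) hM1
      (hZZ.trans (by
        gcongr
        · norm_num)) (by
      intro x hx
      obtain ⟨m, hm, rfl⟩ := mem_image.mp hx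
      exact h3 m hm) with h | h | h
  · left
    rw [hXc] at h
    have h4 : (D1.card : ℝ) * β ^ 4 ≤ 16 * L ^ (115 * E) := by
      calc (D1.card : ℝ) * β ^ 4 = 16 * (β ^ 2 / 4 * (β ^ 2 / 4 * D1.card)) := by ring
        _ ≤ 16 * (β ^ 2 / 4 * D2.card) := by gcongr
        _ ≤ 16 * D3.card := by gcongr
        _ ≤ _ := by
          have := h.trans hEL
          gcongr
    have h5 := le_of_beta 4 hL0 hβ hLβ (by positivity) h4
    calc _ ≤ _ := h5
      _ ≤ L * L ^ (115 * E) * L ^ 4 := by gcongr; linarith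
      _ = L ^ (115 * E + 5) := by ring
      _ ≤ _ := by gcongr; norm_num
  · right; right
    have h4 := Bs_card_le A hA β m0
    have h5 := le_of_beta (x := ((Bs A β m0).card : ℝ)) 1 hL0 hβ hLβ (by positivity) (by simpa using h4)
    have h6 : (Z.card : ℝ) ≤ (Bs A β m0).card := by exact_mod_cast card_le_card hZs
    calc (p:ℝ) ≤ _ := h
      _ ≤ L ^ (115 * E) * (A.card * L ^ 1) := by
        have := h6.trans h5
        gcongr
      _ = L ^ (115 * E + 1) * A.card := by ring
      _ ≤ _ := by gcongr; norm_num
  · right; left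
    refine ⟨m0, hm0, ?_⟩
    calc _ ≤ _ := hZr
      _ ≤ L ^ 6 * L ^ (115 * E) := by
        have := h.trans hEL
        gcongr
      _ = _ := by ring

end RL
end

section
open Finset
open scoped Pointwise

set_option linter.unusedSectionVars false

namespace RL

/-- structure theorem with exponent `E` -/
def AffE (E : ℕ) : Prop := ∀ (p : ℕ) [Fact p.Prime] (S0 : Finset (Aff p)), S0.Nonempty →
    ∀ M : ℝ, 1 ≤ M → ((S0 * S0⁻¹).card : ℝ) ≤ M * S0.card →
    (∃ z : ZMod p, ∃ W : Finset (ZMod p), (W.card : ℝ) ≤ (2 * M) ^ E ∧ ∀ s ∈ S0, s.act z ∈ W) ∨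
    ((slopes S0).card : ℝ) ≤ (2 * M) ^ E ∨
    (p : ℝ) * (slopes S0).card ≤ (2 * M) ^ E * S0.card

lemma affE_ex : ∃ E : ℕ, AffE E := ⟨95, fun _ _ S0 hS M hM h => aff_structure S0 hS M hM h⟩

variable {p : ℕ} [Fact p.Prime]

lemma conc_bound (A : Finset (ZMod p)) (β : ℝ) (h2 : 2 ≤ β * A.card) (z w : ZMod p) :
    (((S A β).filter fun g => g.act z = w).card : ℝ) * β ≤ 2 * A.card := by
  have h := concurrent_le A β z w
  have hN : (0:ℝ) < A.card := by
    by_contra hc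
    have : (A.card : ℝ) = 0 := le_antisymm (not_lt.mp hc) (by positivity)
    rw [this] at h2; linarith
  set x : ℝ := (((S A β).filter fun g => g.act z = w).card : ℝ)
  have hx : 0 ≤ x := by positivity
  have h3 : x * (β * A.card) / 2 ≤ (A.card : ℝ) ^ 2 := by nlinarith
  by_contra hc
  push Not at hc
  nlinarith

lemma star_bound (A : Finset (ZMod p)) (β : ℝ) (h2 : 2 ≤ β * A.card) (hβ : 0 < β)
    (S0 : Finset (Aff p)) (hS : S0 ⊆ S A β) (z : ZMod p) (W : Finset (ZMod p))
    (hW : ∀ s ∈ S0, s.act z ∈ W) : (S0.card : ℝ) * β ≤ W.card * (2 * A.card) := by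
  classical
  have h1 : (S0.card : ℝ) = ∑ w ∈ W, ((S0.filter fun s => s.act z = w).card : ℝ) := by
    exact_mod_cast card_eq_sum_card_fiberwise hW
  rw [h1, sum_mul, ← nsmul_eq_mul]
  apply sum_le_card_nsmul
  intro w _
  refine le_trans ?_ (conc_bound A β h2 z w)
  gcongr

lemma slopes_bound (A : Finset (ZMod p)) (hA : A.Nonempty) (β : ℝ) (hβ : 0 < β)
    (S0 : Finset (Aff p)) (hS : S0 ⊆ S A β) :
    (S0.card : ℝ) * β ≤ (slopes S0).card * A.card := by
  classical
  have h1 : (S0.card : ℝ) = ∑ w ∈ slopes S0, ((S0.filter fun s => s.m = w).card : ℝ) := by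
    exact_mod_cast card_eq_sum_card_fiberwise (fun s hs => mem_image_of_mem _ hs)
  rw [h1, sum_mul, ← nsmul_eq_mul]
  apply sum_le_card_nsmul
  intro m _
  refine le_trans ?_ (Bs_card_le A hA β m)
  rw [Bs_card]
  gcongr

lemma two_points (A : Finset (ZMod p)) (β : ℝ) (h2 : 2 ≤ β * A.card) (hβ : 0 < β)
    (S0 : Finset (Aff p)) (hS : S0 ⊆ S A β) (z z' : ZMod p) (W W' : Finset (ZMod p))
    (hW : ∀ s ∈ S0, s.act z ∈ W) (hW' : ∀ s ∈ S0, s⁻¹.act z' ∈ W') :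
    (S0.card : ℝ) * β ≤ 2 * A.card + W.card * W'.card * β := by
  classical
  have h1 : (S0.filter fun s => ¬ s.act z = z').card ≤ (W ×ˢ W').card := by
    apply card_le_card_of_injOn (fun s => (s.act z, s⁻¹.act z'))
    · intro s hs
      simp only [coe_filter, Set.mem_ofPred_eq] at hs
      simp only [mem_coe, mem_product]
      exact ⟨hW s hs.1, hW' s hs.1⟩
    · intro s hs t ht hst
      simp only [coe_filter, Set.mem_ofPred_eq] at hs ht
      simp only [Prod.mk.injEq] at hst
      have hne : z ≠ s⁻¹.act z' := by
        intro h
        apply hs.2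
        rw [h]; simp
      refine Aff.eq_of_act hne hst.1 ?_
      rw [Aff.act_act_inv, hst.2, Aff.act_act_inv]
  have h3 : (S0.filter fun s => s.act z = z').card +
      (S0.filter fun s => ¬ s.act z = z').card = S0.card := card_filter_add_card_filter_not _
  have h4 : ((S0.filter fun s => s.act z = z').card : ℝ) * β ≤ 2 * A.card := by
    refine le_trans ?_ (conc_bound A β h2 z z')
    gcongr
  have h5 : ((S0.filter fun s => ¬ s.act z = z').card : ℝ) ≤ W.card * W'.card := by
    rw [card_product] at h1
    exact_mod_cast h1
  have h6 : (S0.card : ℝ) = ((S0.filter fun s => s.act z = z').card : ℝ) +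
      ((S0.filter fun s => ¬ s.act z = z').card : ℝ) := by exact_mod_cast h3.symm
  rw [h6, add_mul]
  gcongr

lemma chain (f : ℕ → ℝ) (L : ℝ) (hL : 0 ≤ L) (J : ℕ) (h : ∀ i < J, L * f i ≤ f (i + 1)) :
    L ^ J * f 0 ≤ f J := by
  induction J with
  | zero => simp
  | succ k ih =>
    have := ih fun i hi => h i (by omega)
    calc L ^ (k + 1) * f 0 = L * (L ^ k * f 0) := by ring
      _ ≤ L * f k := by gcongr
      _ ≤ _ := h k (by omega)

lemma sq64_le {β : ℝ} (hβ : 0 < β) (hβ2 : β ≤ 1 / 2) : β ^ 10 ≤ β ^ 2 / 64 := by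
  have h := pow_ten_le hβ hβ2
  have : β ^ 4 ≤ β ^ 2 := pow_le_pow_of_le_one hβ.le (by linarith) (by norm_num)
  linarith

lemma regimeB (E Q J c2 : ℕ) (hE : AffE E) (hQ : 7 * E + 10 ≤ Q) (hJ : Q * c2 + 3 ≤ J)
    (A : Finset (ZMod p)) (hA : A.Nonempty) (L β : ℝ) (hL : 64 ≤ L) (hβ : 0 < β)
    (hβ2 : β ≤ 1 / 2) (hLβ : ∀ i ≤ J, 1 ≤ L * β ^ (10 ^ i))
    (hK : L ^ Q * A.card = (S A β).card) (hp : A.card * L ^ Q ≤ p * L ^ 2)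
    (hN : L ^ Q ≤ A.card * L ^ 2) (hB : (A.card : ℝ) < (L ^ Q) ^ c2) : False := by
  classical
  have hL0 : (0:ℝ) < L := by linarith
  have hL1 : (1:ℝ) < L := by linarith
  have hNp : (0:ℝ) < A.card := by exact_mod_cast hA.card_pos
  have hLN : L ^ 3 ≤ A.card := by
    have : L ^ 2 * L ^ 3 ≤ L ^ 2 * A.card := by
      calc L ^ 2 * L ^ 3 = L ^ 5 := by ring
        _ ≤ L ^ Q := pow_le_pow_right₀ hL1.le (by omega)
        _ ≤ _ := by linarith
    exact le_of_mul_le_mul_left this (by positivity)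
  have hβi : ∀ i ≤ J, 2 ≤ β ^ (10 ^ i) * A.card := by
    intro i hi
    have h1 := hLβ i hi
    have hb : 0 < β ^ (10 ^ i) := by positivity
    calc (2:ℝ) ≤ 1 * L ^ 2 := by nlinarith
      _ ≤ L * β ^ (10 ^ i) * L ^ 2 := by gcongr
      _ = β ^ (10 ^ i) * L ^ 3 := by ring
      _ ≤ _ := by gcongr
  -- find a good scale
  have hex : ∃ i < J, ((S A (β ^ (10 ^ (i + 1)))).card : ℝ) ≤ L * (S A (β ^ (10 ^ i))).card := by
    by_contra hcon
    push Not at hcon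
    have h1 := chain (fun i => ((S A (β ^ (10 ^ i))).card : ℝ)) L hL0.le J
      (fun i hi => (hcon i hi).le)
    simp only [pow_zero, pow_one] at h1
    rw [← hK] at h1
    have h2 := S_trivial A (β ^ (10 ^ J)) (hβi J le_rfl)
    have h3 := le_of_beta 2 hL0 (by positivity) (hLβ J le_rfl) (by positivity) h2
    have h4 : A.card * L ^ (J + Q) ≤ A.card * (2 * A.card * L ^ 2) := by
      calc A.card * L ^ (J + Q) = L ^ J * (L ^ Q * A.card) := by ring
        _ ≤ _ := h1.trans h3
        _ = _ := by ring
    have h5 := le_of_mul_le_mul_left h4 hNp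
    have h6 : 2 * (A.card : ℝ) * L ^ 2 < L ^ (J + Q) := by
      calc 2 * (A.card : ℝ) * L ^ 2 ≤ 2 * (L ^ Q) ^ c2 * L ^ 2 := by gcongr
        _ < L * (L ^ Q) ^ c2 * L ^ 2 := by gcongr; linarith
        _ = L ^ (Q * c2 + 3) := by rw [← pow_mul]; ring
        _ ≤ _ := pow_le_pow_right₀ hL1.le (by omega)
    linarith
  obtain ⟨i, hi, hreg⟩ := hex
  have hLi := hLβ i hi.le
  have h2N := hβi i hi.le
  have e10 : β ^ (10 ^ (i + 1)) = (β ^ (10 ^ i)) ^ 10 := by rw [← pow_mul, pow_succ]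
  rw [e10] at hreg
  have hbi2 : β ^ (10 ^ i) ≤ 1 / 2 := by
    refine le_trans ?_ hβ2
    calc β ^ (10 ^ i) ≤ β ^ 1 := pow_le_pow_of_le_one hβ.le (by linarith) (Nat.one_le_pow _ _ (by norm_num))
      _ = β := pow_one β
  have hmono : (S A β) ⊆ S A (β ^ (10 ^ i)) := by
    apply S_mono
    calc β ^ (10 ^ i) ≤ β ^ 1 := pow_le_pow_of_le_one hβ.le (by linarith) (Nat.one_le_pow _ _ (by norm_num))
      _ = β := pow_one β
  have hb : 0 < β ^ (10 ^ i) := by positivity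
  generalize β ^ (10 ^ i) = b at *
  set R : ℝ := ((S A b).card : ℝ) with hR
  have hRK : L ^ Q * A.card ≤ R := by rw [hK, hR]; exact_mod_cast card_le_card hmono
  have hRpos : 0 < R := lt_of_lt_of_le (by positivity) hRK
  obtain ⟨S', hS', hc, hd⟩ := rich_gowers A hA b hb (S A b) subset_rfl
  rw [← hR] at hc hd
  have hS'pos : (0:ℝ) < S'.card := lt_of_lt_of_le (by positivity) hc
  have hS'n : S'.Nonempty := by rw [← card_pos]; exact_mod_cast hS'pos
  have hRS : R ≤ L ^ 2 * S'.card := by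
    have := le_of_beta (x := R) (y := 2 * S'.card) 1 hL0 hb hLi hRpos.le (by linarith)
    calc R ≤ _ := this
      _ = 2 * (L * S'.card) := by ring
      _ ≤ L * (L * S'.card) := by gcongr; linarith
      _ = _ := by ring
  have hdoub : ((S' * S'⁻¹).card : ℝ) ≤ L ^ 6 * S'.card := by
    have h1 : ((S A (b ^ 2 / 64)).card : ℝ) ≤ L * R := by
      refine le_trans ?_ hreg
      exact_mod_cast card_le_card (S_mono (sq64_le hb hbi2))
    have h2 : R * (((S' * S'⁻¹).card : ℝ) * b ^ 1) ≤ R * (4 * L ^ 2 * R) := by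
      calc R * (((S' * S'⁻¹).card : ℝ) * b ^ 1) = 4 * (((S' * S'⁻¹).card : ℝ) * (b / 4 * R)) := by ring
        _ ≤ 4 * (L * R) ^ 2 := by
          refine mul_le_mul_of_nonneg_left (hd.trans ?_) (by norm_num)
          gcongr
        _ = _ := by ring
    have h3 := le_of_mul_le_mul_left h2 hRpos
    have h4 := le_of_beta 1 hL0 hb hLi (by positivity) h3
    calc _ ≤ _ := h4
      _ ≤ L * L ^ 2 * (L ^ 2 * S'.card) * L ^ 1 := by gcongr; linarith
      _ = _ := by ring
  have hLow : L ^ Q * A.card ≤ L ^ 2 * S'.card := hRK.trans hRS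
  have hEL : (2 * L ^ 6) ^ E ≤ L ^ (7 * E) := by
    rw [pow_mul]
    gcongr
    calc 2 * L ^ 6 ≤ L * L ^ 6 := by gcongr; linarith
      _ = _ := by ring
  -- final contradiction from an upper bound of `S'`
  have hfin : ¬ ((S'.card : ℝ) * b ≤ L ^ (7 * E) * (2 * A.card)) := by
    intro h1
    have h2 := le_of_beta (x := (S'.card : ℝ)) 1 hL0 hb hLi hS'pos.le (by simpa using h1)
    have h3 : A.card * L ^ Q ≤ A.card * L ^ (7 * E + 4) := by
      calc A.card * L ^ Q ≤ L ^ 2 * S'.card := by linarith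
        _ ≤ L ^ 2 * (L ^ (7 * E) * (2 * A.card) * L ^ 1) := by gcongr
        _ ≤ L ^ 2 * (L ^ (7 * E) * (L * A.card) * L ^ 1) := by gcongr; linarith
        _ = _ := by ring
    have h4 := le_of_mul_le_mul_left h3 hNp
    have h5 : L ^ (7 * E + 4) < L ^ Q := pow_lt_pow_right₀ hL1 (by omega)
    linarith
  rcases hE p S' hS'n (L ^ 6) (one_le_pow₀ hL1.le) hdoub with ⟨z, W, hW, hs⟩ | h | h
  · apply hfin
    refine (star_bound A b h2N hb S' hS' z W hs).trans ?_
    have := hW.trans hEL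
    gcongr
  · apply hfin
    refine (slopes_bound A hA b hb S' hS').trans ?_
    have := h.trans hEL
    gcongr
    linarith
  · have h1 := slopes_bound A hA b hb S' hS'
    have h2 := le_of_beta (x := (S'.card : ℝ)) 1 hL0 hb hLi hS'pos.le (by simpa using h1)
    have hsl : (0:ℝ) < (slopes S').card := by
      have : (slopes S').Nonempty := hS'n.image _
      exact_mod_cast this.card_pos
    have h3 : (slopes S').card * (p:ℝ) ≤ (slopes S').card * (L ^ (7 * E + 1) * A.card) := by
      calc (slopes S').card * (p:ℝ) = p * (slopes S').card := by ring
        _ ≤ _ := h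
        _ ≤ L ^ (7 * E) * ((slopes S').card * A.card * L ^ 1) := by gcongr
        _ = _ := by ring
    have h4 := le_of_mul_le_mul_left h3 hsl
    have h5 : A.card * L ^ Q ≤ A.card * L ^ (7 * E + 3) := by
      calc A.card * L ^ Q ≤ _ := hp
        _ ≤ L ^ (7 * E + 1) * A.card * L ^ 2 := by gcongr
        _ = _ := by ring
    have h6 := le_of_mul_le_mul_left h5 hNp
    have h7 : L ^ (7 * E + 3) < L ^ Q := pow_lt_pow_right₀ hL1 (by omega)
    linarith

end RL
end

section
open Finset
open scoped Pointwise

set_option linter.unusedSectionVars false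

namespace RL
variable {p : ℕ} [Fact p.Prime]

lemma double_gowers (A : Finset (ZMod p)) (hA : A.Nonempty) (K β : ℝ) (hβ : 0 < β)
    (hβ2 : β ≤ 1 / 2) (hKβ : 64 ≤ K * β ^ 4) (hK : K * A.card = (S A β).card)
    (hR : ((S A (β ^ 10)).card : ℝ) ≤ K ^ 10 * A.card) :
    ∃ S2 ⊆ S A β, S2.Nonempty ∧ β ^ 2 / 4 * (K * A.card) ≤ S2.card ∧
      ((S2 * S2⁻¹).card : ℝ) ≤ K ^ 19 * S2.card ∧ ((S2⁻¹ * S2).card : ℝ) ≤ K ^ 19 * S2.card := by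
  classical
  have hNp : (0:ℝ) < A.card := by exact_mod_cast hA.card_pos
  have hK0 : 0 < K := by
    by_contra hc
    push Not at hc
    have : 0 ≤ β ^ 4 := by positivity
    nlinarith
  have hR2 : ((S A (β ^ 2 / 64)).card : ℝ) ≤ K ^ 10 * A.card := by
    refine le_trans ?_ hR
    exact_mod_cast card_le_card (S_mono (sq64_le hβ hβ2))
  obtain ⟨S1, hS1, hc1, hd1⟩ := rich_gowers A hA β hβ (S A β) subset_rfl
  rw [← hK] at hc1 hd1
  obtain ⟨T, hT, hc2, hd2⟩ := rich_gowers A hA β hβ S1⁻¹ (by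
    intro g hg
    obtain ⟨h, hh, rfl⟩ := mem_inv.mp hg
    exact inv_mem_S.mpr (hS1 hh))
  rw [card_inv] at hc2 hd2
  have hTS : T⁻¹ ⊆ S1 := by
    intro g hg
    obtain ⟨h, hh, rfl⟩ := mem_inv.mp hg
    obtain ⟨h', hh', rfl⟩ := mem_inv.mp (hT hh)
    simpa using hh'
  have hlow : β ^ 2 / 4 * (K * A.card) ≤ T.card := by
    calc β ^ 2 / 4 * (K * A.card) = β / 2 * (β / 2 * (K * A.card)) := by ring
      _ ≤ β / 2 * S1.card := by gcongr
      _ ≤ _ := hc2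
  have hTpos : (0:ℝ) < T.card := lt_of_lt_of_le (by positivity) hlow
  have gen : ∀ x : ℝ, 0 ≤ x → x * (β ^ 2 / 8 * (K * A.card)) ≤ (K ^ 10 * A.card) ^ 2 →
      x ≤ K ^ 19 * T.card := by
    intro x hx h
    have h1 : x * β ^ 2 ≤ 8 * K ^ 19 * A.card := by
      have : K * A.card * (x * β ^ 2) ≤ K * A.card * (8 * K ^ 19 * A.card) := by
        calc K * A.card * (x * β ^ 2) = 8 * (x * (β ^ 2 / 8 * (K * A.card))) := by ring
          _ ≤ 8 * (K ^ 10 * A.card) ^ 2 := by gcongr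
          _ = _ := by ring
      exact le_of_mul_le_mul_left this (by positivity)
    have h2 : x * 64 ≤ 32 * (K ^ 19 * T.card) := by
      calc x * 64 ≤ x * (K * β ^ 4) := by gcongr
        _ = K * β ^ 2 * (x * β ^ 2) := by ring
        _ ≤ K * β ^ 2 * (8 * K ^ 19 * A.card) := by gcongr
        _ = 32 * K ^ 19 * (β ^ 2 / 4 * (K * A.card)) := by ring
        _ ≤ 32 * K ^ 19 * T.card := by gcongr
        _ = _ := by ring
    have : 0 ≤ K ^ 19 * T.card := by positivity
    linarith
  refine ⟨T⁻¹, hTS.trans hS1, ?_, ?_, ?_, ?_⟩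
  · rw [← card_pos, card_inv]; exact_mod_cast hTpos
  · rw [card_inv]; exact hlow
  · rw [card_inv]
    have h1 : ((T⁻¹ * (T⁻¹)⁻¹).card : ℝ) ≤ ((S1 * S1⁻¹).card : ℝ) := by
      norm_cast
      apply card_le_card
      gcongr
    refine h1.trans (gen _ (by positivity) ?_)
    calc ((S1 * S1⁻¹).card : ℝ) * (β ^ 2 / 8 * (K * A.card)) ≤
          ((S1 * S1⁻¹).card : ℝ) * (β / 4 * (K * A.card)) := by
          gcongr ?_ * (?_ * ?_)
          nlinarith
      _ ≤ _ := hd1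
      _ ≤ _ := by gcongr
  · rw [card_inv, inv_inv]
    refine gen _ (by positivity) ?_
    calc ((T * T⁻¹).card : ℝ) * (β ^ 2 / 8 * (K * A.card)) =
          ((T * T⁻¹).card : ℝ) * (β / 4 * (β / 2 * (K * A.card))) := by ring
      _ ≤ ((T * T⁻¹).card : ℝ) * (β / 4 * S1.card) := by gcongr
      _ ≤ _ := hd2
      _ ≤ _ := by gcongr

lemma slopes_inv (S0 : Finset (Aff p)) : (slopes S0⁻¹).card = (slopes S0).card := by
  classical
  have : slopes S0⁻¹ = (slopes S0)⁻¹ := by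
    ext m
    simp only [slopes, mem_image, mem_inv]
    constructor
    · rintro ⟨g, ⟨h, hh, rfl⟩, rfl⟩
      exact ⟨h.m, ⟨h, hh, rfl⟩, by simp⟩
    · rintro ⟨g, ⟨h, hh, rfl⟩, rfl⟩
      exact ⟨h⁻¹, ⟨h, hh, rfl⟩, by simp⟩
  rw [this, card_inv]

lemma few_slopes (E : ℕ) (hE : AffE E) (A : Finset (ZMod p)) (hA : A.Nonempty) (K β : ℝ)
    (hβ : 0 < β) (hβ2 : β ≤ 1 / 2) (hKβ : 64 ≤ K * β ^ 4) (h2N : 2 ≤ β * A.card)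
    (hN : K ^ (40 * E) ≤ A.card) (hK : K * A.card = (S A β).card)
    (S2 : Finset (Aff p)) (hS2 : S2 ⊆ S A β) (hne : S2.Nonempty)
    (hlow : β ^ 2 / 4 * (K * A.card) ≤ S2.card)
    (h1 : ((S2 * S2⁻¹).card : ℝ) ≤ K ^ 19 * S2.card)
    (h2 : ((S2⁻¹ * S2).card : ℝ) ≤ K ^ 19 * S2.card) :
    ((slopes S2).card : ℝ) ≤ K ^ (20 * E + 1) := by
  classical
  have hNp : (0:ℝ) < A.card := by exact_mod_cast hA.card_pos
  have hK64 : 64 ≤ K := by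
    have : β ^ 4 ≤ 1 := pow_le_one₀ hβ.le (by linarith)
    by_contra hc
    have : 0 < β ^ 4 := by positivity
    nlinarith
  have hK1 : 1 ≤ K := by linarith
  have hK0 : 0 < K := by linarith
  have hEK : (2 * K ^ 19) ^ E ≤ K ^ (20 * E) := by
    rw [pow_mul]
    gcongr
    calc 2 * K ^ 19 ≤ K * K ^ 19 := by gcongr; linarith
      _ = _ := by ring
  have hup : K ^ (20 * E) ≤ K ^ (20 * E + 1) := pow_le_pow_right₀ hK1 (by omega)
  have hS2K : (S2.card : ℝ) ≤ K * A.card := by rw [hK]; exact_mod_cast card_le_card hS2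
  have gen : ∀ y : ℝ, 0 ≤ y → (p : ℝ) * y ≤ (2 * K ^ 19) ^ E * S2.card → y ≤ K ^ (20 * E + 1) := by
    intro y hy h
    have h3 : A.card * y ≤ A.card * K ^ (20 * E + 1) := by
      calc A.card * y ≤ p * y := by gcongr; exact_mod_cast card_le_p A
        _ ≤ _ := h
        _ ≤ K ^ (20 * E) * (K * A.card) := by gcongr
        _ = _ := by ring
    exact le_of_mul_le_mul_left h3 hNp
  have hM : (1:ℝ) ≤ K ^ 19 := one_le_pow₀ hK1
  rcases hE p S2 hne (K ^ 19) hM h1 with ⟨z, W, hW, hs⟩ | h | h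
  · rcases hE p S2⁻¹ (hne.inv) (K ^ 19) hM (by rw [inv_inv, card_inv]; exact h2) with
      ⟨z', W', hW', hs'⟩ | h | h
    · exfalso
      have h3 := two_points A β h2N hβ S2 hS2 z z' W W' hs (fun s hs => hs' _ (inv_mem_inv hs))
      have h4 : (W.card : ℝ) * W'.card * β ≤ A.card * 1 := by
        calc (W.card : ℝ) * W'.card * β ≤ K ^ (20 * E) * K ^ (20 * E) * 1 := by
              have := hW.trans hEK
              have := hW'.trans hEK
              gcongr
              linarith
          _ = K ^ (40 * E) := by ring
          _ ≤ A.card * 1 := by linarith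
      have h5 : A.card * (K * β ^ 4) ≤ A.card * 12 := by
        calc A.card * (K * β ^ 4) = 4 * β * (β ^ 2 / 4 * (K * A.card) * β) := by ring
          _ ≤ 4 * β * (S2.card * β) := by gcongr
          _ ≤ 4 * 1 * (3 * A.card) := by
            have hb3 : (S2.card : ℝ) * β ≤ 3 * A.card := by linarith
            gcongr 4 * ?_ * ?_
            linarith
          _ = _ := by ring
      have := le_of_mul_le_mul_left h5 hNp
      linarith
    · rw [slopes_inv] at h
      exact (h.trans hEK).trans hup
    · rw [slopes_inv, card_inv] at h
      exact gen _ (by positivity) h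
  · exact (h.trans hEK).trans hup
  · exact gen _ (by positivity) h

/-- many rich slopes -/
lemma rich_slopes (e : ℕ) (A : Finset (ZMod p)) (hA : A.Nonempty) (K β : ℝ)
    (hβ : 0 < β) (hβ2 : β ≤ 1 / 2) (hKβ : 64 ≤ K * β ^ 4)
    (S2 : Finset (Aff p)) (hS2 : S2 ⊆ S A β)
    (hlow : β ^ 2 / 4 * (K * A.card) ≤ S2.card)
    (hsl : ((slopes S2).card : ℝ) ≤ K ^ e) :
    ∃ D0 : Finset (ZMod p)ˣ, K * β ^ 3 ≤ 8 * D0.card ∧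
      ∀ m ∈ D0, (A.card : ℝ) ≤ K ^ (e + 1) * (Bs A β m).card := by
  classical
  have hNp : (0:ℝ) < A.card := by exact_mod_cast hA.card_pos
  have hK64 : 64 ≤ K := by
    have : β ^ 4 ≤ 1 := pow_le_one₀ hβ.le (by linarith)
    by_contra hc
    have : 0 < β ^ 4 := by positivity
    nlinarith
  have hK0 : 0 < K := by linarith
  refine ⟨(slopes S2).filter fun m => (A.card : ℝ) ≤ K ^ (e + 1) * (Bs A β m).card, ?_,
    fun m hm => (mem_filter.mp hm).2⟩
  set D0 := (slopes S2).filter fun m => (A.card : ℝ) ≤ K ^ (e + 1) * (Bs A β m).card with hD0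
  have h1 : (S2.card : ℝ) = ∑ w ∈ slopes S2, ((S2.filter fun s => s.m = w).card : ℝ) := by
    exact_mod_cast card_eq_sum_card_fiberwise (fun s hs => mem_image_of_mem _ hs)
  have hfib : ∀ m, ((S2.filter fun s => s.m = m).card : ℝ) ≤ (Bs A β m).card := by
    intro m
    rw [Bs_card]
    gcongr
  rw [← sum_filter_add_sum_filter_not _
    (fun m => (A.card : ℝ) ≤ K ^ (e + 1) * (Bs A β m).card)] at h1
  have h2 : (∑ w ∈ D0, ((S2.filter fun s => s.m = w).card : ℝ)) * β ≤ D0.card * A.card := by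
    rw [sum_mul, ← nsmul_eq_mul]
    apply sum_le_card_nsmul
    intro m _
    refine le_trans ?_ (Bs_card_le A hA β m)
    gcongr
    exact_mod_cast hfib m
  have h3 : K ^ (e + 1) * (∑ w ∈ (slopes S2).filter fun m => ¬ (A.card : ℝ) ≤ K ^ (e + 1) * (Bs A β m).card,
      ((S2.filter fun s => s.m = w).card : ℝ)) ≤ K ^ e * A.card := by
    rw [mul_sum]
    calc _ ≤ ∑ w ∈ (slopes S2).filter fun m => ¬ (A.card : ℝ) ≤ K ^ (e + 1) * (Bs A β m).card,
          (A.card : ℝ) := by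
          apply sum_le_sum
          intro m hm
          have h4 := (mem_filter.mp hm).2
          push Not at h4
          refine le_trans ?_ h4.le
          gcongr
          exact_mod_cast hfib m
      _ ≤ ((slopes S2).card : ℝ) * A.card := by
          rw [sum_const, nsmul_eq_mul]
          gcongr
          exact filter_subset _ _
      _ ≤ _ := by gcongr
  set x := ∑ w ∈ D0, ((S2.filter fun s => s.m = w).card : ℝ) with hx
  set y := (∑ w ∈ (slopes S2).filter fun m => ¬ (A.card : ℝ) ≤ K ^ (e + 1) * (Bs A β m).card,
      ((S2.filter fun s => s.m = w).card : ℝ)) with hy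
  have h4 : K * y ≤ A.card := by
    have : K ^ e * (K * y) ≤ K ^ e * A.card := le_trans (le_of_eq (by ring)) h3
    exact le_of_mul_le_mul_left this (by positivity)
  have hy0 : 0 ≤ y := sum_nonneg fun _ _ => Nat.cast_nonneg _
  clear_value x y
  have hyN : y ≤ A.card := by nlinarith
  have hKb2 : 64 ≤ K * β ^ 2 := by
    have : β ^ 4 ≤ β ^ 2 := pow_le_pow_of_le_one hβ.le (by linarith) (by norm_num)
    nlinarith
  -- `x ≥ β² K N / 8`
  have h5 : β ^ 2 / 8 * (K * A.card) ≤ x := by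
    have : (A.card:ℝ) ≤ β ^ 2 / 8 * (K * A.card) := by nlinarith
    linarith
  have h6 : A.card * (K * β ^ 3) ≤ A.card * (8 * D0.card) := by
    calc A.card * (K * β ^ 3) = 8 * ((β ^ 2 / 8 * (K * A.card)) * β) := by ring
      _ ≤ 8 * (x * β) := by gcongr
      _ ≤ 8 * (D0.card * A.card) := by gcongr
      _ = _ := by ring
  exact le_of_mul_le_mul_left h6 hNp

end RL
end

section
open Finset
open scoped Pointwise

set_option linter.unusedSectionVars false

namespace RL

/-- descent with exponent `c` -/
def Desc (c : ℕ) : Prop := ∀ (p : ℕ) [Fact p.Prime] (A : Finset (ZMod p)), A.Nonempty →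
    ∀ (L β : ℝ), 64 ≤ L → 0 < β → β ≤ 1 / 2 → 1 ≤ L * β →
    ∀ D1 : Finset (ZMod p)ˣ, D1.Nonempty → (∀ m ∈ D1, (Bs A β m).Nonempty) →
    (∀ m ∈ D1, ((Bs A (β ^ 10) m).card : ℝ) ≤ L * (Bs A β m).card) →
    (D1.card : ℝ) ≤ L ^ c ∨ (∃ m ∈ D1, ((Bs A β m).card : ℝ) ≤ L ^ c) ∨ (p : ℝ) ≤ L ^ c * A.card

variable {p : ℕ} [Fact p.Prime]

lemma pow_ten_pow_le {β : ℝ} (hβ : 0 < β) (hβ2 : β ≤ 1 / 2) (i : ℕ) : β ^ (10 ^ i) ≤ β := by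
  calc β ^ (10 ^ i) ≤ β ^ 1 :=
        pow_le_pow_of_le_one hβ.le (by linarith) (Nat.one_le_pow _ _ (by norm_num))
    _ = β := pow_one β

lemma regimeA (E c Q J : ℕ) (hE : AffE E) (hc : Desc c) (hQ : c + 3 ≤ Q)
    (hJ : Q * (20 * E + 2) + 2 ≤ J)
    (A : Finset (ZMod p)) (hA : A.Nonempty) (L β : ℝ) (hL : 64 ≤ L) (hβ : 0 < β)
    (hβ2 : β ≤ 1 / 2) (hLβ : ∀ i ≤ J, 1 ≤ L * β ^ (10 ^ i)) (hJL : (J : ℝ) ≤ L)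
    (hK : L ^ Q * A.card = (S A β).card) (hp : A.card * L ^ Q ≤ p * L ^ 2)
    (h2N : 2 ≤ β * A.card)
    (hN : (L ^ Q) ^ (40 * E + 3) ≤ A.card)
    (hR : ((S A (β ^ 10)).card : ℝ) ≤ (L ^ Q) ^ 10 * A.card) : False := by
  classical
  have hL0 : (0:ℝ) < L := by linarith
  have hL1 : (1:ℝ) < L := by linarith
  have hNp : (0:ℝ) < A.card := by exact_mod_cast hA.card_pos
  have hLβ4 : 64 ≤ L * β ^ 4 := by
    have h1 := hLβ 1 (by omega)
    have h2 := pow_ten_le hβ hβ2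
    rw [pow_one] at h1
    have : L * β ^ 10 ≤ L * (β ^ 4 / 64) := by gcongr
    linarith
  set K := L ^ Q with hKdef
  have hKL : L ≤ K := by
    calc L = L ^ 1 := (pow_one L).symm
      _ ≤ _ := pow_le_pow_right₀ hL1.le (by omega)
  have hK1 : 1 ≤ K := by linarith
  have hK0 : 0 < K := by linarith
  have hKβ : 64 ≤ K * β ^ 4 := by
    refine hLβ4.trans ?_
    gcongr
  obtain ⟨S2, hS2, hne, hlow, h1, h2⟩ := double_gowers A hA K β hβ hβ2 hKβ hK hR
  have hsl := few_slopes E hE A hA K β hβ hβ2 hKβ h2N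
    ((pow_le_pow_right₀ hK1 (by omega)).trans hN) hK S2 hS2 hne hlow h1 h2
  obtain ⟨D0, hD0, hrich⟩ := rich_slopes (20 * E + 1) A hA K β hβ hβ2 hKβ S2 hS2 hlow hsl
  have hD0c : K ≤ L * D0.card := by
    have h3 : 64 ≤ L * β ^ 3 := by
      have : β ^ 4 ≤ β ^ 3 := pow_le_pow_of_le_one hβ.le (by linarith) (by norm_num)
      nlinarith
    have : 64 * K ≤ 8 * (L * D0.card) := by
      calc 64 * K ≤ L * β ^ 3 * K := by gcongr
        _ = L * (K * β ^ 3) := by ring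
        _ ≤ L * (8 * D0.card) := by gcongr
        _ = _ := by ring
    linarith
  have hreg : ∀ m : (ZMod p)ˣ, ∃ i : ℕ, m ∈ D0 → i < J ∧
      ((Bs A (β ^ (10 ^ (i + 1))) m).card : ℝ) ≤ L * (Bs A (β ^ (10 ^ i)) m).card := by
    intro m
    by_cases hm : m ∈ D0
    · suffices ∃ i < J, ((Bs A (β ^ (10 ^ (i + 1))) m).card : ℝ) ≤
          L * (Bs A (β ^ (10 ^ i)) m).card by
        obtain ⟨i, h⟩ := this
        exact ⟨i, fun _ => h⟩
      by_contra hcon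
      push Not at hcon
      have h3 := chain (fun i => ((Bs A (β ^ (10 ^ i)) m).card : ℝ)) L hL0.le J
        (fun i hi => (hcon i hi).le)
      simp only [pow_zero, pow_one] at h3
      have h4 := Bs_card_le A hA (β ^ (10 ^ J)) m
      have h5 := le_of_beta (x := ((Bs A (β ^ (10 ^ J)) m).card : ℝ)) 1 hL0 (by positivity)
        (hLβ J le_rfl) (by positivity) (by simpa using h4)
      have h6 : A.card * L ^ J ≤ A.card * L ^ (Q * (20 * E + 2) + 1) := by
        calc A.card * L ^ J ≤ K ^ (20 * E + 1 + 1) * (Bs A β m).card * L ^ J := by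
              gcongr
              exact hrich m hm
          _ = K ^ (20 * E + 2) * (L ^ J * (Bs A β m).card) := by ring
          _ ≤ K ^ (20 * E + 2) * (A.card * L ^ 1) :=
            mul_le_mul_of_nonneg_left (h3.trans h5) (by positivity)
          _ = _ := by rw [hKdef, ← pow_mul]; ring
      have h7 := le_of_mul_le_mul_left h6 hNp
      have h8 : L ^ (Q * (20 * E + 2) + 1) < L ^ J := pow_lt_pow_right₀ hL1 (by omega)
      linarith
    · exact ⟨0, fun h => absurd h hm⟩
  choose idx hidx using hreg
  have hD0n : D0.Nonempty := by
    rw [nonempty_iff_ne_empty]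
    rintro rfl
    simp at hD0c
    linarith
  obtain ⟨i, hi, hfib⟩ := exists_large_fiber (range J) D0 idx
    (fun m hm => mem_range.mpr (hidx m hm).1) hD0n
  set D1 := D0.filter fun m => idx m = i with hD1
  rw [card_range] at hfib
  have hD1c : K ≤ L ^ 2 * D1.card := by
    calc K ≤ L * D0.card := hD0c
      _ ≤ L * (J * D1.card) := by gcongr
      _ ≤ L * (L * D1.card) := by gcongr
      _ = _ := by ring
  have hD1n : D1.Nonempty := by
    rw [nonempty_iff_ne_empty]
    intro h
    rw [h] at hD1c
    simp at hD1c
    linarith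
  have hiJ := mem_range.mp hi
  have hbi := pow_ten_pow_le hβ hβ2 i
  have hmass : ∀ m ∈ D1, K ≤ (Bs A (β ^ (10 ^ i)) m).card := by
    intro m hm
    have h3 := hrich m (mem_filter.mp hm).1
    have h4 : ((Bs A β m).card : ℝ) ≤ (Bs A (β ^ (10 ^ i)) m).card := by
      exact_mod_cast card_le_card (Bs_mono hbi)
    have h5 : K ^ (20 * E + 2) * K ≤ K ^ (20 * E + 2) * (Bs A β m).card := by
      calc K ^ (20 * E + 2) * K = K ^ (20 * E + 3) := by ring
        _ ≤ K ^ (40 * E + 3) := pow_le_pow_right₀ hK1 (by omega)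
        _ ≤ _ := hN.trans h3
    exact (le_of_mul_le_mul_left h5 (by positivity)).trans h4
  have hcQ : L ^ (c + 2) < K := pow_lt_pow_right₀ hL1 (by omega)
  have hcQ2 : L ^ c < K := pow_lt_pow_right₀ hL1 (by omega)
  rcases hc p A hA L (β ^ (10 ^ i)) hL (by positivity) (hbi.trans hβ2) (hLβ i hiJ.le) D1 hD1n
    (by
      intro m hm
      have := hmass m hm
      rw [← card_pos]
      have h0 : (0:ℝ) < (Bs A (β ^ (10 ^ i)) m).card := by linarith
      exact_mod_cast h0)
    (by
      intro m hm
      have h3 := (hidx m (mem_filter.mp hm).1).2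
      rw [(mem_filter.mp hm).2] at h3
      rw [← pow_mul, ← pow_succ]
      exact h3) with h | ⟨m, hm, h⟩ | h
  · have : L ^ 2 * (D1.card : ℝ) ≤ L ^ 2 * L ^ c := by gcongr
    have e : L ^ 2 * L ^ c = L ^ (c + 2) := by ring
    linarith
  · have := hmass m hm
    linarith
  · have h3 : A.card * K ≤ A.card * L ^ (c + 2) := by
      calc A.card * K ≤ _ := hp
        _ ≤ L ^ c * A.card * L ^ 2 := by gcongr
        _ = _ := by ring
    have := le_of_mul_le_mul_left h3 hNp
    linarith

lemma le_two_pow_ten_pow (J : ℕ) : (J : ℝ) ≤ 2 ^ (10 ^ J) := by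
  have h1 : J < 10 ^ J := Nat.lt_pow_self (by norm_num)
  have h2 : 10 ^ J < 2 ^ (10 ^ J) := Nat.lt_pow_self (by norm_num)
  exact_mod_cast (h1.trans h2).le

lemma core : ∃ C1 : ℕ, 15 ≤ C1 ∧ ∀ (p : ℕ) [Fact p.Prime] (A : Finset (ZMod p)), A.Nonempty →
    ∀ β : ℝ, 0 < β → β ≤ 1 / 2 → 2 ≤ β * A.card → 2 * A.card ≤ β * p →
    (A.card : ℝ) < (S A β).card * β ^ C1 →
    ((S A β).card / A.card : ℝ) ^ 10 * A.card < (S A (β ^ 10)).card := by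
  obtain ⟨E, hE⟩ := affE_ex
  obtain ⟨c, hc0⟩ := descent
  have hc : Desc c := hc0
  obtain ⟨Q, hQ1, hQ2, hQ3⟩ : ∃ Q : ℕ, 7 * E + 10 ≤ Q ∧ c + 3 ≤ Q ∧ 15 ≤ Q :=
    ⟨7 * E + c + 15, by omega, by omega, by omega⟩
  obtain ⟨J, hJ1, hJ2⟩ : ∃ J : ℕ, Q * (40 * E + 3) + 3 ≤ J ∧ Q * (20 * E + 2) + 2 ≤ J :=
    ⟨Q * (40 * E + 3) + 3 + (Q * (20 * E + 2) + 2), by omega, by omega⟩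
  refine ⟨Q * 10 ^ J, ?_, ?_⟩
  · have : 1 ≤ 10 ^ J := Nat.one_le_pow _ _ (by norm_num)
    nlinarith
  intro p _ A hA β hβ hβ2 h2N h2p hlarge
  have hNp : (0:ℝ) < A.card := by exact_mod_cast hA.card_pos
  by_contra hcon
  push Not at hcon
  set K : ℝ := (S A β).card / A.card with hKdef
  have hK : K * A.card = (S A β).card := by rw [hKdef]; field_simp
  have hKβ : 1 < K * β ^ (Q * 10 ^ J) := by
    rw [← hK] at hlarge
    have : A.card * 1 < A.card * (K * β ^ (Q * 10 ^ J)) := by linarith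
    exact lt_of_mul_lt_mul_left this hNp.le
  have hK0 : 0 < K := by
    by_contra hc
    have : 0 < β ^ (Q * 10 ^ J) := by positivity
    nlinarith
  set L : ℝ := K ^ ((1:ℝ) / Q) with hLdef
  have hL0 : 0 < L := Real.rpow_pos_of_pos hK0 _
  have hLQ : L ^ Q = K := by
    rw [hLdef, ← Real.rpow_natCast, ← Real.rpow_mul hK0.le]
    have : (Q:ℝ) ≠ 0 := by
      have : 0 < Q := by omega
      positivity
    rw [one_div, inv_mul_cancel₀ this, Real.rpow_one]
  have hLT : 1 ≤ L * β ^ (10 ^ J) := by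
    by_contra hc
    push Not at hc
    have h1 : (L * β ^ (10 ^ J)) ^ Q ≤ 1 := pow_le_one₀ (by positivity) hc.le
    rw [mul_pow, hLQ, ← pow_mul, mul_comm (10 ^ J) Q] at h1
    linarith
  have hLβ : ∀ i ≤ J, 1 ≤ L * β ^ (10 ^ i) := by
    intro i hi
    exact hLT.trans (mul_le_mul_of_nonneg_left (pow_le_pow_of_le_one hβ.le (by linarith)
      (Nat.pow_le_pow_right (by norm_num) hi)) hL0.le)
  have hL2 : (2:ℝ) ^ (10 ^ J) ≤ L := by
    have h1 : β ^ (10 ^ J) ≤ (1 / 2) ^ (10 ^ J) := by gcongr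
    have h2 : (1:ℝ) ≤ L * (1 / 2) ^ (10 ^ J) := hLT.trans (by gcongr)
    rw [one_div, inv_pow, ← div_eq_mul_inv, le_div_iff₀ (by positivity)] at h2
    linarith
  have hJL : (J:ℝ) ≤ L := (le_two_pow_ten_pow J).trans hL2
  have hL : 64 ≤ L := by
    refine le_trans ?_ hL2
    calc (64:ℝ) = 2 ^ 6 := by norm_num
      _ ≤ 2 ^ (10 ^ J) := by
        apply pow_le_pow_right₀ (by norm_num)
        calc 6 ≤ 10 ^ 1 := by norm_num
          _ ≤ 10 ^ J := Nat.pow_le_pow_right (by norm_num) (by omega)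
  have hLβ4 : 64 ≤ L * β ^ 4 := by
    have h1 := hLβ 1 (by omega)
    have h2 := pow_ten_le hβ hβ2
    rw [pow_one] at h1
    have : L * β ^ 10 ≤ L * (β ^ 4 / 64) := by gcongr
    linarith
  have hLβ2 : 64 ≤ L * β ^ 2 := by
    refine hLβ4.trans ?_
    gcongr ?_ * ?_
    exact pow_le_pow_of_le_one hβ.le (by linarith) (by norm_num)
  have hp : A.card * L ^ Q ≤ p * L ^ 2 := by
    have h1 := S_vinh A β hA h2p
    rw [← hK] at h1
    rw [hLQ]
    have h2 := le_of_beta (x := K * A.card) 2 hL0 hβ (by simpa using hLβ 0 (by omega))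
      (by positivity) h1
    have h3 : 64 * (A.card * K) ≤ 64 * (p * L ^ 2) := by
      calc 64 * (A.card * K) ≤ L * β ^ 2 * (A.card * K) := by gcongr
        _ = L * (K * A.card * β ^ 2) := by ring
        _ ≤ L * (4 * p) := by gcongr
        _ ≤ L * (L * p) := by gcongr; linarith
        _ = 1 * (p * L ^ 2) := by ring
        _ ≤ _ := by gcongr; norm_num
    linarith
  have hN : L ^ Q ≤ A.card * L ^ 2 := by
    have h1 := S_trivial A β h2N
    rw [← hK] at h1
    rw [hLQ]
    have h3 : A.card * K ≤ A.card * (A.card * L ^ 2) := by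
      calc A.card * K = 1 * (A.card * K) := by ring
        _ ≤ L * β ^ 2 * (A.card * K) := by gcongr; linarith
        _ = L * (K * A.card * β ^ 2) := by ring
        _ ≤ L * (2 * (A.card : ℝ) ^ 2) := by gcongr
        _ ≤ L * (L * (A.card : ℝ) ^ 2) := by gcongr; linarith
        _ = _ := by ring
    exact le_of_mul_le_mul_left h3 hNp
  rw [← hLQ] at hK hcon
  rcases lt_or_ge (A.card : ℝ) ((L ^ Q) ^ (40 * E + 3)) with h | h
  · exact regimeB E Q J (40 * E + 3) hE hQ1 hJ1 A hA L β hL hβ hβ2 hLβ hK hp hN h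
  · exact regimeA E c Q J hE hc hQ2 hJ2 A hA L β hL hβ hβ2 hLβ hJL hK hp h2N h hcon

/-- the bound on the number of rich transformations -/
theorem rich_bound : ∃ C1 : ℕ, ∀ (p : ℕ) [Fact p.Prime] (A : Finset (ZMod p)), A.Nonempty →
    ∀ β : ℝ, 0 < β → β ≤ 1 / 2 → 2 ≤ β * A.card → 2 * A.card ≤ β * p →
    (S A β).card * β ^ C1 ≤ (A.card : ℝ) := by
  obtain ⟨C1, hC1, hcore⟩ := core
  refine ⟨C1, ?_⟩
  intro p _ A hA β hβ hβ2 h2N h2p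
  by_contra hcon
  push Not at hcon
  have hNp : (0:ℝ) < A.card := by exact_mod_cast hA.card_pos
  have inv : ∀ j : ℕ, 2 ≤ β ^ (10 ^ j) * A.card ∧ 2 * A.card ≤ β ^ (10 ^ j) * p ∧
      (A.card : ℝ) < (S A (β ^ (10 ^ j))).card * (β ^ (10 ^ j)) ^ C1 := by
    intro j
    induction j with
    | zero => simpa using ⟨h2N, h2p, hcon⟩
    | succ j ih =>
      obtain ⟨i1, i2, i3⟩ := ih
      have hb2 := (pow_ten_pow_le hβ hβ2 j).trans hβ2
      have hb : 0 < β ^ (10 ^ j) := by positivity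
      have e10 : β ^ (10 ^ (j + 1)) = (β ^ (10 ^ j)) ^ 10 := by rw [← pow_mul, pow_succ]
      rw [e10]
      generalize β ^ (10 ^ j) = b at *
      have h1 := hcore p A hA b hb hb2 i1 i2 i3
      have h2 := S_trivial A b i1
      have h3 := S_vinh A b hA i2
      set K : ℝ := (S A b).card / A.card with hKdef
      have hK : K * A.card = (S A b).card := by rw [hKdef]; field_simp
      rw [← hK] at i3 h2 h3
      have hKb : 1 < K * b ^ C1 := by
        have : A.card * 1 < A.card * (K * b ^ C1) := by linarith
        exact lt_of_mul_lt_mul_left this hNp.le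
      have hK0 : 0 < K := by
        by_contra hc
        have : 0 < b ^ C1 := by positivity
        nlinarith
      have hKb15 : 1 < K * b ^ 15 := by
        refine hKb.trans_le ?_
        gcongr ?_ * ?_
        exact pow_le_pow_of_le_one hb.le (by linarith) hC1
      have hKb12 : 8 ≤ K * b ^ 12 := by
        have : b ^ 3 ≤ (1/2) ^ 3 := by gcongr
        have h4 : K * b ^ 15 ≤ K * b ^ 12 * (1/2)^3 := by
          calc K * b ^ 15 = K * b ^ 12 * b ^ 3 := by ring
            _ ≤ _ := by gcongr
        linarith
      have hKN : K * b ^ 2 ≤ 2 * A.card := by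
        have : A.card * (K * b ^ 2) ≤ A.card * (2 * A.card) := by nlinarith
        exact le_of_mul_le_mul_left this hNp
      have hb10 : 0 < b ^ 10 := by positivity
      refine ⟨?_, ?_, ?_⟩
      · have : 8 ≤ b ^ 10 * (2 * A.card) := by
          calc 8 ≤ K * b ^ 12 := hKb12
            _ = b ^ 10 * (K * b ^ 2) := by ring
            _ ≤ _ := by gcongr
        linarith
      · have : 8 * A.card ≤ b ^ 10 * (4 * p) := by
          calc 8 * (A.card:ℝ) ≤ K * b ^ 12 * A.card := by gcongr
            _ = b ^ 10 * (K * A.card * b ^ 2) := by ring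
            _ ≤ _ := by gcongr
        linarith
      · have h4 : (1:ℝ) < (K * b ^ C1) ^ 10 := one_lt_pow₀ hKb (by norm_num)
        calc (A.card : ℝ) = 1 * A.card := by ring
          _ < (K * b ^ C1) ^ 10 * A.card := by gcongr
          _ = (K ^ 10 * A.card) * (b ^ 10) ^ C1 := by
            rw [mul_pow, ← pow_mul, ← pow_mul, mul_comm C1 10]; ring
          _ ≤ _ := by gcongr
  -- contradiction with the trivial bound
  set T : ℕ := Fintype.card (Aff p) with hT
  obtain ⟨_, _, h3⟩ := inv T
  have h4 : ((S A (β ^ (10 ^ T))).card : ℝ) ≤ T := by exact_mod_cast card_le_univ _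
  have h5 : (β ^ (10 ^ T)) ^ C1 ≤ (1 / 2) ^ (10 ^ T) := by
    calc (β ^ (10 ^ T)) ^ C1 ≤ (β ^ (10 ^ T)) ^ 1 :=
          pow_le_pow_of_le_one (by positivity) (pow_le_one₀ hβ.le (by linarith)) (by omega)
      _ = β ^ (10 ^ T) := pow_one _
      _ ≤ _ := by gcongr
  have h6 : (T : ℝ) * (1 / 2) ^ (10 ^ T) ≤ 1 := by
    rw [one_div, inv_pow, ← div_eq_mul_inv, div_le_one (by positivity)]
    exact le_two_pow_ten_pow T
  have h7 : (1:ℝ) ≤ A.card := by exact_mod_cast hA.card_pos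
  have h8 : ((S A (β ^ (10 ^ T))).card : ℝ) * (β ^ (10 ^ T)) ^ C1 ≤ T * (1 / 2) ^ (10 ^ T) := by
    gcongr
  linarith

end RL
end

section
open Finset
open scoped Pointwise
set_option linter.unusedSectionVars false
namespace RL

lemma en_bound {X Y Z : Type*} [DecidableEq X] [DecidableEq Y] [DecidableEq Z]
    (D : Finset X) (U : Finset Y) (W : Finset Z) (φ : X → Y → Z)
    (E : Finset (Y × Y × Y × Y))
    (hR : ∀ m ∈ D, ∀ m2 ∈ D, ∀ u ∈ U, ∀ u' ∈ U, ∀ v ∈ U, ∀ v' ∈ U,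
      φ m u = φ m2 v → φ m u' = φ m2 v' → (u, u', v, v') ∈ E)
    (hinj : ∀ m ∈ D, ∀ m' ∈ D, ∀ v ∈ U, φ m v = φ m' v → m = m')
    (N x : ℝ) (hD : (D.card : ℝ) ≤ N) (hW : (W.card : ℝ) ≤ N) (hx : 0 ≤ x)
    (hP : x ≤ (((D ×ˢ U).filter fun q => φ q.1 q.2 ∈ W).card : ℝ)) :
    x ^ 4 ≤ N ^ 5 * E.card := by
  classical
  set P := (D ×ˢ U).filter fun q => φ q.1 q.2 ∈ W with hPd
  set Q := (P ×ˢ P).filter fun q => q.1.1 = q.2.1 with hQ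
  have h1 : (P.card : ℝ) ^ 2 ≤ D.card * (Q.card : ℝ) := by
    apply cs_fiber
    intro e he
    simp only [hPd, mem_filter, mem_product] at he
    exact he.1.1
  have h2 := cs_fiber Q (W ×ˢ W) (fun q => (φ q.1.1 q.1.2, φ q.2.1 q.2.2)) (by
    rintro ⟨⟨m, u⟩, ⟨m2, u2⟩⟩ hq
    simp only [hQ, hPd, mem_filter, mem_product] at hq ⊢
    exact ⟨hq.1.1.2, hq.1.2.2⟩)
  have h3 : ((Q ×ˢ Q).filter fun q => (fun q : (X × Y) × (X × Y) =>
      (φ q.1.1 q.1.2, φ q.2.1 q.2.2)) q.1 = (fun q : (X × Y) × (X × Y) =>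
      (φ q.1.1 q.1.2, φ q.2.1 q.2.2)) q.2).card ≤ (D ×ˢ E).card := by
    apply Finset.card_le_card_of_injOn
      (fun q => (q.1.1.1, (q.1.1.2, q.1.2.2, q.2.1.2, q.2.2.2)))
    · rintro ⟨⟨⟨m, u⟩, ⟨m1, u'⟩⟩, ⟨⟨m2, v⟩, ⟨m3, v'⟩⟩⟩ hq
      simp only [hQ, hPd, mem_filter, mem_product, Prod.mk.injEq, mem_coe] at hq ⊢
      obtain ⟨⟨⟨⟨⟨⟨hm, hu⟩, _⟩, ⟨⟨_, hu'⟩, _⟩⟩, e1⟩, ⟨⟨⟨hm2, hv⟩, _⟩, ⟨⟨_, hv'⟩, _⟩⟩, e2⟩,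
        h4, h5⟩ := hq
      subst e1 e2
      exact ⟨hm, hR _ hm _ hm2 _ hu _ hu' _ hv _ hv' h4 h5⟩
    · rintro ⟨⟨⟨m, u⟩, ⟨m1, u'⟩⟩, ⟨⟨m2, v⟩, ⟨m3, v'⟩⟩⟩ hq
        ⟨⟨⟨n, s⟩, ⟨n1, s'⟩⟩, ⟨⟨n2, t⟩, ⟨n3, t'⟩⟩⟩ hq' he
      simp only [hQ, hPd, mem_filter, mem_product, Prod.mk.injEq, mem_coe] at hq hq' he
      obtain ⟨⟨⟨⟨⟨⟨hm, hu⟩, _⟩, ⟨⟨_, hu'⟩, _⟩⟩, e1⟩, ⟨⟨⟨hm2, hv⟩, _⟩, ⟨⟨_, hv'⟩, _⟩⟩, e2⟩,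
        h4, h5⟩ := hq
      obtain ⟨⟨⟨⟨⟨⟨hn, hs⟩, _⟩, ⟨⟨_, hs'⟩, _⟩⟩, e3⟩, ⟨⟨⟨hn2, ht⟩, _⟩, ⟨⟨_, ht'⟩, _⟩⟩, e4⟩,
        h6, h7⟩ := hq'
      obtain ⟨r1, r2, r3, r4, r5⟩ := he
      subst e1 e2 e3 e4 r1 r2 r3 r4 r5
      have := hinj _ hm2 _ hn2 _ hv (h4.symm.trans h6)
      subst this
      rfl
  have h3' : (((Q ×ˢ Q).filter fun q => (fun q : (X × Y) × (X × Y) =>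
      (φ q.1.1 q.1.2, φ q.2.1 q.2.2)) q.1 = (fun q : (X × Y) × (X × Y) =>
      (φ q.1.1 q.1.2, φ q.2.1 q.2.2)) q.2).card : ℝ) ≤ D.card * E.card := by
    rw [card_product] at h3
    exact_mod_cast h3
  rw [card_product, Nat.cast_mul] at h2
  have h4 : (Q.card : ℝ) ^ 2 ≤ (W.card * W.card) * (D.card * E.card) :=
    h2.trans (mul_le_mul_of_nonneg_left h3' (by positivity))
  have hN : 0 ≤ N := (Nat.cast_nonneg _).trans hD
  calc x ^ 4 ≤ (P.card : ℝ) ^ 4 := by gcongr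
    _ = ((P.card : ℝ) ^ 2) ^ 2 := by ring
    _ ≤ (D.card * (Q.card : ℝ)) ^ 2 := by gcongr
    _ = (D.card : ℝ) ^ 2 * (Q.card : ℝ) ^ 2 := by ring
    _ ≤ (D.card : ℝ) ^ 2 * ((W.card * W.card) * (D.card * E.card)) :=
      mul_le_mul_of_nonneg_left h4 (by positivity)
    _ ≤ N ^ 2 * ((N * N) * (N * E.card)) := by gcongr
    _ = _ := by ring

lemma card_P_ge {X Y Z : Type*} [DecidableEq X] [DecidableEq Y] [DecidableEq Z]
    (D : Finset X) (U : Finset Y) (W : Finset Z) (φ : X → Y → Z) (θ : ℝ)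
    (h : ∀ m ∈ D, θ ≤ ((U.filter fun u => φ m u ∈ W).card : ℝ)) :
    D.card * θ ≤ (((D ×ˢ U).filter fun q => φ q.1 q.2 ∈ W).card : ℝ) := by
  classical
  have h1 : ((D ×ˢ U).filter fun q => φ q.1 q.2 ∈ W).card =
      ∑ m ∈ D, (U.filter fun u => φ m u ∈ W).card := by
    rw [Finset.card_filter, Finset.sum_product]
    simp only [Finset.card_filter]
  rw [h1, Nat.cast_sum, ← nsmul_eq_mul]
  exact Finset.card_nsmul_le_sum _ _ _ h

lemma en_both {X Y Z : Type*} [DecidableEq X] [DecidableEq Y] [DecidableEq Z]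
    (D : Finset X) (U : Finset Y) (W : Finset Z) (φ : X → Y → Z)
    (E : Finset (Y × Y × Y × Y)) (F : Finset (X × X × X × X))
    (hR : ∀ m ∈ D, ∀ m2 ∈ D, ∀ u ∈ U, ∀ u' ∈ U, ∀ v ∈ U, ∀ v' ∈ U,
      φ m u = φ m2 v → φ m u' = φ m2 v' → (u, u', v, v') ∈ E)
    (hR2 : ∀ m ∈ U, ∀ m2 ∈ U, ∀ u ∈ D, ∀ u' ∈ D, ∀ v ∈ D, ∀ v' ∈ D,
      φ u m = φ v m2 → φ u' m = φ v' m2 → (u, u', v, v') ∈ F)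
    (hinj : ∀ m ∈ D, ∀ m' ∈ D, ∀ v ∈ U, φ m v = φ m' v → m = m')
    (hinj2 : ∀ m ∈ U, ∀ m' ∈ U, ∀ v ∈ D, φ v m = φ v m' → m = m')
    (N M θ : ℝ) (hD : (D.card : ℝ) ≤ N) (hU : (U.card : ℝ) ≤ N) (hW : (W.card : ℝ) ≤ N)
    (hM : 0 ≤ M) (hMD : M ≤ D.card) (hθ : 0 ≤ θ)
    (h : ∀ m ∈ D, θ ≤ ((U.filter fun u => φ m u ∈ W).card : ℝ)) :
    (M * θ) ^ 4 ≤ N ^ 5 * E.card ∧ (M * θ) ^ 4 ≤ N ^ 5 * F.card := by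
  have h1 := card_P_ge D U W φ θ h
  have h2 : M * θ ≤ (((D ×ˢ U).filter fun q => φ q.1 q.2 ∈ W).card : ℝ) :=
    (mul_le_mul_of_nonneg_right hMD hθ).trans h1
  refine ⟨en_bound D U W φ E hR hinj N _ hD hW (by positivity) h2, ?_⟩
  refine en_bound U D W (fun u m => φ m u) F hR2 hinj2 N _ hU hW (by positivity) (h2.trans ?_)
  have : ((D ×ˢ U).filter fun q => φ q.1 q.2 ∈ W).card ≤
      ((U ×ˢ D).filter fun q => φ q.2 q.1 ∈ W).card := by
    apply Finset.card_le_card_of_injOn Prod.swap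
    · rintro ⟨a, b⟩ hq
      simp only [mem_filter, mem_product, mem_coe, Prod.swap] at hq ⊢
      tauto
    · exact Prod.swap_injective.injOn
  exact_mod_cast this

end RL
end

section
open Finset
open scoped Pointwise
set_option linter.unusedSectionVars false
namespace RL
variable {p : ℕ} [Fact p.Prime]

lemma addE_ge (B : Finset (ZMod p)) (F : Finset (ZMod p × ZMod p × ZMod p × ZMod p))
    (hF : ∀ x ∈ F, x.1 ∈ B ∧ x.2.1 ∈ B ∧ x.2.2.1 ∈ B ∧ x.2.2.2 ∈ B ∧
      x.1 - x.2.2.1 = x.2.1 - x.2.2.2) : F.card ≤ addE p B B := by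
  rw [addE, ← Set.ncard_coe_finset F]
  exact Set.ncard_le_ncard (fun x hx => hF x (by simpa using hx)) (Set.toFinite _)

lemma mulE_ge (B : Finset (ZMod p)) (F : Finset (ZMod p × ZMod p × ZMod p × ZMod p))
    (hF : ∀ x ∈ F, x.1 ∈ B ∧ x.2.1 ∈ B ∧ x.2.2.1 ∈ B ∧ x.2.2.2 ∈ B ∧
      x.1 * x.2.2.2 = x.2.1 * x.2.2.1) : F.card ≤ mulE p B B := by
  rw [mulE, ← Set.ncard_coe_finset F]
  exact Set.ncard_le_ncard (fun x hx => hF x (by simpa using hx)) (Set.toFinite _)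

lemma par_energy (A B : Finset (ZMod p)) (α M : ℝ) (hα : 0 < α) (hM : 0 ≤ M)
    (L : Finset (Aff p)) (hL : L ⊆ S A α) (m0 : (ZMod p)ˣ) (hm : ∀ g ∈ L, g.m = m0)
    (hB : ∀ g ∈ L, g.b ∈ B) (hML : M ≤ L.card) (hLA : L.card ≤ A.card) :
    (M * (α * A.card)) ^ 4 ≤ (A.card : ℝ) ^ 5 * addE p A A ∧
    (M * (α * A.card)) ^ 4 ≤ (A.card : ℝ) ^ 5 * addE p B B := by
  classical
  have hc : (L.image Aff.b).card = L.card := by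
    apply Finset.card_image_of_injOn
    intro g hg h hh e
    exact Aff.ext (by rw [hm g hg, hm h hh]) e
  have key := en_both (L.image Aff.b) A A (fun b u => (m0 : ZMod p) * u + b)
    (univ.filter fun x => x.1 ∈ A ∧ x.2.1 ∈ A ∧ x.2.2.1 ∈ A ∧ x.2.2.2 ∈ A ∧
      x.1 - x.2.2.1 = x.2.1 - x.2.2.2)
    (univ.filter fun x => x.1 ∈ B ∧ x.2.1 ∈ B ∧ x.2.2.1 ∈ B ∧ x.2.2.2 ∈ B ∧
      x.1 - x.2.2.1 = x.2.1 - x.2.2.2)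
    (by
      intro m _ m2 _ u hu u' hu' v hv v' hv' e1 e2
      simp only [mem_filter, mem_univ, true_and]
      refine ⟨hu, hu', hv, hv', ?_⟩
      apply m0.isUnit.mul_left_cancel
      linear_combination e1 - e2)
    (by
      have hb : ∀ u ∈ L.image Aff.b, u ∈ B := by
        intro u hu
        obtain ⟨g, hg, rfl⟩ := mem_image.mp hu
        exact hB g hg
      intro m _ m2 _ u hu u' hu' v hv v' hv' e1 e2
      simp only [mem_filter, mem_univ, true_and]
      refine ⟨hb _ hu, hb _ hu', hb _ hv, hb _ hv', ?_⟩
      linear_combination e1 - e2)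
    (by
      intro m _ m' _ v _ e
      exact add_left_cancel e)
    (by
      intro m _ m' _ v _ e
      exact m0.isUnit.mul_left_cancel (add_right_cancel e))
    A.card M (α * A.card) (by rw [hc]; exact_mod_cast hLA) le_rfl le_rfl hM (by rwa [hc])
    (by positivity)
    (by
      intro b hb
      obtain ⟨g, hg, rfl⟩ := mem_image.mp hb
      have := mem_S.mp (hL hg)
      refine this.trans ?_
      have h2 : good A g ⊆ A.filter fun u => (m0 : ZMod p) * u + g.b ∈ A := by
        intro a ha
        rw [mem_good, Aff.act, hm g hg] at ha
        rw [mem_filter]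
        exact ha
      exact_mod_cast card_le_card h2)
  constructor
  · refine key.1.trans (mul_le_mul_of_nonneg_left ?_ (by positivity))
    exact_mod_cast addE_ge A _ (by
      intro x hx
      simpa using hx)
  · refine key.2.trans (mul_le_mul_of_nonneg_left ?_ (by positivity))
    exact_mod_cast addE_ge B _ (by
      intro x hx
      simpa using hx)

lemma conc_energy (A B : Finset (ZMod p)) (α M : ℝ) (hα : 0 < α) (hM : 0 ≤ M)
    (h2 : 2 ≤ α * A.card)
    (L : Finset (Aff p)) (hL : L ⊆ S A α) (z w : ZMod p) (hm : ∀ g ∈ L, g.act z = w)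
    (hB : ∀ g ∈ L, (g.m : ZMod p) ∈ B) (hML : M ≤ L.card) (hLA : L.card ≤ A.card) :
    (M * (α * A.card / 2)) ^ 4 ≤ (A.card : ℝ) ^ 5 *
      mulE p (A.image fun a => a - z) (A.image fun a => a - z) ∧
    (M * (α * A.card / 2)) ^ 4 ≤ (A.card : ℝ) ^ 5 * mulE p B B := by
  classical
  have hc : (L.image fun g => (g.m : ZMod p)).card = L.card := by
    apply Finset.card_image_of_injOn
    intro g hg h hh e
    exact Aff.eq_of_m_act (x := z) (Units.ext e) (by rw [hm g hg, hm h hh])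
  set U := (A.image fun a => a - z) with hU
  have hD0 : ∀ u ∈ (L.image fun g => (g.m : ZMod p)), u ≠ 0 ∧ u ∈ B := by
    intro u hu
    obtain ⟨g, hg, rfl⟩ := mem_image.mp hu
    exact ⟨g.m.ne_zero, hB g hg⟩
  have hUc : U.card ≤ A.card := card_image_le
  have key := en_both (L.image fun g => (g.m : ZMod p)) (U.erase 0) (A.image fun a => a - w)
    (fun m u => m * u)
    (univ.filter fun x => x.1 ∈ U ∧ x.2.1 ∈ U ∧ x.2.2.1 ∈ U ∧ x.2.2.2 ∈ U ∧
      x.1 * x.2.2.2 = x.2.1 * x.2.2.1)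
    (univ.filter fun x => x.1 ∈ B ∧ x.2.1 ∈ B ∧ x.2.2.1 ∈ B ∧ x.2.2.2 ∈ B ∧
      x.1 * x.2.2.2 = x.2.1 * x.2.2.1)
    (by
      intro m hm m2 hm2 u hu u' hu' v hv v' hv' e1 e2
      simp only [mem_filter, mem_univ, true_and]
      refine ⟨mem_of_mem_erase hu, mem_of_mem_erase hu', mem_of_mem_erase hv,
        mem_of_mem_erase hv', ?_⟩
      apply mul_left_cancel₀ (hD0 m hm).1
      apply mul_left_cancel₀ (hD0 m2 hm2).1
      linear_combination m2 * v' * e1 - m2 * v * e2)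
    (by
      intro m hm m2 hm2 u hu u' hu' v hv v' hv' e1 e2
      simp only [mem_filter, mem_univ, true_and]
      refine ⟨(hD0 _ hu).2, (hD0 _ hu').2, (hD0 _ hv).2, (hD0 _ hv').2, ?_⟩
      apply mul_left_cancel₀ (ne_of_mem_erase hm)
      apply mul_left_cancel₀ (ne_of_mem_erase hm2)
      linear_combination m2 * v' * e1 - m2 * v * e2)
    (by
      intro m _ m' _ v hv e
      exact mul_right_cancel₀ (ne_of_mem_erase hv) e)
    (by
      intro m _ m' _ v hv e
      exact mul_left_cancel₀ (hD0 v hv).1 e)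
    A.card M (α * A.card / 2) (by rw [hc]; exact_mod_cast hLA)
    (by exact_mod_cast (card_erase_le.trans hUc)) (by exact_mod_cast card_image_le) hM
    (by rwa [hc])
    (by positivity)
    (by
      intro b hb
      obtain ⟨g, hg, rfl⟩ := mem_image.mp hb
      have h1 := mem_S.mp (hL hg)
      have h3 : (((good A g).erase z).image fun a => a - z) ⊆
          (U.erase 0).filter fun u => (g.m : ZMod p) * u ∈ A.image fun a => a - w := by
        intro x hx
        obtain ⟨a, ha, rfl⟩ := mem_image.mp hx
        rw [mem_erase, mem_good] at ha
        rw [mem_filter, mem_erase]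
        refine ⟨⟨sub_ne_zero.mpr ha.1, mem_image.mpr ⟨a, ha.2.1, rfl⟩⟩,
          mem_image.mpr ⟨_, ha.2.2, ?_⟩⟩
        have := hm g hg
        rw [Aff.act] at this ⊢
        linear_combination this
      have h4 := card_le_card h3
      rw [card_image_of_injective _ (sub_left_injective)] at h4
      have h5 := Finset.pred_card_le_card_erase (s := good A g) (a := z)
      have h6 : (good A g).card ≤ ((U.erase 0).filter fun u =>
        (g.m : ZMod p) * u ∈ A.image fun a => a - w).card + 1 := by omega
      have h7 : ((good A g).card : ℝ) ≤ (((U.erase 0).filter fun u =>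
        (g.m : ZMod p) * u ∈ A.image fun a => a - w).card : ℝ) + 1 := by exact_mod_cast h6
      linarith)
  constructor
  · refine key.1.trans (mul_le_mul_of_nonneg_left ?_ (by positivity))
    exact_mod_cast mulE_ge U _ (by
      intro x hx
      simpa using hx)
  · refine key.2.trans (mul_le_mul_of_nonneg_left ?_ (by positivity))
    exact_mod_cast mulE_ge B _ (by
      intro x hx
      simpa using hx)

end RL
end

section
open Finset
open scoped Pointwise
set_option linter.unusedSectionVars false
namespace RL

lemma main_struct : ∃ K : ℕ, ∀ (p : ℕ) [Fact p.Prime] (A : Finset (ZMod p)), A.Nonempty →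
    ∀ α : ℝ, 0 < α → α < 1 → 256 ≤ α ^ 2 * A.card → 256 * A.card ≤ α ^ 2 * p →
    ∀ L0 : Finset (Aff p), L0 ⊆ S A α → L0.card = A.card →
    (∃ m0 : (ZMod p)ˣ, (α / 8) ^ K * A.card ≤ ((L0.filter fun g => g.m = m0).card : ℝ)) ∨
    (∃ z w : ZMod p, (α / 8) ^ K * A.card ≤ ((L0.filter fun g => g.act z = w).card : ℝ)) := by
  classical
  obtain ⟨C1, hC1⟩ := rich_bound
  obtain ⟨E, hE⟩ := affE_ex
  refine ⟨(4 * C1 + 3) * E + 1, ?_⟩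
  intro p _ A hA α hα hα1 hN hp L0 hL0 hcard
  have hNp : (0:ℝ) < A.card := by exact_mod_cast hA.card_pos
  obtain ⟨γ, rfl⟩ : ∃ γ : ℝ, α = 8 * γ := ⟨α / 8, by ring⟩
  have hγ0 : 0 < γ := by linarith
  have hγ1 : γ ≤ 1 / 2 := by linarith
  have hβ : (8 * γ) ^ 2 / 64 = γ ^ 2 := by ring
  have hγ : 8 * γ / 8 = γ := by ring
  rw [hγ]
  clear hγ
  obtain ⟨L', hL', hcL, hLL⟩ := rich_gowers A hA (8 * γ) hα L0 hL0
  rw [hβ, hcard] at hLL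
  rw [hcard] at hcL
  have hS := hC1 p A hA (γ ^ 2) (by positivity) (by nlinarith) (by
    nlinarith) (by nlinarith)
  rw [← pow_mul] at hS
  have h1 : γ * A.card ≤ L'.card := by
    refine le_trans ?_ hcL
    nlinarith
  have hL'0 : (0:ℝ) < L'.card := lt_of_lt_of_le (by positivity) h1
  have hne : L'.Nonempty := by
    rw [← Finset.card_pos]; exact_mod_cast hL'0
  set x : ℝ := ((L' * L'⁻¹).card : ℝ) with hx
  have hx0 : 0 ≤ x := by positivity
  have h2 : x * γ ^ (4 * C1 + 1) ≤ A.card := by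
    have h3 : (x * γ ^ (4 * C1 + 1)) * A.card ≤ A.card * A.card := by
      calc (x * γ ^ (4 * C1 + 1)) * A.card = (x * (γ * A.card)) * γ ^ (4 * C1) := by ring
        _ ≤ (x * (8 * γ / 4 * A.card)) * γ ^ (4 * C1) := by
          gcongr
          linarith
        _ ≤ ((S A (γ ^ 2)).card : ℝ) ^ 2 * γ ^ (4 * C1) := by gcongr
        _ = (((S A (γ ^ 2)).card : ℝ) * γ ^ (2 * C1)) ^ 2 := by ring
        _ ≤ (A.card : ℝ) ^ 2 := by gcongr
        _ = _ := by ring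
    exact le_of_mul_le_mul_right h3 hNp
  have h3 : x * γ ^ (4 * C1 + 2) ≤ L'.card := by
    calc x * γ ^ (4 * C1 + 2) = γ * (x * γ ^ (4 * C1 + 1)) := by ring
      _ ≤ γ * A.card := by gcongr
      _ ≤ _ := h1
  set M : ℝ := (γ ^ (4 * C1 + 2))⁻¹ with hM
  have hg : 0 < γ ^ (4 * C1 + 2) := by positivity
  have hM1 : 1 ≤ M := by
    rw [hM]
    exact (one_le_inv₀ hg).mpr (pow_le_one₀ hγ0.le (by linarith))
  have hMx : x ≤ M * L'.card := by
    rw [hM, inv_mul_eq_div, le_div_iff₀ hg]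
    exact h3
  have h4 : (2 * M) ^ E * γ ^ ((4 * C1 + 3) * E) ≤ 1 := by
    rw [pow_mul, ← mul_pow]
    apply pow_le_one₀ (by positivity)
    calc 2 * M * γ ^ (4 * C1 + 3) = 2 * γ * (M * γ ^ (4 * C1 + 2)) := by ring
      _ = 2 * γ := by rw [hM, inv_mul_cancel₀ hg.ne', mul_one]
      _ ≤ 1 := by linarith
  have fin : ∀ y : ℝ, ∀ n : ℝ, 0 ≤ y → n ≤ (2 * M) ^ E → (L'.card : ℝ) ≤ n * y →
      γ ^ ((4 * C1 + 3) * E + 1) * A.card ≤ y := by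
    intro y n hy hn h
    calc γ ^ ((4 * C1 + 3) * E + 1) * A.card = γ ^ ((4 * C1 + 3) * E) * (γ * A.card) := by ring
      _ ≤ γ ^ ((4 * C1 + 3) * E) * (n * y) :=
        mul_le_mul_of_nonneg_left (h1.trans h) (by positivity)
      _ ≤ γ ^ ((4 * C1 + 3) * E) * ((2 * M) ^ E * y) := by gcongr
      _ = ((2 * M) ^ E * γ ^ ((4 * C1 + 3) * E)) * y := by ring
      _ ≤ 1 * y := by gcongr
      _ = y := one_mul y
  have hsl : ((slopes L').card : ℝ) ≤ (2 * M) ^ E →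
      (∃ m0 : (ZMod p)ˣ, γ ^ ((4 * C1 + 3) * E + 1) * A.card ≤
        ((L0.filter fun g => g.m = m0).card : ℝ)) := by
    intro hs
    obtain ⟨m0, _, h5⟩ := exists_large_fiber (slopes L') L' Aff.m
      (fun g hg => mem_image_of_mem _ hg) hne
    refine ⟨m0, (fin _ _ (by positivity) hs h5).trans ?_⟩
    exact_mod_cast card_le_card (filter_subset_filter _ hL')
  rcases hE p L' hne M hM1 hMx with ⟨z, W, hW, hWm⟩ | h | h
  · right
    obtain ⟨w, _, h5⟩ := exists_large_fiber W L' (fun g => g.act z) hWm hne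
    refine ⟨z, w, (fin _ _ (by positivity) hW h5).trans ?_⟩
    exact_mod_cast card_le_card (filter_subset_filter _ hL')
  · exact Or.inl (hsl h)
  · left
    apply hsl
    have hpp : (0:ℝ) < p := lt_of_lt_of_le hNp (card_le_p A)
    have h6 : (L'.card : ℝ) ≤ p := by
      have : L'.card ≤ A.card := hcard ▸ card_le_card hL'
      exact le_trans (by exact_mod_cast this) (card_le_p A)
    have h7 : (p:ℝ) * (slopes L').card ≤ p * (2 * M) ^ E := by
      calc _ ≤ _ := h
        _ ≤ (2 * M) ^ E * p := by gcongr
        _ = _ := by ring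
    exact le_of_mul_le_mul_left h7 hpp

end RL
end

open RL
/-- **Theorem 1.7** (structured rich lines in grids over F_p): there are absolute
constants `C ≥ 1`, `C₀ ≥ 1`, `c > 0` such that for every prime `p`, `α ∈ (0,1)`,
`A ⊆ F_p` with `|A| ≤ p`, and every set `L` of `|A|` lines with nonzero slopes, each
containing at least `α|A|` points of `A×A`, with `α|A| ≥ C₀|A|^{1/2}·max{1, |A|/√p}`:
either at least `c·α^C·|A|` of the lines are parallel, `E⁺(A) ≥ c·α^C·|A|³` and the set
`B` of y-intercepts satisfies `E⁺(B) ≥ c·α^C·|A|³`; or at least `c·α^C·|A|` of the lines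
pass through a common point, some translate `A−s` satisfies `E^×(A−s) ≥ c·α^C·|A|³` and
the set `D` of slopes satisfies `E^×(D) ≥ c·α^C·|A|³`. -/
theorem rich_lines_in_grids :
    ∃ C C₀ c : ℝ, 1 ≤ C ∧ 1 ≤ C₀ ∧ 0 < c ∧
      ∀ (p : ℕ), p.Prime →
        ∀ α : ℝ, 0 < α → α < 1 →
          ∀ A : Finset (ZMod p), A.card ≤ p →
            ∀ L : Finset (ZMod p × ZMod p),
              (∀ l ∈ L, l.1 ≠ 0) →
              L.card = A.card →
              (∀ l ∈ L, α * (A.card : ℝ) ≤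
                (Set.ncard {q : ZMod p × ZMod p |
                  q.1 ∈ A ∧ q.2 ∈ A ∧ q.2 = l.1 * q.1 + l.2} : ℝ)) →
              C₀ * (A.card : ℝ) ^ ((1 : ℝ) / 2) *
                  max 1 ((A.card : ℝ) / (p : ℝ) ^ ((1 : ℝ) / 2)) ≤ α * (A.card : ℝ) →
              ((∃ m₀ : ZMod p,
                  c * α ^ C * (A.card : ℝ) ≤ ((L.filter fun l => l.1 = m₀).card : ℝ) ∧
                  c * α ^ C * (A.card : ℝ) ^ 3 ≤ (addE p A A : ℝ) ∧
                  c * α ^ C * (A.card : ℝ) ^ 3 ≤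
                    (addE p (L.image Prod.snd) (L.image Prod.snd) : ℝ)) ∨
               (∃ q : ZMod p × ZMod p,
                  c * α ^ C * (A.card : ℝ) ≤
                    ((L.filter fun l => q.2 = l.1 * q.1 + l.2).card : ℝ) ∧
                  ∃ s : ZMod p,
                    c * α ^ C * (A.card : ℝ) ^ 3 ≤
                      (mulE p (A.image fun a => a - s) (A.image fun a => a - s) : ℝ) ∧
                    c * α ^ C * (A.card : ℝ) ^ 3 ≤
                      (mulE p (L.image Prod.fst) (L.image Prod.fst) : ℝ))) := by
  classical
  obtain ⟨K, hK⟩ := RL.main_struct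
  refine ⟨((4 * K + 4 : ℕ) : ℝ), 16, (1 / 8) ^ (4 * K + 4), ?_, by norm_num, by positivity, ?_⟩
  · have : 1 ≤ 4 * K + 4 := by omega
    exact_mod_cast this
  intro p hp α hα hα1 A hAp L hL0 hcard hrich hbig
  have : Fact p.Prime := ⟨hp⟩
  rw [Real.rpow_natCast]
  have hcα : (1 / 8 : ℝ) ^ (4 * K + 4) * α ^ (4 * K + 4) = (α / 8) ^ (4 * K + 4) := by
    rw [← mul_pow]; ring
  rw [hcα]
  obtain ⟨γ, hγ⟩ : ∃ γ : ℝ, γ = α / 8 := ⟨_, rfl⟩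
  have hγ0 : 0 < γ := by rw [hγ]; positivity
  have hγ1 : γ ≤ 1 := by linarith
  rcases A.eq_empty_or_nonempty with rfl | hA
  · left
    exact ⟨0, by simp, by simp, by simp⟩
  have hNp : (0:ℝ) < A.card := by exact_mod_cast hA.card_pos
  have hpp : (0:ℝ) < p := by exact_mod_cast hp.pos
  rw [← Real.sqrt_eq_rpow, ← Real.sqrt_eq_rpow] at hbig
  have hs2 : Real.sqrt A.card ^ 2 = A.card := Real.sq_sqrt hNp.le
  have ht2 : Real.sqrt p ^ 2 = p := Real.sq_sqrt hpp.le
  have hs0 : 0 < Real.sqrt A.card := Real.sqrt_pos.mpr hNp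
  have ht0 : 0 < Real.sqrt p := Real.sqrt_pos.mpr hpp
  have hN : 256 ≤ α ^ 2 * (A.card : ℝ) := by
    have h1 : 16 * Real.sqrt A.card * 1 ≤ α * A.card :=
      le_trans (mul_le_mul_of_nonneg_left (le_max_left _ _) (by positivity)) hbig
    have h2 : 16 * Real.sqrt A.card ≤ (α * Real.sqrt A.card) * Real.sqrt A.card := by
      nlinarith
    have h3 := le_of_mul_le_mul_right h2 hs0
    nlinarith
  have hP : 256 * (A.card : ℝ) ≤ α ^ 2 * p := by
    have h1 : 16 * Real.sqrt A.card * (A.card / Real.sqrt p) ≤ α * A.card :=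
      le_trans (mul_le_mul_of_nonneg_left (le_max_right _ _) (by positivity)) hbig
    have h2 : 16 * Real.sqrt A.card * A.card ≤ (α * Real.sqrt p) * A.card := by
      rw [← mul_div_assoc, div_le_iff₀ ht0] at h1
      linarith
    have h3 := le_of_mul_le_mul_right h2 hNp
    have h4 : (16 * Real.sqrt A.card) ^ 2 ≤ (α * Real.sqrt p) ^ 2 := by gcongr
    rw [mul_pow, mul_pow, hs2, ht2] at h4
    linarith
  have h2α : 2 ≤ α * (A.card : ℝ) := by nlinarith
  -- transfer to the affine group
  set toP : Aff p → ZMod p × ZMod p := fun g => ((g.m : ZMod p), g.b) with htoP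
  have hinj : Function.Injective toP := by
    intro g h e
    simp only [htoP, Prod.mk.injEq] at e
    exact Aff.ext (Units.ext e.1) e.2
  set L0 : Finset (Aff p) := Finset.univ.filter fun g => toP g ∈ L with hL0def
  have himg : L0.image toP = L := by
    ext l
    simp only [Finset.mem_image, hL0def, Finset.mem_filter, Finset.mem_univ, true_and]
    constructor
    · rintro ⟨g, hg, rfl⟩
      exact hg
    · intro hl
      exact ⟨⟨Units.mk0 l.1 (hL0 l hl), l.2⟩, by simpa [htoP] using hl, by simp [htoP]⟩
  have hcard0 : L0.card = A.card := by
    rw [← hcard, ← himg, Finset.card_image_of_injective _ hinj]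
  have hmem : ∀ g ∈ L0, toP g ∈ L := by
    intro g hg
    exact (Finset.mem_filter.mp hg).2
  have hLS : L0 ⊆ S A α := by
    intro g hg
    rw [mem_S]
    refine (hrich _ (hmem g hg)).trans ?_
    have h1 : {q : ZMod p × ZMod p | q.1 ∈ A ∧ q.2 ∈ A ∧ q.2 = (toP g).1 * q.1 + (toP g).2} ⊆
        (((good A g).image fun a => (a, g.act a) : Finset (ZMod p × ZMod p)) : Set _) := by
      rintro ⟨a, b⟩ ⟨h1, h2, h3⟩
      simp only [htoP] at h1 h2 h3
      rw [Finset.mem_coe, Finset.mem_image]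
      refine ⟨a, ?_, ?_⟩
      · rw [mem_good, Aff.act, ← h3]
        exact ⟨h1, h2⟩
      · rw [Aff.act, ← h3]
    have h2 := Set.ncard_le_ncard h1 (Set.toFinite _)
    rw [Set.ncard_coe_finset] at h2
    exact_mod_cast h2.trans Finset.card_image_le
  have hfin : ∀ x : ℝ, 0 ≤ x → (γ ^ K * A.card * (γ * A.card)) ^ 4 ≤ (A.card : ℝ) ^ 5 * x →
      γ ^ (4 * K + 4) * (A.card : ℝ) ^ 3 ≤ x := by
    intro x _ h
    have h1 : (A.card : ℝ) ^ 5 * (γ ^ (4 * K + 4) * (A.card : ℝ) ^ 3) ≤ (A.card : ℝ) ^ 5 * x := by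
      refine le_trans (le_of_eq ?_) h
      ring
    exact le_of_mul_le_mul_left h1 (by positivity)
  have hγK : γ ^ (4 * K + 4) * (A.card : ℝ) ≤ γ ^ K * A.card := by
    have := pow_le_pow_of_le_one hγ0.le hγ1 (show K ≤ 4 * K + 4 by omega)
    exact mul_le_mul_of_nonneg_right this hNp.le
  rw [← hγ]
  have hKK := hK p A hA α hα hα1 hN hP L0 hLS hcard0
  rw [← hγ] at hKK
  rcases hKK with ⟨m0, hm0⟩ | ⟨z, w, hzw⟩
  · left
    have hen := par_energy A (L.image Prod.snd) α (γ ^ K * A.card) hα (by positivity)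
      (L0.filter fun g => g.m = m0) ((Finset.filter_subset _ _).trans hLS) m0
      (fun g hg => (Finset.mem_filter.mp hg).2)
      (fun g hg => Finset.mem_image.mpr ⟨_, hmem g (Finset.mem_filter.mp hg).1, rfl⟩) hm0
      (hcard0 ▸ Finset.card_filter_le _ _)
    have hle : (γ ^ K * A.card * (γ * A.card)) ^ 4 ≤ (γ ^ K * A.card * (α * A.card)) ^ 4 := by
      gcongr
      linarith
    refine ⟨m0, ?_, hfin _ (by positivity) (hle.trans hen.1),
      hfin _ (by positivity) (hle.trans hen.2)⟩
    refine (hγK.trans hm0).trans ?_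
    have : (L0.filter fun g => g.m = m0).card ≤ (L.filter fun l => l.1 = (m0 : ZMod p)).card := by
      apply Finset.card_le_card_of_injOn toP _ hinj.injOn
      intro g hg
      have hg := Finset.mem_filter.mp (Finset.mem_coe.mp hg)
      exact Finset.mem_coe.mpr (Finset.mem_filter.mpr ⟨hmem g hg.1, by simp [htoP, hg.2]⟩)
    exact_mod_cast this
  · right
    have hen := conc_energy A (L.image Prod.fst) α (γ ^ K * A.card) hα (by positivity) h2α
      (L0.filter fun g => g.act z = w) ((Finset.filter_subset _ _).trans hLS) z w
      (fun g hg => (Finset.mem_filter.mp hg).2)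
      (fun g hg => Finset.mem_image.mpr ⟨_, hmem g (Finset.mem_filter.mp hg).1, rfl⟩) hzw
      (hcard0 ▸ Finset.card_filter_le _ _)
    have hle : (γ ^ K * A.card * (γ * A.card)) ^ 4 ≤
        (γ ^ K * A.card * (α * A.card / 2)) ^ 4 := by
      have : γ * A.card ≤ α * A.card / 2 := by
        rw [hγ]; nlinarith
      gcongr
    refine ⟨(z, w), ?_, z, hfin _ (by positivity) (hle.trans hen.1),
      hfin _ (by positivity) (hle.trans hen.2)⟩
    refine (hγK.trans hzw).trans ?_
    have : (L0.filter fun g => g.act z = w).card ≤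
        (L.filter fun l => (z, w).2 = l.1 * (z, w).1 + l.2).card := by
      apply Finset.card_le_card_of_injOn toP _ hinj.injOn
      intro g hg
      have hg := Finset.mem_filter.mp (Finset.mem_coe.mp hg)
      exact Finset.mem_coe.mpr (Finset.mem_filter.mpr ⟨hmem g hg.1, hg.2.symm⟩)
    exact_mod_cast this
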